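/- arXiv:1103.0103 — 2 statements merged into one kernel-verified Lean document; each statement's English description precedes it below -/
import Mathlib

section
/- For every integer d ≥ 2 there exists a constant c > 0 such that for every odd positive integer w, the number κ*(d,w) of equivalence classes of centrally symmetric d-dimensional convex lattice polytopes P with |P ∩ ℤ^d| = w is finite and satisfies κ*(d,w) ≤ exp(c·w^{(d−1)/(d+1)}). -/
open MeasureTheory

noncomputable section

/-- The canonical embedding of integer vectors into real vectors. -/
def intVec {d : ℕ} (x : Fin d → ℤ) : Fin d → ℝ := fun i => (x i : ℝ)

/-- `P` is a convex lattice polytope: the convex hull of a finite set of lattice points. -/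
def IsConvexLatticePolytope (d : ℕ) (P : Set (Fin d → ℝ)) : Prop :=
  ∃ V : Finset (Fin d → ℤ), P = convexHull ℝ (intVec '' (V : Set (Fin d → ℤ)))

/-- `P` is `d`-dimensional: its affine span is all of `ℝ^d`. -/
def IsFullDim (d : ℕ) (P : Set (Fin d → ℝ)) : Prop :=
  affineSpan ℝ P = ⊤

/-- The set of lattice points of `P`. -/
def latticePts (d : ℕ) (P : Set (Fin d → ℝ)) : Set (Fin d → ℤ) :=
  {x | intVec x ∈ P}

/-- The lattice `ℤ^d` viewed inside `ℝ^d`. -/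
def latticeSet (d : ℕ) : Set (Fin d → ℝ) := Set.range (intVec (d := d))

/-- Two subsets of `ℝ^d` are lattice-equivalent if some affine bijection of `ℝ^d`
preserving `ℤ^d` maps one onto the other. -/
def LatticeEquiv (d : ℕ) (P₁ P₂ : Set (Fin d → ℝ)) : Prop :=
  ∃ σ : (Fin d → ℝ) ≃ᵃ[ℝ] (Fin d → ℝ), σ '' latticeSet d = latticeSet d ∧ P₂ = σ '' P₁

/-- The type of equivalence classes of `d`-dimensional convex lattice polytopes
satisfying the predicate `Q`, modulo lattice equivalence. -/
def ClassesType (d : ℕ) (Q : Set (Fin d → ℝ) → Prop) : Type :=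
  Quot (fun P₁ P₂ : {P : Set (Fin d → ℝ) // IsConvexLatticePolytope d P ∧ IsFullDim d P ∧ Q P} =>
    LatticeEquiv d P₁.1 P₂.1)

/-- `P` is centrally symmetric (with some center `c`, i.e. `P = 2c - P`). -/
def IsCentrallySymmetric (d : ℕ) (P : Set (Fin d → ℝ)) : Prop :=
  ∃ c : Fin d → ℝ, ∀ x, x ∈ P ↔ (2 : ℝ) • c - x ∈ P

section

/-- value of the affine function with slope `q.1` and constant `-q.2` -/
def affv {k : ℕ} (q : (Fin k → ℝ) × ℝ) (x : Fin k → ℝ) : ℝ := q.1 ⬝ᵥ x - q.2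

lemma affv_cont {k : ℕ} (q : (Fin k → ℝ) × ℝ) : Continuous (affv q) := by
  unfold affv dotProduct
  fun_prop

lemma affv_comb {k : ℕ} (q : (Fin k → ℝ) × ℝ) (x y : Fin k → ℝ) (a b : ℝ) (h : a + b = 1) :
    affv q (a • x + b • y) = a * affv q x + b * affv q y := by
  unfold affv
  rw [dotProduct_add, dotProduct_smul, dotProduct_smul]
  simp only [smul_eq_mul]
  have : b = 1 - a := by linarith
  subst this; ring

open Classical in
/-- the points of `L` lying on the graph of the affine function `q` -/
def touch {k : ℕ} (L : Finset (ℝ × (Fin k → ℝ))) (q : (Fin k → ℝ) × ℝ) :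
    Finset (ℝ × (Fin k → ℝ)) := L.filter (fun l => affv q l.2 = l.1)

def cellS {k : ℕ} (L : Finset (ℝ × (Fin k → ℝ))) (q : (Fin k → ℝ) × ℝ) : Set (Fin k → ℝ) :=
  convexHull ℝ (Prod.snd '' (touch L q : Set (ℝ × (Fin k → ℝ))))

def Facets {k : ℕ} (L : Finset (ℝ × (Fin k → ℝ))) : Set ((Fin k → ℝ) × ℝ) :=
  {q | (∀ l ∈ L, affv q l.2 ≤ l.1) ∧ 0 < volume (cellS L q)}

def domS {k : ℕ} (L : Finset (ℝ × (Fin k → ℝ))) : Set (Fin k → ℝ) :=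
  convexHull ℝ (Prod.snd '' (L : Set (ℝ × (Fin k → ℝ))))

variable {k : ℕ} {L : Finset (ℝ × (Fin k → ℝ))}

lemma mem_touch {q : (Fin k → ℝ) × ℝ} {l} : l ∈ touch L q ↔ l ∈ L ∧ affv q l.2 = l.1 := by
  simp [touch]

lemma cellS_compact (q) : IsCompact (cellS L q) :=
  ((Finset.finite_toSet _).image _).isCompact_convexHull (𝕜 := ℝ)

lemma domS_compact : IsCompact (domS L) :=
  ((Finset.finite_toSet _).image _).isCompact_convexHull (𝕜 := ℝ)

lemma cellS_sub (q) : cellS L q ⊆ domS L := by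
  apply convexHull_mono
  apply Set.image_mono
  intro l hl
  exact (mem_touch.1 hl).1

lemma affv_convex_le (q q' : (Fin k → ℝ) × ℝ) : Convex ℝ {x | affv q' x ≤ affv q x} := by
  intro x hx y hy a b ha hb hab
  simp only [Set.mem_ofPred_eq] at *
  rw [affv_comb _ _ _ _ _ hab, affv_comb _ _ _ _ _ hab]
  nlinarith

/-- on the cell of `q`, other minorants are below `q` -/
lemma cellS_le {q q' : (Fin k → ℝ) × ℝ} (h' : ∀ l ∈ L, affv q' l.2 ≤ l.1) {x} (hx : x ∈ cellS L q) :
    affv q' x ≤ affv q x := by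
  have : cellS L q ⊆ {x | affv q' x ≤ affv q x} := by
    apply convexHull_min _ (affv_convex_le _ _)
    rintro _ ⟨l, hl, rfl⟩
    have := mem_touch.1 hl
    simp only [Set.mem_ofPred_eq]
    rw [this.2]; exact h' _ this.1
  exact this hx

lemma affv_eq_null {q q' : (Fin k → ℝ) × ℝ} (h : q ≠ q') :
    volume {x : Fin k → ℝ | affv q x = affv q' x} = 0 := by
  let S : AffineSubspace ℝ (Fin k → ℝ) :=
    { carrier := {x | affv q x = affv q' x}
      smul_vsub_vadd_mem' := by
        intro c p1 p2 p3 h1 h2 h3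
        simp only [Set.mem_ofPred_eq, affv, vsub_eq_sub, vadd_eq_add, dotProduct_add,
          dotProduct_smul, dotProduct_sub, smul_eq_mul] at *
        have e1 : q.1 ⬝ᵥ p1 - q.1 ⬝ᵥ p2 = q'.1 ⬝ᵥ p1 - q'.1 ⬝ᵥ p2 := by linarith
        rw [e1]; linarith }
  have := Measure.addHaar_affineSubspace volume S
  apply this
  intro hT
  have hall : ∀ x, affv q x = affv q' x := by
    intro x
    have : x ∈ S := by rw [hT]; trivial
    exact this
  apply h
  have h0 := hall 0
  simp [affv] at h0
  ext i
  · have := hall (Pi.single i 1)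
    simp [affv, h0] at this
    exact this
  · exact h0

lemma cellS_aedisj {q q' : (Fin k → ℝ) × ℝ} (hq : q ∈ Facets L) (hq' : q' ∈ Facets L) (h : q ≠ q') :
    AEDisjoint volume (cellS L q) (cellS L q') := by
  refine measure_mono_null ?_ (affv_eq_null h)
  intro x hx
  exact le_antisymm (cellS_le hq.1 hx.2) (cellS_le hq'.1 hx.1)

lemma facets_finite : (Facets L).Finite := by
  apply Set.Finite.of_finite_image (f := touch L)
  · exact (Finset.finite_toSet L.powerset).subset (by
      rintro _ ⟨q, _, rfl⟩
      simp only [Finset.coe_powerset, Set.mem_preimage, Set.mem_powerset_iff, Finset.coe_subset]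
      intro l hl; exact (mem_touch.1 hl).1)
  · intro q hq q' hq' h
    by_contra hne
    have h1 := cellS_aedisj hq hq' hne
    have : cellS L q = cellS L q' := by unfold cellS; rw [h]
    rw [this] at h1
    have h2 := hq'.2
    rw [AEDisjoint, Set.inter_self] at h1
    rw [h1] at h2; exact lt_irrefl _ h2

lemma facets_touch_ne {q} (hq : q ∈ Facets L) : ∃ l ∈ L, affv q l.2 = l.1 := by
  by_contra hcon
  push Not at hcon
  have : touch L q = ∅ := by
    ext l; simp only [mem_touch, Finset.notMem_empty, iff_false, not_and]; exact hcon l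
  have h2 := hq.2
  simp [cellS, this] at h2

lemma facets_slope_inj {q q'} (hq : q ∈ Facets L) (hq' : q' ∈ Facets L) (h : q.1 = q'.1) : q = q' := by
  obtain ⟨l, hl, e⟩ := facets_touch_ne hq
  obtain ⟨l', hl', e'⟩ := facets_touch_ne hq'
  have h1 := hq.1 l' hl'
  have h2 := hq'.1 l hl
  unfold affv at *
  rw [h] at e h1
  exact Prod.ext h (by linarith)

/-- if `x` is in the cell then the graph point is in the hull -/
lemma cellS_mem_hull {q} {x} (hx : x ∈ cellS L q) :
    (affv q x, x) ∈ convexHull ℝ (L : Set (ℝ × (Fin k → ℝ))) := by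
  have : cellS L q ⊆ {x | (affv q x, x) ∈ convexHull ℝ (L : Set (ℝ × (Fin k → ℝ)))} := by
    apply convexHull_min
    · rintro _ ⟨l, hl, rfl⟩
      have := mem_touch.1 hl
      simp only [Set.mem_ofPred_eq, this.2]
      exact subset_convexHull _ _ this.1
    · intro x hx y hy a b ha hb hab
      simp only [Set.mem_ofPred_eq] at *
      rw [affv_comb _ _ _ _ _ hab]
      have := convex_convexHull ℝ (L : Set (ℝ × (Fin k → ℝ))) hx hy ha hb hab
      simpa using this
  exact this hx

lemma minorant_hull {q : (Fin k → ℝ) × ℝ} (h : ∀ l ∈ L, affv q l.2 ≤ l.1) {y}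
    (hy : y ∈ convexHull ℝ (L : Set (ℝ × (Fin k → ℝ)))) : affv q y.2 ≤ y.1 := by
  have : convexHull ℝ (L : Set (ℝ × (Fin k → ℝ))) ⊆ {y | affv q y.2 ≤ y.1} := by
    apply convexHull_min
    · intro l hl; exact h l hl
    · intro x hx y hy a b ha hb hab
      simp only [Set.mem_ofPred_eq, Prod.snd_add, Prod.smul_snd, Prod.fst_add, Prod.smul_fst,
        smul_eq_mul] at *
      rw [affv_comb _ _ _ _ _ hab]
      nlinarith
  exact this hy

lemma domS_eq : domS L = Prod.snd '' (convexHull ℝ (L : Set (ℝ × (Fin k → ℝ)))) := by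
  unfold domS
  exact ((LinearMap.snd ℝ ℝ (Fin k → ℝ)).image_convexHull _).symm

lemma support_exists {x} (hx : x ∈ interior (domS L)) :
    ∃ q : (Fin k → ℝ) × ℝ, (∀ l ∈ L, affv q l.2 ≤ l.1) ∧ x ∈ cellS L q := by
  classical
  set K := convexHull ℝ (L : Set (ℝ × (Fin k → ℝ))) with hK
  have Kc : IsCompact K := (Finset.finite_toSet L).isCompact_convexHull (𝕜 := ℝ)
  have Kconv : Convex ℝ K := convex_convexHull _ _
  -- the minimum over the fiber
  have hfib : ∃ t0, (t0, x) ∈ K ∧ ∀ t, (t, x) ∈ K → t0 ≤ t := by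
    have c1 : IsCompact (K ∩ {y | y.2 = x}) :=
      Kc.inter_right (isClosed_eq continuous_snd continuous_const)
    have n1 : (K ∩ {y | y.2 = x}).Nonempty := by
      have := interior_subset hx
      rw [domS_eq] at this
      obtain ⟨y, hy, e⟩ := this
      exact ⟨y, hy, e⟩
    obtain ⟨y, ⟨hy, e⟩, hmin⟩ := c1.exists_isMinOn n1 continuous_fst.continuousOn
    refine ⟨y.1, ?_, ?_⟩
    · rw [← show y.2 = x from e]; exact hy
    · intro t ht
      exact hmin ⟨ht, rfl⟩
  obtain ⟨t0, ht0, hmin⟩ := hfib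
  let U : Set (ℝ × (Fin k → ℝ)) := {y | ∃ s ≤ y.1, (s, y.2) ∈ K}
  have Uconv : Convex ℝ U := by
    rintro y ⟨s, hs, hsK⟩ y' ⟨s', hs', hsK'⟩ a b ha hb hab
    refine ⟨a * s + b * s', ?_, ?_⟩
    · simp only [Prod.fst_add, Prod.smul_fst, smul_eq_mul]
      gcongr
    · have := Kconv hsK hsK' ha hb hab
      simpa using this
  -- an upper bound of the heights
  obtain ⟨M, hM⟩ : ∃ M : ℝ, ∀ y ∈ K, y.1 ≤ M := by
    obtain ⟨M, hM⟩ := (Kc.image continuous_fst).bddAbove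
    exact ⟨M, fun y hy => hM ⟨y, hy, rfl⟩⟩
  have hbig : ((max M t0) + 1, x) ∈ interior U := by
    rw [mem_interior]
    refine ⟨Set.Ioi M ×ˢ interior (domS L), ?_, isOpen_Ioi.prod isOpen_interior, ?_⟩
    · rintro ⟨t, y⟩ ⟨ht, hy⟩
      have := interior_subset hy
      rw [domS_eq] at this
      obtain ⟨z, hz, e⟩ := this
      refine ⟨z.1, (hM z hz).trans (le_of_lt ht), ?_⟩
      rw [← show z.2 = y from e]; exact hz
    · refine ⟨?_, hx⟩
      simp only [Set.mem_Ioi]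
      have := le_max_left M t0
      linarith
  have hnot : (t0, x) ∉ interior U := by
    intro hin
    have : ∀ᶠ t in nhds t0, (t, x) ∈ U := by
      have hc : ContinuousAt (fun t : ℝ => (t, x)) t0 := by fun_prop
      exact hc.eventually (mem_interior_iff_mem_nhds.1 hin)
    obtain ⟨ε, hε, hb⟩ := Metric.eventually_nhds_iff.1 this
    obtain ⟨s, hs, hsK⟩ := hb (y := t0 - ε / 2) (by simp [abs_of_pos hε]; linarith)
    have := hmin s hsK
    simp only at hs
    linarith
  obtain ⟨f, hf⟩ := geometric_hahn_banach_open_point Uconv.interior isOpen_interior hnot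
  have hfU : ∀ u ∈ U, f u ≤ f (t0, x) := by
    intro u hu
    have h1 : u ∈ closure (interior U) := by
      rw [Uconv.closure_interior_eq_closure_of_nonempty_interior ⟨_, hbig⟩]
      exact subset_closure hu
    have h2 : closure (interior U) ⊆ {u | f u ≤ f (t0, x)} := by
      apply closure_minimal
      · intro u hu; exact (hf u hu).le
      · exact isClosed_le f.continuous continuous_const
    exact h2 h1
  set α := f (1, 0) with hα
  let g : (Fin k → ℝ) →ₗ[ℝ] ℝ := f.toLinearMap.comp (LinearMap.inr ℝ ℝ (Fin k → ℝ))
  have hdec : ∀ t y, f (t, y) = α * t + g y := by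
    intro t y
    have : (t, y) = t • ((1 : ℝ), (0 : Fin k → ℝ)) + ((0 : ℝ), y) := by simp
    rw [this, map_add, map_smul]
    simp [g, hα, mul_comm]
  have hαneg : α < 0 := by
    have := hf _ hbig
    rw [hdec, hdec] at this
    have h3 := le_max_right M t0
    nlinarith
  let c : Fin k → ℝ := fun i => g (Pi.single i 1)
  have hg : ∀ y, g y = c ⬝ᵥ y := by
    intro y
    rw [LinearMap.pi_apply_eq_sum_univ g y]
    simp only [dotProduct, smul_eq_mul, c]
    apply Finset.sum_congr rfl
    intro i _
    rw [mul_comm]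
    congr 2
    ext j
    simp [Pi.single_apply, eq_comm]
  let p : Fin k → ℝ := (-α)⁻¹ • c
  have hp : ∀ y, p ⬝ᵥ y = (-α)⁻¹ * g y := by
    intro y; simp only [p, smul_dotProduct, hg, smul_eq_mul]
  let q : (Fin k → ℝ) × ℝ := (p, p ⬝ᵥ x - t0)
  have hqx : affv q x = t0 := by simp [affv, q]
  have hq : ∀ l ∈ L, affv q l.2 ≤ l.1 := by
    intro l hl
    have hlU : l ∈ U := ⟨l.1, le_rfl, subset_convexHull _ _ hl⟩
    have h1 := hfU _ hlU
    rw [show l = (l.1, l.2) from rfl, hdec, hdec] at h1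
    simp only [affv, q, hp]
    have h2 : (-α)⁻¹ * (g l.2 - g x) ≤ (-α)⁻¹ * ((-α) * (l.1 - t0)) := by
      apply mul_le_mul_of_nonneg_left _ (inv_nonneg.2 (by linarith))
      linarith
    rw [inv_mul_cancel_left₀ (by linarith)] at h2
    linarith
  refine ⟨q, hq, ?_⟩
  obtain ⟨w, hw0, hw1, hwx⟩ := (Finset.mem_convexHull (R := ℝ)).1 ht0
  rw [Finset.centerMass_eq_of_sum_1 _ _ hw1] at hwx
  have hsum : ∑ l ∈ L, w l * (l.1 - affv q l.2) = 0 := by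
    have e1 : ∑ l ∈ L, w l * l.1 = t0 := by
      have := congrArg Prod.fst hwx
      simpa [Prod.fst_sum] using this
    have e2 : ∑ l ∈ L, w l • l.2 = x := by
      have := congrArg Prod.snd hwx
      simpa [Prod.snd_sum] using this
    have e3 : ∑ l ∈ L, w l * affv q l.2 = affv q x := by
      simp only [affv, mul_sub, Finset.sum_sub_distrib, ← Finset.sum_mul, hw1, one_mul]
      rw [← e2, dotProduct_sum]
      simp [dotProduct_smul]
    simp only [mul_sub, Finset.sum_sub_distrib, e1, e3, hqx, sub_self]
  have hz := (Finset.sum_eq_zero_iff_of_nonneg (fun l hl =>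
    mul_nonneg (hw0 l hl) (by linarith [hq l hl]))).1 hsum
  have hx2 : x = ∑ l ∈ touch L q, w l • l.2 := by
    have e2 : ∑ l ∈ L, w l • l.2 = x := by
      have := congrArg Prod.snd hwx
      simpa [Prod.snd_sum] using this
    rw [← e2]
    symm
    apply Finset.sum_subset
    · intro l hl; exact (mem_touch.1 hl).1
    · intro l hl hn
      have : w l = 0 := by
        rcases mul_eq_zero.1 (hz l hl) with h | h
        · exact h
        · exact absurd (mem_touch.2 ⟨hl, by linarith⟩) hn
      simp [this]
  have hw1' : ∑ l ∈ touch L q, w l = 1 := by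
    rw [← hw1]
    apply Finset.sum_subset
    · intro l hl; exact (mem_touch.1 hl).1
    · intro l hl hn
      rcases mul_eq_zero.1 (hz l hl) with h | h
      · exact h
      · exact absurd (mem_touch.2 ⟨hl, by linarith⟩) hn
  rw [hx2]
  apply (convex_convexHull ℝ _).sum_mem (fun l hl => hw0 l (mem_touch.1 hl).1) hw1'
  intro l hl
  exact subset_convexHull _ _ ⟨l, hl, rfl⟩

lemma cover_of_interior (hne : (interior (domS L)).Nonempty) :
    domS L = ⋃ q ∈ Facets L, cellS L q := by
  classical
  apply Set.Subset.antisymm _ (Set.iUnion₂_subset fun q _ => cellS_sub q)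
  have Ucl : IsClosed (⋃ q ∈ Facets L, cellS L q) :=
    facets_finite.isClosed_biUnion fun q _ => (cellS_compact q).isClosed
  have hint : interior (domS L) ⊆ ⋃ q ∈ Facets L, cellS L q := by
    have hop : IsOpen (interior (domS L) \ ⋃ q ∈ Facets L, cellS L q) :=
      isOpen_interior.sdiff Ucl
    have hnull : volume (interior (domS L) \ ⋃ q ∈ Facets L, cellS L q) = 0 := by
      have hsub : (interior (domS L) \ ⋃ q ∈ Facets L, cellS L q) ⊆
          ⋃ W ∈ L.powerset.filter (fun W : Finset (ℝ × (Fin k → ℝ)) =>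
            volume (convexHull ℝ (Prod.snd '' (W : Set (ℝ × (Fin k → ℝ))))) = 0),
            convexHull ℝ (Prod.snd '' (W : Set (ℝ × (Fin k → ℝ)))) := by
        rintro x ⟨hx, hn⟩
        obtain ⟨q, hq, hxq⟩ := support_exists hx
        simp only [Set.mem_iUnion, not_exists] at hn
        rw [Set.mem_iUnion₂]
        refine ⟨touch L q, ?_, hxq⟩
        simp only [Finset.mem_filter, Finset.mem_powerset]
        refine ⟨fun l hl => (mem_touch.1 hl).1, ?_⟩
        by_contra hpos
        exact hn q ⟨hq, pos_iff_ne_zero.2 hpos⟩ hxq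
      refine measure_mono_null hsub ?_
      refine (measure_biUnion_null_iff (Finset.countable_toSet _)).2 ?_
      intro W hW
      exact (Finset.mem_filter.1 hW).2
    have := hop.eq_empty_of_measure_zero hnull
    exact Set.sdiff_eq_empty.1 this
  have hcl : domS L = closure (interior (domS L)) := by
    have hc : Convex ℝ (domS L) := convex_convexHull ℝ _
    rw [hc.closure_interior_eq_closure_of_nonempty_interior hne,
      domS_compact.isClosed.closure_eq]
  rw [hcl]
  exact closure_minimal hint Ucl

lemma volume_domS_eq (hne : (interior (domS L)).Nonempty) :
    volume (domS L) = ∑ q ∈ (facets_finite (L := L)).toFinset, volume (cellS L q) := by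
  rw [cover_of_interior hne]
  have : (⋃ q ∈ Facets L, cellS L q) = ⋃ q ∈ (facets_finite (L := L)).toFinset, cellS L q := by
    simp
  rw [this]
  apply measure_biUnion_finset₀
  · intro q hq q' hq' h
    exact cellS_aedisj (by simpa using hq) (by simpa using hq') h
  · intro q _
    exact (cellS_compact q).isClosed.nullMeasurableSet

end

section

variable {k : ℕ} {L : Finset (ℝ × (Fin k → ℝ))}

lemma conv_int_nonempty {C : Set (Fin k → ℝ)} (hv : Convex ℝ C) (hp : 0 < volume C) :
    (interior C).Nonempty := by
  by_contra h
  rw [Set.not_nonempty_iff_eq_empty] at h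
  have h1 := hv.addHaar_frontier volume
  have : C ⊆ frontier C := by
    intro x hx
    rw [frontier, h]
    exact ⟨subset_closure hx, by simp⟩
  exact hp.ne' (measure_mono_null this h1)

lemma zero_of_setIntegral_zero {C : Set (Fin k → ℝ)} (hc : IsCompact C) (hv : Convex ℝ C)
    (hp : 0 < volume C) {f : (Fin k → ℝ) → ℝ} (hf : Continuous f) (h0 : ∀ x, 0 ≤ f x)
    (hi : ∫ x in C, f x = 0) : ∀ x ∈ C, f x = 0 := by
  have hint : IntegrableOn f C := hf.continuousOn.integrableOn_compact hc
  have hae := (integral_eq_zero_iff_of_nonneg_ae (Filter.Eventually.of_forall h0) hint).1 hi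
  have hop : IsOpen (interior C ∩ {x | f x ≠ 0}) :=
    isOpen_interior.inter (isOpen_ne_fun hf continuous_const)
  have hnull : volume (interior C ∩ {x | f x ≠ 0}) = 0 := by
    have h2 := (ae_restrict_iff' hc.measurableSet).1 hae
    rw [ae_iff] at h2
    refine measure_mono_null ?_ h2
    rintro x ⟨hx, hne⟩
    simp only [Set.mem_ofPred_eq, Classical.not_imp]
    exact ⟨interior_subset hx, hne⟩
  have he := hop.eq_empty_of_measure_zero hnull
  have h3 : closure (interior C) ⊆ {x | f x = 0} := by
    apply closure_minimal _ (isClosed_eq hf continuous_const)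
    intro x hx
    by_contra hne
    have : x ∈ interior C ∩ {x | f x ≠ 0} := ⟨hx, hne⟩
    rw [he] at this; exact this
  intro x hx
  apply h3
  rw [hv.closure_interior_eq_closure_of_nonempty_interior (conv_int_nonempty hv hp)]
  exact subset_closure hx

lemma setIntegral_cells {ι : Type*} (I : Finset ι) (C : ι → Set (Fin k → ℝ))
    (hc : ∀ p ∈ I, IsCompact (C p)) (hd : (I : Set ι).Pairwise (Function.onFun (AEDisjoint volume) C))
    {f : (Fin k → ℝ) → ℝ} (hf : Continuous f) :
    ∫ x in ⋃ p ∈ I, C p, f x = ∑ p ∈ I, ∫ x in C p, f x := by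
  classical
  induction I using Finset.induction_on with
  | empty => simp
  | insert i I hi ih =>
    rw [Finset.sum_insert hi, Finset.set_biUnion_insert, ← ih]
    · have hcI : IsCompact (⋃ p ∈ I, C p) :=
        I.isCompact_biUnion fun p hp => hc p (Finset.mem_insert_of_mem hp)
      apply setIntegral_union₀
      · rw [AEDisjoint]
        rw [Set.inter_iUnion₂]
        refine (measure_biUnion_null_iff (Finset.countable_toSet _)).2 ?_
        intro p hp
        exact hd (by simp) (by simp only [Finset.coe_insert]; exact Or.inr hp)
          (by rintro rfl; exact hi hp)
      · exact hcI.measurableSet.nullMeasurableSet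
      · exact hf.continuousOn.integrableOn_compact (hc i (by simp))
      · exact hf.continuousOn.integrableOn_compact hcI
    · exact fun p hp => hc p (Finset.mem_insert_of_mem hp)
    · exact hd.mono (by simp)

lemma ot_unique (I : Finset (Fin k → ℝ)) (D : Set (Fin k → ℝ)) (hD : Convex ℝ D)
    (a b : (Fin k → ℝ) → ℝ) (C C' : (Fin k → ℝ) → Set (Fin k → ℝ))
    (hc : ∀ p ∈ I, IsCompact (C p)) (hv : ∀ p ∈ I, Convex ℝ (C p)) (hp : ∀ p ∈ I, 0 < volume (C p))
    (hc' : ∀ p ∈ I, IsCompact (C' p)) (hv' : ∀ p ∈ I, Convex ℝ (C' p))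
    (hvol : ∀ p ∈ I, volume (C p) = volume (C' p))
    (hu : D = ⋃ p ∈ I, C p) (hu' : D = ⋃ p ∈ I, C' p)
    (hd : (I : Set _).Pairwise (Function.onFun (AEDisjoint volume) C))
    (hd' : (I : Set _).Pairwise (Function.onFun (AEDisjoint volume) C'))
    (hC : ∀ p ∈ I, ∀ x ∈ C p, ∀ q ∈ I, affv (q, a q) x ≤ affv (p, a p) x)
    (hC' : ∀ p ∈ I, ∀ x ∈ C' p, ∀ q ∈ I, affv (q, b q) x ≤ affv (p, b p) x) :
    ∃ c, ∀ p ∈ I, a p = b p + c := by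
  classical
  rcases I.eq_empty_or_nonempty with rfl | hne
  · exact ⟨0, by simp⟩
  have hp' : ∀ p ∈ I, 0 < volume (C' p) := fun p h => hvol p h ▸ hp p h
  let F : (Fin k → ℝ) → ℝ := fun x => I.sup' hne (fun q => affv (q, a q) x)
  let G : (Fin k → ℝ) → ℝ := fun x => I.sup' hne (fun q => affv (q, b q) x)
  have Fc : Continuous F := Continuous.finset_sup'_apply hne fun q _ => affv_cont _
  have Gc : Continuous G := Continuous.finset_sup'_apply hne fun q _ => affv_cont _
  have Fge : ∀ p ∈ I, ∀ x, affv (p, a p) x ≤ F x := fun p hp x =>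
    Finset.le_sup' (fun q => affv (q, a q) x) hp
  have Gge : ∀ p ∈ I, ∀ x, affv (p, b p) x ≤ G x := fun p hp x =>
    Finset.le_sup' (fun q => affv (q, b q) x) hp
  have Feq : ∀ p ∈ I, ∀ x ∈ C p, F x = affv (p, a p) x := fun p hp x hx =>
    le_antisymm (Finset.sup'_le _ _ fun q hq => hC p hp x hx q hq) (Fge p hp x)
  have Geq : ∀ p ∈ I, ∀ x ∈ C' p, G x = affv (p, b p) x := fun p hp x hx =>
    le_antisymm (Finset.sup'_le _ _ fun q hq => hC' p hp x hx q hq) (Gge p hp x)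
  have FF : ∑ p ∈ I, ∫ x in C p, F x = ∑ p ∈ I, ∫ x in C' p, F x := by
    rw [← setIntegral_cells I C hc hd Fc, ← setIntegral_cells I C' hc' hd' Fc, ← hu, ← hu']
  have GG : ∑ p ∈ I, ∫ x in C p, G x = ∑ p ∈ I, ∫ x in C' p, G x := by
    rw [← setIntegral_cells I C hc hd Gc, ← setIntegral_cells I C' hc' hd' Gc, ← hu, ← hu']
  have io : ∀ {f : (Fin k → ℝ) → ℝ}, Continuous f → ∀ p ∈ I, IntegrableOn f (C p) :=
    fun hf p hp => hf.continuousOn.integrableOn_compact (hc p hp)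
  have io' : ∀ {f : (Fin k → ℝ) → ℝ}, Continuous f → ∀ p ∈ I, IntegrableOn f (C' p) :=
    fun hf p hp => hf.continuousOn.integrableOn_compact (hc' p hp)
  have e1 : ∀ p ∈ I, ∫ x in C p, F x = ∫ x in C p, affv (p, a p) x := fun p hp =>
    setIntegral_congr_fun (hc p hp).measurableSet (Feq p hp)
  have e2 : ∀ p ∈ I, ∫ x in C' p, G x = ∫ x in C' p, affv (p, b p) x := fun p hp =>
    setIntegral_congr_fun (hc' p hp).measurableSet (Geq p hp)
  have e3 : ∀ p ∈ I, ∫ x in C p, affv (p, b p) x =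
      (∫ x in C p, affv (p, a p) x) + (a p - b p) * (volume (C p)).toReal := by
    intro p hp
    have : ∀ x, affv (p, b p) x = affv (p, a p) x + (a p - b p) := by intro x; simp [affv]
    simp only [this]
    rw [integral_add (io (affv_cont _) p hp) (io continuous_const p hp)]
    simp [mul_comm, Measure.real]
  have e3' : ∀ p ∈ I, ∫ x in C' p, affv (p, b p) x =
      (∫ x in C' p, affv (p, a p) x) + (a p - b p) * (volume (C p)).toReal := by
    intro p hp
    have : ∀ x, affv (p, b p) x = affv (p, a p) x + (a p - b p) := by intro x; simp [affv]
    simp only [this]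
    rw [integral_add (io' (affv_cont _) p hp) (io' continuous_const p hp), hvol p hp]
    simp [mul_comm, Measure.real]
  have t1 : ∀ p ∈ I, 0 ≤ ∫ x in C' p, (F x - affv (p, a p) x) := fun p hp =>
    integral_nonneg fun x => sub_nonneg.2 (Fge p hp x)
  have t2 : ∀ p ∈ I, 0 ≤ ∫ x in C p, (G x - affv (p, b p) x) := fun p hp =>
    integral_nonneg fun x => sub_nonneg.2 (Gge p hp x)
  have s1 : ∀ p ∈ I, ∫ x in C' p, (F x - affv (p, a p) x) =
      (∫ x in C' p, F x) - ∫ x in C' p, affv (p, a p) x := fun p hp =>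
    integral_sub (io' Fc p hp) (io' (affv_cont _) p hp)
  have s2 : ∀ p ∈ I, ∫ x in C p, (G x - affv (p, b p) x) =
      (∫ x in C p, G x) - ∫ x in C p, affv (p, b p) x := fun p hp =>
    integral_sub (io Gc p hp) (io (affv_cont _) p hp)
  have tot : ∑ p ∈ I, (∫ x in C' p, (F x - affv (p, a p) x)) = 0 := by
    have n2 := Finset.sum_nonneg t2
    have n1 := Finset.sum_nonneg t1
    rw [Finset.sum_congr rfl s2, Finset.sum_sub_distrib, GG, Finset.sum_congr rfl e2,
      Finset.sum_congr rfl e3, Finset.sum_congr rfl e3', Finset.sum_add_distrib,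
      Finset.sum_add_distrib] at n2
    refine le_antisymm ?_ n1
    rw [Finset.sum_congr rfl s1, Finset.sum_sub_distrib, ← FF, Finset.sum_congr rfl e1]
    linarith
  have z1 := (Finset.sum_eq_zero_iff_of_nonneg t1).1 tot
  have key : ∀ p ∈ I, ∀ x ∈ C' p, F x = affv (p, a p) x := by
    intro p hp x hx
    have := zero_of_setIntegral_zero (hc' p hp) (hv' p hp) (hp' p hp)
      (Fc.sub (affv_cont (p, a p))) (fun x => sub_nonneg.2 (Fge p hp x)) (z1 p hp) x hx
    simp only [Pi.sub_apply] at this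
    linarith
  have diff : ∀ p ∈ I, ∀ x ∈ C' p, G x - F x = a p - b p := by
    intro p hp x hx
    rw [key p hp x hx, Geq p hp x hx]; simp [affv]
  obtain ⟨p0, hp0⟩ := hne
  refine ⟨a p0 - b p0, ?_⟩
  intro p1 hp1
  by_contra hcon
  have hcon' : a p1 - b p1 ≠ a p0 - b p0 := fun h => hcon (by linarith)
  let A : Set (Fin k → ℝ) := ⋃ p ∈ I.filter (fun p => a p - b p = a p0 - b p0), C' p
  let B : Set (Fin k → ℝ) := ⋃ p ∈ I.filter (fun p => ¬ (a p - b p = a p0 - b p0)), C' p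
  have Acl : IsClosed A := (Finset.isCompact_biUnion _ fun p hp =>
    hc' p (Finset.mem_filter.1 hp).1).isClosed
  have Bcl : IsClosed B := (Finset.isCompact_biUnion _ fun p hp =>
    hc' p (Finset.mem_filter.1 hp).1).isClosed
  have hne' : ∀ p ∈ I, (C' p).Nonempty := fun p h => nonempty_of_measure_ne_zero (hp' p h).ne'
  have hDD : ∀ p ∈ I, C' p ⊆ D := fun p h => by
    rw [hu']; exact Set.subset_biUnion_of_mem (u := C') h
  have hcov : D ⊆ A ∪ B := by
    intro x hx
    rw [hu'] at hx
    obtain ⟨p, hp, hxp⟩ := Set.mem_iUnion₂.1 hx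
    by_cases h : a p - b p = a p0 - b p0
    · left; exact Set.mem_iUnion₂.2 ⟨p, Finset.mem_filter.2 ⟨hp, h⟩, hxp⟩
    · right; exact Set.mem_iUnion₂.2 ⟨p, Finset.mem_filter.2 ⟨hp, h⟩, hxp⟩
  have hA : (D ∩ A).Nonempty := by
    obtain ⟨x, hx⟩ := hne' p0 hp0
    exact ⟨x, hDD p0 hp0 hx, Set.mem_iUnion₂.2 ⟨p0, Finset.mem_filter.2 ⟨hp0, rfl⟩, hx⟩⟩
  have hB : (D ∩ B).Nonempty := by
    obtain ⟨x, hx⟩ := hne' p1 hp1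
    exact ⟨x, hDD p1 hp1 hx, Set.mem_iUnion₂.2 ⟨p1, Finset.mem_filter.2 ⟨hp1, hcon'⟩, hx⟩⟩
  obtain ⟨x, -, hxA, hxB⟩ := isPreconnected_closed_iff.1 hD.isPreconnected A B Acl Bcl hcov hA hB
  obtain ⟨p, hp, hxp⟩ := Set.mem_iUnion₂.1 hxA
  obtain ⟨q, hq, hxq⟩ := Set.mem_iUnion₂.1 hxB
  rw [Finset.mem_filter] at hp hq
  apply hq.2
  rw [← diff q hq.1 x hxq, diff p hp.1 x hxp, hp.2]

end

section

variable {k : ℕ} {L L' : Finset (ℝ × (Fin k → ℝ))}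

lemma determine (hD : domS L = domS L') (hne : (interior (domS L)).Nonempty)
    (hdata : (fun q => (q.1, volume (cellS L q))) '' Facets L =
      (fun q => (q.1, volume (cellS L' q))) '' Facets L') :
    ∃ c : ℝ, (∀ q ∈ Facets L, (q.1, q.2 - c) ∈ Facets L') ∧
      (∀ q ∈ Facets L', (q.1, q.2 + c) ∈ Facets L) := by
  classical
  let I : Finset (Fin k → ℝ) := (facets_finite (L := L)).toFinset.image Prod.fst
  have hI : ∀ p, p ∈ I ↔ ∃ a, (p, a) ∈ Facets L := by
    intro p; simp [I]
  have h1 : ∀ p, p ∈ I → ∃ a, ∃ b, (p, a) ∈ Facets L ∧ (p, b) ∈ Facets L' ∧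
      volume (cellS L (p, a)) = volume (cellS L' (p, b)) := by
    intro p hp
    obtain ⟨a, ha⟩ := (hI p).1 hp
    have : (p, volume (cellS L (p, a))) ∈ (fun q => (q.1, volume (cellS L' q))) '' Facets L' := by
      rw [← hdata]; exact ⟨(p, a), ha, rfl⟩
    obtain ⟨q, hq, e⟩ := this
    simp only [Prod.mk.injEq] at e
    refine ⟨a, q.2, ha, ?_, ?_⟩
    · rw [← e.1]; exact hq
    · rw [← e.2, ← e.1]
  choose! a b ha hb hab using h1
  have hL : ∀ q ∈ Facets L, q.1 ∈ I ∧ q = (q.1, a q.1) := by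
    intro q hq
    have : q.1 ∈ I := (hI _).2 ⟨q.2, hq⟩
    exact ⟨this, facets_slope_inj hq (ha _ this) rfl⟩
  have hL' : ∀ q ∈ Facets L', q.1 ∈ I ∧ q = (q.1, b q.1) := by
    intro q hq
    have : (q.1, volume (cellS L' q)) ∈ (fun q => (q.1, volume (cellS L q))) '' Facets L := by
      rw [hdata]; exact ⟨q, hq, rfl⟩
    obtain ⟨q', hq', e⟩ := this
    simp only [Prod.mk.injEq] at e
    have : q.1 ∈ I := by rw [← e.1]; exact (hL q' hq').1
    exact ⟨this, facets_slope_inj hq (hb _ this) rfl⟩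
  have hu : domS L = ⋃ p ∈ I, cellS L (p, a p) := by
    rw [cover_of_interior hne]
    ext x
    simp only [Set.mem_iUnion]
    constructor
    · rintro ⟨q, hq, hx⟩
      obtain ⟨h1, h2⟩ := hL q hq
      exact ⟨q.1, h1, by rw [← h2]; exact hx⟩
    · rintro ⟨p, hp, hx⟩
      exact ⟨_, ha p hp, hx⟩
  have hu' : domS L = ⋃ p ∈ I, cellS L' (p, b p) := by
    rw [hD, cover_of_interior (hD ▸ hne)]
    ext x
    simp only [Set.mem_iUnion]
    constructor
    · rintro ⟨q, hq, hx⟩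
      obtain ⟨h1, h2⟩ := hL' q hq
      exact ⟨q.1, h1, by rw [← h2]; exact hx⟩
    · rintro ⟨p, hp, hx⟩
      exact ⟨_, hb p hp, hx⟩
  obtain ⟨c, hc⟩ := ot_unique I (domS L) (convex_convexHull ℝ _) a b
    (fun p => cellS L (p, a p)) (fun p => cellS L' (p, b p))
    (fun p _ => cellS_compact _) (fun p _ => convex_convexHull ℝ _) (fun p hp => (ha p hp).2)
    (fun p _ => cellS_compact _) (fun p _ => convex_convexHull ℝ _) hab hu hu'
    (fun p hp q hq hpq => cellS_aedisj (ha p hp) (ha q hq) (fun h => hpq (congrArg Prod.fst h)))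
    (fun p hp q hq hpq => cellS_aedisj (hb p hp) (hb q hq) (fun h => hpq (congrArg Prod.fst h)))
    (fun p hp x hx q hq => cellS_le (ha q hq).1 hx)
    (fun p hp x hx q hq => cellS_le (hb q hq).1 hx)
  refine ⟨c, ?_, ?_⟩
  · intro q hq
    obtain ⟨h1, h2⟩ := hL q hq
    have h3 := congrArg Prod.snd h2
    simp only at h3
    have : q.2 - c = b q.1 := by rw [h3, hc _ h1]; ring
    rw [this]; exact hb _ h1
  · intro q hq
    obtain ⟨h1, h2⟩ := hL' q hq
    have h3 := congrArg Prod.snd h2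
    simp only at h3
    have : q.2 + c = a q.1 := by rw [h3, hc _ h1]
    rw [this]; exact ha _ h1

lemma recover (hne : (interior (domS L)).Nonempty)
    (hsym : ∀ y ∈ convexHull ℝ (L : Set (ℝ × (Fin k → ℝ))), -y ∈ convexHull ℝ (L : Set (ℝ × (Fin k → ℝ))))
    (t : ℝ) (x : Fin k → ℝ) :
    (t, x) ∈ convexHull ℝ (L : Set (ℝ × (Fin k → ℝ))) ↔
      x ∈ domS L ∧ (∀ q ∈ Facets L, affv q x ≤ t) ∧ (∀ q ∈ Facets L, affv q (-x) ≤ -t) := by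
  constructor
  · intro h
    refine ⟨?_, fun q hq => minorant_hull hq.1 h, fun q hq => minorant_hull hq.1 (hsym _ h)⟩
    rw [domS_eq]; exact ⟨_, h, rfl⟩
  · rintro ⟨hx, h1, h2⟩
    have hnx : -x ∈ domS L := by
      rw [domS_eq] at hx ⊢
      obtain ⟨y, hy, e⟩ := hx
      exact ⟨-y, hsym _ hy, by simp [e]⟩
    have hx' := hx
    rw [cover_of_interior hne] at hx hnx
    obtain ⟨q, hq, hxq⟩ := Set.mem_iUnion₂.1 hx
    obtain ⟨q', hq', hxq'⟩ := Set.mem_iUnion₂.1 hnx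
    have m1 := cellS_mem_hull hxq
    have m2 := hsym _ (cellS_mem_hull hxq')
    simp only [Prod.neg_mk, neg_neg] at m2
    have b1 := h1 q hq
    have b2 := h2 q' hq'
    have hcv : Convex ℝ {s : ℝ | (s, x) ∈ convexHull ℝ (L : Set (ℝ × (Fin k → ℝ)))} := by
      intro s hs s' hs' a b ha hb hab
      have := convex_convexHull ℝ (L : Set (ℝ × (Fin k → ℝ))) hs hs' ha hb hab
      have e : a • x + b • x = x := by rw [← add_smul, hab, one_smul]
      simpa [e] using this
    exact hcv.ordConnected.out m1 m2 ⟨b1, by linarith⟩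

lemma code_inj (hD : domS L = domS L') (hne : (interior (domS L)).Nonempty)
    (hsym : ∀ y ∈ convexHull ℝ (L : Set (ℝ × (Fin k → ℝ))), -y ∈ convexHull ℝ (L : Set (ℝ × (Fin k → ℝ))))
    (hsym' : ∀ y ∈ convexHull ℝ (L' : Set (ℝ × (Fin k → ℝ))), -y ∈ convexHull ℝ (L' : Set (ℝ × (Fin k → ℝ))))
    (hdata : (fun q => (q.1, volume (cellS L q))) '' Facets L =
      (fun q => (q.1, volume (cellS L' q))) '' Facets L')
    (σ : ℝ) (h1 : ∀ y ∈ convexHull ℝ (L : Set (ℝ × (Fin k → ℝ))), σ ≤ y.1)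
    (h2 : ∃ y ∈ convexHull ℝ (L : Set (ℝ × (Fin k → ℝ))), y.1 = σ)
    (h1' : ∀ y ∈ convexHull ℝ (L' : Set (ℝ × (Fin k → ℝ))), σ ≤ y.1)
    (h2' : ∃ y ∈ convexHull ℝ (L' : Set (ℝ × (Fin k → ℝ))), y.1 = σ) :
    convexHull ℝ (L : Set (ℝ × (Fin k → ℝ))) = convexHull ℝ (L' : Set (ℝ × (Fin k → ℝ))) := by
  obtain ⟨c, hc1, hc2⟩ := determine hD hne hdata
  have hne' : (interior (domS L')).Nonempty := hD ▸ hne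
  have hle : c ≤ 0 := by
    obtain ⟨y, hy, e⟩ := h2'
    have hyD : y.2 ∈ domS L := by rw [hD, domS_eq]; exact ⟨y, hy, rfl⟩
    rw [cover_of_interior hne] at hyD
    obtain ⟨q, hq, hx⟩ := Set.mem_iUnion₂.1 hyD
    have m1 := h1 _ (cellS_mem_hull hx)
    have m2 := minorant_hull (hc1 q hq).1 hy
    simp only [affv] at m1 m2
    linarith
  have hge : 0 ≤ c := by
    obtain ⟨y, hy, e⟩ := h2
    have hyD : y.2 ∈ domS L' := by rw [← hD, domS_eq]; exact ⟨y, hy, rfl⟩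
    rw [cover_of_interior hne'] at hyD
    obtain ⟨q, hq, hx⟩ := Set.mem_iUnion₂.1 hyD
    have m1 := h1' _ (cellS_mem_hull hx)
    have m2 := minorant_hull (hc2 q hq).1 hy
    simp only [affv] at m1 m2
    linarith
  obtain rfl : c = 0 := le_antisymm hle hge
  have hF : Facets L = Facets L' := by
    ext q
    constructor
    · intro hq; simpa using hc1 q hq
    · intro hq; simpa using hc2 q hq
  ext ⟨t, x⟩
  rw [recover hne hsym, recover hne' hsym', hD, hF]

end

section

def updMap {k : ℕ} (i : Fin k) (q : (Fin k → ℝ) × ℝ) (x : Fin k → ℝ) : Fin k → ℝ :=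
  Function.update x i (affv q x)

section
variable {k : ℕ} {L : Finset (ℝ × (Fin k → ℝ))}

lemma updMap_eq (i : Fin k) (q : (Fin k → ℝ) × ℝ) (x : Fin k → ℝ) :
    updMap i q x = Pi.single i (-q.2) + Matrix.mulVecLin (Matrix.updateRow 1 i q.1) x := by
  ext j
  rw [Pi.add_apply, Matrix.mulVecLin_apply, Matrix.mulVec]
  by_cases h : j = i
  · subst h
    simp [updMap, affv]; ring
  · simp [updMap, h, Matrix.updateRow_ne, dotProduct, Matrix.one_apply]

lemma updMap_det (i : Fin k) (v : Fin k → ℝ) :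
    (Matrix.updateRow (1 : Matrix (Fin k) (Fin k) ℝ) i v).det = v i := by
  have := Matrix.det_updateRow_sum (1 : Matrix (Fin k) (Fin k) ℝ) i v
  have e : ∑ j, v j • (1 : Matrix (Fin k) (Fin k) ℝ) j = v := by
    ext j
    simp [Finset.sum_apply, Matrix.one_apply]
  rw [e] at this
  simpa using this

lemma updMap_vol (i : Fin k) (q : (Fin k → ℝ) × ℝ) (C : Set (Fin k → ℝ)) :
    volume (updMap i q '' C) = ENNReal.ofReal |q.1 i| * volume C := by
  have : updMap i q '' C = (fun y => Pi.single i (-q.2) + y) ''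
      ((Matrix.mulVecLin (Matrix.updateRow 1 i q.1)) '' C) := by
    rw [Set.image_image]
    apply Set.image_congr
    intro x _
    exact updMap_eq i q x
  rw [this, Set.image_add_left, measure_preimage_add, Measure.addHaar_image_linearMap]
  congr 3
  rw [← updMap_det i q.1, ← Matrix.toLin'_apply', LinearMap.det_toLin']

lemma updMap_cont (i : Fin k) (q : (Fin k → ℝ) × ℝ) : Continuous (updMap i q) := by
  unfold updMap
  exact continuous_id.update i (affv_cont q)

lemma affv_shift {i : Fin k} {q : (Fin k → ℝ) × ℝ} {x x' : Fin k → ℝ} (h : ∀ j, j ≠ i → x j = x' j) :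
    affv q x' = affv q x + (x' i - x i) * q.1 i := by
  have : x' = x + Pi.single i (x' i - x i) := by
    ext j
    by_cases hj : j = i
    · subst hj; simp
    · simp [hj, h j hj]
  unfold affv
  conv_lhs => rw [this]
  rw [dotProduct_add, dotProduct_single]; ring

lemma updMap_aedisj {i : Fin k} {p q} (hp : p ∈ Facets L) (hq : q ∈ Facets L) (hpq : p ≠ q)
    (hs : 0 < p.1 i * q.1 i) :
    AEDisjoint volume (updMap i p '' cellS L p) (updMap i q '' cellS L q) := by
  have hsub : (updMap i p '' cellS L p) ∩ (updMap i q '' cellS L q) ⊆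
      updMap i p '' (cellS L p ∩ cellS L q) := by
    rintro _ ⟨⟨x, hx, rfl⟩, ⟨x', hx', e⟩⟩
    have h1 : ∀ j, j ≠ i → x j = x' j := by
      intro j hj
      have := congrFun e j
      simpa [updMap, hj] using this.symm
    have h2 : affv q x' = affv p x := by
      have := congrFun e i
      simpa [updMap] using this
    have a1 := cellS_le hp.1 hx'
    have a2 := cellS_le hq.1 hx
    have b1 := affv_shift (q := p) h1
    have b2 := affv_shift (q := q) h1
    have : x' i - x i = 0 := by
      have c1 : (x' i - x i) * p.1 i ≤ 0 := by linarith
      have c2 : 0 ≤ (x' i - x i) * q.1 i := by linarith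
      by_contra hne
      have : 0 < (x' i - x i)^2 * (p.1 i * q.1 i) := by positivity
      nlinarith
    have : x = x' := by
      ext j
      by_cases hj : j = i
      · subst hj; linarith
      · exact h1 j hj
    subst this
    exact ⟨x, ⟨hx, hx'⟩, rfl⟩
  refine measure_mono_null hsub ?_
  rw [updMap_vol]
  have := cellS_aedisj hp hq hpq
  rw [AEDisjoint] at this
  rw [this, mul_zero]

lemma sum_slope_half (i : Fin k) (I : Finset ((Fin k → ℝ) × ℝ)) (hI : ∀ q ∈ I, q ∈ Facets L)
    (hs : ∀ p ∈ I, ∀ q ∈ I, 0 < p.1 i * q.1 i) (B : Set (Fin k → ℝ)) (hB : Convex ℝ B)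
    (hL : ∀ l ∈ L, Function.update l.2 i l.1 ∈ B) :
    ∑ q ∈ I, ENNReal.ofReal |q.1 i| * volume (cellS L q) ≤ volume B := by
  have : volume (⋃ q ∈ I, updMap i q '' cellS L q) = ∑ q ∈ I, volume (updMap i q '' cellS L q) := by
    apply measure_biUnion_finset₀
    · intro p hp q hq hpq
      exact updMap_aedisj (hI _ hp) (hI _ hq) hpq (hs _ hp _ hq)
    · intro q _
      exact (((cellS_compact q).image (updMap_cont i q)).measurableSet).nullMeasurableSet
  simp only [← updMap_vol]
  rw [← this]
  apply measure_mono
  apply Set.iUnion₂_subset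
  intro q hq
  rintro _ ⟨x, hx, rfl⟩
  have hc : Convex ℝ {x | updMap i q x ∈ B} := by
    intro x hx y hy a b ha hb hab
    have := hB hx hy ha hb hab
    simp only [Set.mem_ofPred_eq]
    convert this using 1
    ext j
    by_cases hj : j = i
    · subst hj; simp [updMap, affv_comb _ _ _ _ _ hab]
    · simp [updMap, hj]
  have : cellS L q ⊆ {x | updMap i q x ∈ B} := by
    apply convexHull_min _ hc
    rintro _ ⟨l, hl, rfl⟩
    have := mem_touch.1 hl
    simp only [Set.mem_ofPred_eq, updMap]
    rw [this.2]; exact hL _ this.1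
  exact this hx

lemma sum_slope (i : Fin k) (B : Set (Fin k → ℝ)) (hB : Convex ℝ B)
    (hL : ∀ l ∈ L, Function.update l.2 i l.1 ∈ B) :
    ∑ q ∈ (facets_finite (L := L)).toFinset, ENNReal.ofReal |q.1 i| * volume (cellS L q)
      ≤ 2 * volume B := by
  classical
  set I := (facets_finite (L := L)).toFinset
  have hI : ∀ q ∈ I, q ∈ Facets L := by intro q hq; simpa [I] using hq
  have h1 := sum_slope_half i (I.filter (fun q => 0 < q.1 i)) (fun q hq => hI q (Finset.mem_filter.1 hq).1)
    (fun p hp q hq => mul_pos (Finset.mem_filter.1 hp).2 (Finset.mem_filter.1 hq).2) B hB hL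
  have h2 := sum_slope_half i (I.filter (fun q => q.1 i < 0)) (fun q hq => hI q (Finset.mem_filter.1 hq).1)
    (fun p hp q hq => mul_pos_of_neg_of_neg (Finset.mem_filter.1 hp).2 (Finset.mem_filter.1 hq).2) B hB hL
  rw [two_mul]
  refine le_trans ?_ (add_le_add h1 h2)
  rw [Finset.sum_filter, Finset.sum_filter, ← Finset.sum_add_distrib]
  apply Finset.sum_le_sum
  intro q hq
  rcases lt_trichotomy (q.1 i) 0 with h | h | h
  · simp [h, not_lt.2 h.le]
  · simp [h]
  · simp [h, not_lt.2 h.le]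

end

end

section

/-- vertices of the standard simplex -/
def stdV (k : ℕ) : Fin (k+1) → (Fin k → ℝ) := Fin.cons 0 (fun i => Pi.single i 1)

/-- volume of the standard simplex -/
def cvol (k : ℕ) : ENNReal := volume (convexHull ℝ (Set.range (stdV k)))

lemma cvol_ne_top (k : ℕ) : cvol k ≠ ⊤ := by
  have : IsCompact (convexHull ℝ (Set.range (stdV k))) :=
    (Set.finite_range _).isCompact_convexHull (𝕜 := ℝ)
  exact this.measure_lt_top.ne

lemma cvol_pos (k : ℕ) : 0 < cvol k := by
  have hsub : Set.pi Set.univ (fun _ : Fin k => Set.Icc (0:ℝ) (1/(k+1))) ⊆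
      convexHull ℝ (Set.range (stdV k)) := by
    intro x hx
    have hx' : ∀ i, 0 ≤ x i ∧ x i ≤ 1/(k+1) := by
      intro i; have := hx i (Set.mem_univ _); simpa using this
    have hs : ∑ i, x i ≤ 1 := by
      calc ∑ i, x i ≤ ∑ i : Fin k, (1/(k+1) : ℝ) := Finset.sum_le_sum (fun i _ => (hx' i).2)
        _ = k / (k+1) := by simp; ring
        _ ≤ 1 := by rw [div_le_one (by positivity)]; linarith
    have := (convex_convexHull ℝ (Set.range (stdV k))).sum_mem (t := Finset.univ)
      (w := (Fin.cons (1 - ∑ i, x i) x : Fin (k+1) → ℝ)) (z := stdV k) ?_ ?_ ?_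
    · convert this using 1
      rw [Fin.sum_univ_succ]
      ext j
      simp [stdV, Finset.sum_apply, Pi.single_apply]
    · intro i _
      refine Fin.cases ?_ ?_ i
      · simp [hs]
      · intro i; simp [(hx' i).1]
    · rw [Fin.sum_univ_succ]; simp
    · intro i _
      exact subset_convexHull _ _ ⟨i, rfl⟩
  refine lt_of_lt_of_le ?_ (measure_mono hsub)
  rw [volume_pi_pi]
  simp only [Real.volume_Icc, sub_zero]
  rw [Finset.prod_const, pos_iff_ne_zero]
  apply pow_ne_zero
  simp; positivity

lemma simplex_vol {k : ℕ} (p : Fin (k+1) → (Fin k → ℤ)) :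
    ∃ n : ℕ, volume (convexHull ℝ (Set.range (fun i => intVec (p i)))) = n * cvol k := by
  let M : Matrix (Fin k) (Fin k) ℤ := fun i j => p j.succ i - p 0 i
  let f : (Fin k → ℝ) →ₗ[ℝ] (Fin k → ℝ) := Matrix.mulVecLin (M.map (Int.cast : ℤ → ℝ))
  have h1 : Set.range (fun i => intVec (p i)) = (fun y => intVec (p 0) + y) '' (f '' Set.range (stdV k)) := by
    rw [Set.image_image, ← Set.range_comp]
    congr 1
    ext i j
    refine Fin.cases ?_ ?_ i
    · simp [stdV]
    · intro i
      simp [stdV, f, intVec, M]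
      change (p i.succ j : ℝ) = (p 0 j : ℝ) + ((p i.succ j - p 0 j : ℤ) : ℝ)
      push_cast; ring
  have h2 : convexHull ℝ (Set.range (fun i => intVec (p i))) =
      (fun y => intVec (p 0) + y) '' (f '' convexHull ℝ (Set.range (stdV k))) := by
    rw [h1, LinearMap.image_convexHull]
    have := convexHull_vadd (intVec (p 0)) (f '' Set.range (stdV k)) (𝕜 := ℝ)
    exact this
  refine ⟨M.det.natAbs, ?_⟩
  rw [h2, Set.image_add_left, measure_preimage_add, Measure.addHaar_image_linearMap, cvol]
  congr 1
  have : LinearMap.det f = (M.det : ℝ) := by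
    simp only [f]
    rw [← Matrix.toLin'_apply', LinearMap.det_toLin']
    exact (Int.cast_det M).symm
  rw [this, ← Int.cast_abs, Int.abs_eq_natAbs, Int.cast_natCast, ENNReal.ofReal_natCast]

lemma generic_heights {k : ℕ} (W : Finset (Fin k → ℝ)) : ∃ ω : (Fin k → ℝ) → ℝ,
    ∀ q : (Fin k → ℝ) × ℝ, ∀ U ⊆ W, (∀ v ∈ U, affv q v = ω v) → U.card ≤ k + 1 := by
  classical
  let ι := {U : Finset (Fin k → ℝ) // U ∈ W.powerset ∧ k + 1 < U.card}
  have : Finite ι := Finite.of_injective (β := W.powerset) (fun U => ⟨U.1, U.2.1⟩) (by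
    intro U U' h; exact Subtype.ext (by simpa using h))
  have hc : ∀ U : ι, ∃ f : (Fin k → ℝ) → ℝ, ∑ e ∈ U.1, f e • e = 0 ∧ ∑ e ∈ U.1, f e = 0 ∧
      ∃ x ∈ U.1, f x ≠ 0 := by
    intro U
    apply Module.exists_nontrivial_relation_sum_zero_of_finrank_succ_lt_card
    simpa using U.2.2
  choose c h1 h2 h3 using hc
  obtain ⟨ω, hω⟩ := Module.Dual.exists_forall_ne_zero_of_forall_exists (K := ℝ)
    (M := (Fin k → ℝ) → ℝ)
    (fun U : ι => ∑ e ∈ U.1, c U e • (LinearMap.proj e : ((Fin k → ℝ) → ℝ) →ₗ[ℝ] ℝ)) (by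
      intro U
      obtain ⟨x, hx, hx0⟩ := h3 U
      refine ⟨Pi.single x 1, ?_⟩
      simp [LinearMap.sum_apply, Pi.single_apply, hx, hx0])
  refine ⟨ω, ?_⟩
  intro q U hU hq
  by_contra hcon
  push Not at hcon
  let U' : ι := ⟨U, Finset.mem_powerset.2 hU, hcon⟩
  apply hω U'
  simp only [LinearMap.sum_apply, LinearMap.smul_apply, LinearMap.proj_apply, smul_eq_mul]
  have : ∑ e ∈ U'.1, c U' e * ω e = ∑ e ∈ U'.1, (q.1 ⬝ᵥ (c U' e • e) - c U' e * q.2) := by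
    apply Finset.sum_congr rfl
    intro e he
    rw [← hq e he, affv, dotProduct_smul]; simp; ring
  rw [this, Finset.sum_sub_distrib, ← dotProduct_sum, h1, ← Finset.sum_mul, h2]
  simp

lemma small_vol {k : ℕ} (U : Finset (Fin k → ℝ)) (hU : ∀ v ∈ U, ∃ z : Fin k → ℤ, v = intVec z)
    (hc : U.card ≤ k + 1) : ∃ n : ℕ, volume (convexHull ℝ (U : Set (Fin k → ℝ))) = n * cvol k := by
  rcases U.eq_empty_or_nonempty with rfl | hne
  · exact ⟨0, by simp⟩
  obtain ⟨u0, hu0⟩ := hne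
  have : ∃ g : Fin (k+1) → (Fin k → ℝ), Set.range g = (U : Set _) := by
    let e := U.equivFin
    refine ⟨fun i => if h : i.1 < U.card then (e.symm ⟨i.1, h⟩).1 else u0, ?_⟩
    ext v
    constructor
    · rintro ⟨i, rfl⟩
      dsimp only
      split_ifs
      · exact (e.symm _).2
      · exact hu0
    · intro hv
      refine ⟨⟨(e ⟨v, hv⟩).1, lt_of_lt_of_le (e ⟨v, hv⟩).2 hc⟩, ?_⟩
      simp
  obtain ⟨g, hg⟩ := this
  have : ∀ i, ∃ z : Fin k → ℤ, g i = intVec z := by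
    intro i; apply hU
    have : g i ∈ (U : Set _) := by rw [← hg]; exact ⟨i, rfl⟩
    exact this
  choose p hp using this
  obtain ⟨n, hn⟩ := simplex_vol p
  refine ⟨n, ?_⟩
  rw [← hg, ← hn]
  congr 3
  ext1 i; exact hp i

lemma lattice_vol {k : ℕ} (W : Finset (Fin k → ℝ)) (hW : ∀ v ∈ W, ∃ z : Fin k → ℤ, v = intVec z) :
    ∃ n : ℕ, volume (convexHull ℝ (W : Set (Fin k → ℝ))) = n * cvol k := by
  classical
  by_cases h0 : volume (convexHull ℝ (W : Set (Fin k → ℝ))) = 0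
  · exact ⟨0, by simp [h0]⟩
  have hint := conv_int_nonempty (convex_convexHull ℝ (W : Set (Fin k → ℝ))) (pos_iff_ne_zero.2 h0)
  obtain ⟨ω, hω⟩ := generic_heights W
  let L : Finset (ℝ × (Fin k → ℝ)) := W.image (fun v => (ω v, v))
  have hD : domS L = convexHull ℝ (W : Set (Fin k → ℝ)) := by
    unfold domS
    congr 1
    ext v; simp [L]
  have hne : (interior (domS L)).Nonempty := by rw [hD]; exact hint
  have hcell : ∀ q, ∃ n : ℕ, volume (cellS L q) = n * cvol k := by
    intro q
    have e : cellS L q = convexHull ℝ (((touch L q).image Prod.snd : Finset _) : Set (Fin k → ℝ)) := by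
      unfold cellS; rw [Finset.coe_image]
    have hsub : (touch L q).image Prod.snd ⊆ W := by
      intro v hv
      obtain ⟨l, hl, rfl⟩ := Finset.mem_image.1 hv
      obtain ⟨u, hu, rfl⟩ := Finset.mem_image.1 (mem_touch.1 hl).1
      exact hu
    rw [e]
    apply small_vol
    · intro v hv; exact hW v (hsub hv)
    · apply hω q _ hsub
      intro v hv
      obtain ⟨l, hl, rfl⟩ := Finset.mem_image.1 hv
      have h2 := (mem_touch.1 hl).2
      obtain ⟨u, hu, rfl⟩ := Finset.mem_image.1 (mem_touch.1 hl).1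
      exact h2
  choose n hn using hcell
  refine ⟨∑ q ∈ (facets_finite (L := L)).toFinset, n q, ?_⟩
  rw [← hD, volume_domS_eq hne]
  push_cast
  rw [Finset.sum_mul]
  exact Finset.sum_congr rfl (fun q _ => hn q)

end

section

section
variable {k : ℕ} {L : Finset (ℝ × (Fin k → ℝ))}

lemma cell_int (hint : ∀ l ∈ L, ∃ (a : ℤ) (z : Fin k → ℤ), l = ((a : ℝ), intVec z)) {q}
    (hq : q ∈ Facets L) : ∃ z : Fin (k+1) → ℤ, 1 ≤ z 0 ∧
      (volume (cellS L q)).toReal = z 0 * (cvol k).toReal ∧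
      ∀ i : Fin k, q.1 i * (volume (cellS L q)).toReal = z i.succ * (cvol k).toReal := by
  classical
  have e : cellS L q = convexHull ℝ (((touch L q).image Prod.snd : Finset _) : Set (Fin k → ℝ)) := by
    unfold cellS; rw [Finset.coe_image]
  have hc0 : 0 < (cvol k).toReal := ENNReal.toReal_pos (cvol_pos k).ne' (cvol_ne_top k)
  obtain ⟨n, hn⟩ := lattice_vol ((touch L q).image Prod.snd) (by
    intro v hv
    obtain ⟨l, hl, rfl⟩ := Finset.mem_image.1 hv
    obtain ⟨a, z, rfl⟩ := hint l (mem_touch.1 hl).1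
    exact ⟨z, rfl⟩)
  have hi : ∀ i : Fin k, ∃ m : ℤ, q.1 i * (volume (cellS L q)).toReal = m * (cvol k).toReal := by
    intro i
    obtain ⟨m, hm⟩ := lattice_vol ((touch L q).image (fun l => Function.update l.2 i l.1)) (by
      intro v hv
      obtain ⟨l, hl, rfl⟩ := Finset.mem_image.1 hv
      obtain ⟨a, z, rfl⟩ := hint l (mem_touch.1 hl).1
      refine ⟨Function.update z i a, ?_⟩
      ext j
      by_cases hj : j = i
      · subst hj; simp [intVec]
      · simp [intVec, hj])
    let f : (Fin k → ℝ) →ᵃ[ℝ] (Fin k → ℝ) :=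
      (Matrix.mulVecLin (Matrix.updateRow 1 i q.1)).toAffineMap +
        AffineMap.const ℝ (Fin k → ℝ) (Pi.single i (-q.2) : Fin k → ℝ)
    have hf : ∀ x, f x = updMap i q x := by
      intro x
      rw [updMap_eq, add_comm]; rfl
    have h2 : updMap i q '' cellS L q =
        convexHull ℝ (((touch L q).image (fun l => Function.update l.2 i l.1) : Finset _) : Set (Fin k → ℝ)) := by
      have : updMap i q = f := by ext1 x; exact (hf x).symm
      rw [this, cellS, AffineMap.image_convexHull, Set.image_image, Finset.coe_image]
      congr 1
      apply Set.image_congr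
      intro l hl
      rw [hf, updMap, (mem_touch.1 hl).2]
    rw [← h2, updMap_vol] at hm
    have hm' : |q.1 i| * (volume (cellS L q)).toReal = m * (cvol k).toReal := by
      have := congrArg ENNReal.toReal hm
      simpa [ENNReal.toReal_mul] using this
    rcases abs_choice (q.1 i) with h | h
    · rw [h] at hm'; exact ⟨m, by simpa using hm'⟩
    · rw [h] at hm'; exact ⟨-m, by push_cast; linarith⟩
  choose m hm using hi
  refine ⟨Fin.cons n m, ?_, ?_, ?_⟩
  · simp only [Fin.cons_zero]
    have : n ≠ 0 := by
      rintro rfl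
      have h := hq.2
      rw [e, hn] at h; simp at h
    omega
  · rw [e, hn, ENNReal.toReal_mul]; simp
  · intro i; simpa using hm i

lemma box_vol (g : Fin k → ℝ) (hg : ∀ i, 0 ≤ g i) :
    (volume (Set.pi Set.univ (fun j => Set.Icc (-(g j)) (g j)))).toReal = 2^k * ∏ j, g j := by
  rw [volume_pi_pi]
  simp only [Real.volume_Icc, sub_neg_eq_add]
  rw [ENNReal.toReal_prod]
  have : ∀ j, (ENNReal.ofReal (g j + g j)).toReal = 2 * g j := by
    intro j; rw [ENNReal.toReal_ofReal (by have := hg j; linarith)]; ring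
  simp only [this]
  rw [Finset.prod_mul_distrib]; simp

lemma box_fin (g : Fin k → ℝ) :
    volume (Set.pi Set.univ (fun j => Set.Icc (-(g j)) (g j))) ≠ ⊤ := by
  have : IsCompact (Set.pi Set.univ (fun j => Set.Icc (-(g j)) (g j))) :=
    isCompact_univ_pi (fun j => isCompact_Icc)
  exact this.measure_lt_top.ne

lemma box_convex (g : Fin k → ℝ) : Convex ℝ (Set.pi Set.univ (fun j => Set.Icc (-(g j)) (g j))) :=
  convex_pi (fun j _ => convex_Icc _ _)

lemma code_exists (hint : ∀ l ∈ L, ∃ (a : ℤ) (z : Fin k → ℤ), l = ((a : ℝ), intVec z))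
    (hne : (interior (domS L)).Nonempty) (g : Fin (k+1) → ℕ)
    (h0 : ∀ l ∈ L, |l.1| ≤ g 0) (h1 : ∀ l ∈ L, ∀ i, |l.2 i| ≤ g (Fin.succ i)) :
    ∃ S : Finset (Fin (k+1) → ℤ), (∀ z ∈ S, 1 ≤ z 0) ∧
      (fun q => (q.1, volume (cellS L q))) '' Facets L =
        (fun z : Fin (k+1) → ℤ => ((fun i : Fin k => (z i.succ : ℝ) / (z 0 : ℝ)),
          ENNReal.ofReal ((z 0 : ℝ) * (cvol k).toReal))) '' (S : Set (Fin (k+1) → ℤ)) ∧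
      ∀ j, (∑ z ∈ S, |(z j : ℝ)|) * g j * (cvol k).toReal ≤ 2^(k+1) * ∏ i, (g i : ℝ) := by
  classical
  have hc0 : 0 < (cvol k).toReal := ENNReal.toReal_pos (cvol_pos k).ne' (cvol_ne_top k)
  have hvf : ∀ q, volume (cellS L q) ≠ ⊤ := fun q => (cellS_compact q).measure_lt_top.ne
  choose! z hz1 hz2 hz3 using fun q (hq : q ∈ Facets L) => cell_int hint hq
  set I := (facets_finite (L := L)).toFinset with hIdef
  have hI : ∀ q, q ∈ I ↔ q ∈ Facets L := by intro q; simp [I]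
  have hslope : ∀ q ∈ Facets L, q.1 = fun i : Fin k => (z q i.succ : ℝ) / (z q 0 : ℝ) := by
    intro q hq
    ext i
    have a := hz1 q hq
    have b := hz2 q hq
    have c := hz3 q hq i
    have a' : (0:ℝ) < z q 0 := by exact_mod_cast (by omega : 0 < z q 0)
    rw [eq_div_iff a'.ne']
    rw [b] at c
    have : (q.1 i * z q 0) * (cvol k).toReal = z q i.succ * (cvol k).toReal := by linarith
    exact mul_right_cancel₀ hc0.ne' this
  have hinj : Set.InjOn z (I : Set _) := by
    intro p hp q hq e
    have hp' := (hI p).1 hp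
    have hq' := (hI q).1 hq
    apply facets_slope_inj hp' hq'
    rw [hslope p hp', hslope q hq', e]
  refine ⟨I.image z, ?_, ?_, ?_⟩
  · intro y hy
    obtain ⟨q, hq, rfl⟩ := Finset.mem_image.1 hy
    exact hz1 q ((hI q).1 hq)
  · rw [Finset.coe_image, Set.image_image]
    have : (I : Set _) = Facets L := by ext q; simp [hI]
    rw [this]
    apply Set.image_congr
    intro q hq
    have h2 := hz2 q hq
    ext1
    · exact hslope q hq
    · change volume (cellS L q) = _
      dsimp only
      rw [← h2, ENNReal.ofReal_toReal (hvf q)]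
  · intro j
    rw [Finset.sum_image (fun p hp q hq e => hinj hp hq e), mul_right_comm, Finset.sum_mul]
    refine Fin.cases ?_ ?_ j
    · have e1 : ∑ q ∈ I, |(z q 0 : ℝ)| * (cvol k).toReal = (volume (domS L)).toReal := by
        rw [volume_domS_eq hne, ENNReal.toReal_sum (fun q _ => hvf q)]
        apply Finset.sum_congr rfl
        intro q hq
        have hq' := (hI q).1 hq
        rw [hz2 q hq', abs_of_nonneg]
        have := hz1 q hq'
        exact_mod_cast (by omega : 0 ≤ z q 0)
      have e2 : domS L ⊆ Set.pi Set.univ (fun j : Fin k => Set.Icc (-(g j.succ : ℝ)) (g j.succ)) := by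
        apply convexHull_min _ (box_convex _)
        rintro _ ⟨l, hl, rfl⟩ i _
        exact abs_le.1 (h1 l hl i)
      have e3 := ENNReal.toReal_mono (box_fin _) (measure_mono e2 (μ := volume))
      rw [box_vol _ (fun i => Nat.cast_nonneg _)] at e3
      rw [e1]
      rw [Fin.prod_univ_succ]
      calc (volume (domS L)).toReal * (g 0 : ℝ) ≤ (2^k * ∏ j : Fin k, (g j.succ : ℝ)) * g 0 := by gcongr
        _ ≤ 2 * ((2^k * ∏ j : Fin k, (g j.succ : ℝ)) * g 0) := by
          have : 0 ≤ (2^k * ∏ j : Fin k, (g j.succ : ℝ)) * g 0 := by positivity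
          linarith
        _ = _ := by rw [pow_succ]; ring
    · intro i
      let G : Fin k → ℝ := Function.update (fun j : Fin k => (g j.succ : ℝ)) i (g 0)
      have hG : ∀ j, 0 ≤ G j := by
        intro j
        by_cases hj : j = i
        · subst hj; simp [G]
        · simp [G, hj]
      have hs := sum_slope (L := L) i _ (box_convex G) (by
        intro l hl j _
        by_cases hj : j = i
        · subst hj; simpa [G] using abs_le.1 (h0 l hl)
        · simpa [G, hj] using abs_le.1 (h1 l hl j))
      have hs' := ENNReal.toReal_mono (ENNReal.mul_ne_top (by simp) (box_fin G)) hs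
      rw [ENNReal.toReal_mul, box_vol G hG, ENNReal.toReal_sum (fun q _ => ENNReal.mul_ne_top (by simp) (hvf q))] at hs'
      have e1 : ∑ q ∈ I, |(z q i.succ : ℝ)| * (cvol k).toReal =
          ∑ q ∈ I, (ENNReal.ofReal |q.1 i| * volume (cellS L q)).toReal := by
        apply Finset.sum_congr rfl
        intro q hq
        have := hz3 q ((hI q).1 hq) i
        rw [ENNReal.toReal_mul, ENNReal.toReal_ofReal (abs_nonneg _)]
        have := congrArg abs this
        rw [abs_mul, abs_mul, abs_of_nonneg ENNReal.toReal_nonneg, abs_of_nonneg hc0.le] at this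
        exact this.symm
      rw [e1]
      have e2 : (∏ j, G j) * (g i.succ : ℝ) = g 0 * ∏ j : Fin k, (g j.succ : ℝ) := by
        simp only [G]
        rw [Finset.prod_update_of_mem (Finset.mem_univ i),
          ← Finset.mul_prod_erase Finset.univ (fun j : Fin k => (g j.succ : ℝ)) (Finset.mem_univ i),
          Finset.sdiff_singleton_eq_erase]
        ring
      calc _ ≤ ((2:ENNReal).toReal * (2^k * ∏ j, G j)) * (g i.succ : ℝ) := by gcongr
        _ = 2 ^ (k+1) * ((∏ j, G j) * (g i.succ : ℝ)) := by simp [pow_succ]; ring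
        _ = _ := by rw [e2, Fin.prod_univ_succ]
end

end

section

lemma geo1 (t : ℝ) (N : ℕ) :
    (∑ m ∈ Finset.range N, Real.exp (-t * (m+1))) * (Real.exp t - 1) = 1 - Real.exp (-t * N) := by
  induction N with
  | zero => simp
  | succ n ih =>
    rw [Finset.sum_range_succ, add_mul, ih]
    push_cast
    have : Real.exp (-t * (n+1)) * Real.exp t = Real.exp (-t * n) := by
      rw [← Real.exp_add]; ring_nf
    rw [mul_sub, this]; ring

lemma geo2 {t : ℝ} (ht : 0 < t) (N : ℕ) :
    ∑ m ∈ Finset.range N, Real.exp (-t * (m+1)) ≤ 1 / (Real.exp t - 1) := by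
  have h := Real.add_one_lt_exp ht.ne'
  rw [le_div_iff₀ (by linarith), geo1]
  have := Real.exp_pos (-t * N)
  linarith

lemma geo3 {t : ℝ} (ht : 0 < t) (N : ℕ) :
    ∑ x ∈ Finset.Icc (1:ℤ) N, Real.exp (-t * |(x:ℝ)|) ≤ 1 / (Real.exp t - 1) := by
  refine le_trans (le_of_eq ?_) (geo2 ht N)
  symm
  refine Finset.sum_bij (fun m _ => (m:ℤ) + 1) ?_ ?_ ?_ ?_
  · intro m hm; simp at hm ⊢; omega
  · intro a _ b _ h; simpa using h
  · intro x hx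
    simp at hx
    refine ⟨(x-1).toNat, ?_, ?_⟩
    · simp; omega
    · rw [Int.toNat_of_nonneg (by omega)]; ring
  · intro m _
    push_cast
    rw [abs_of_nonneg (by positivity)]

lemma geo4 {t : ℝ} (ht : 0 < t) (N : ℕ) :
    ∑ x ∈ Finset.Icc (-(N:ℤ)) N, Real.exp (-t * |(x:ℝ)|) ≤ 1 + 2 / (Real.exp t - 1) := by
  classical
  have e : Finset.Icc (-(N:ℤ)) N ⊆ ({0} ∪ Finset.Icc (1:ℤ) N) ∪ (Finset.Icc (1:ℤ) N).image (fun x => -x) := by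
    intro x hx
    rw [Finset.mem_Icc] at hx
    rw [Finset.mem_union, Finset.mem_union, Finset.mem_singleton, Finset.mem_Icc, Finset.mem_image]
    rcases lt_trichotomy x 0 with h | h | h
    · right; exact ⟨-x, Finset.mem_Icc.2 (by omega), by ring⟩
    · left; left; exact h
    · left; right; omega
  have h3 := geo3 ht N
  have h4 : ∑ x ∈ (Finset.Icc (1:ℤ) N).image (fun x => -x), Real.exp (-t * |(x:ℝ)|) ≤ 1 / (Real.exp t - 1) := by
    rw [Finset.sum_image (by intro a _ b _ h; simpa using h)]
    simpa using h3
  have hu : ∀ (A B : Finset ℤ), ∑ x ∈ A ∪ B, Real.exp (-t * |(x:ℝ)|) ≤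
      ∑ x ∈ A, Real.exp (-t * |(x:ℝ)|) + ∑ x ∈ B, Real.exp (-t * |(x:ℝ)|) := by
    intro A B
    rw [← Finset.sum_union_inter]
    have : 0 ≤ ∑ x ∈ A ∩ B, Real.exp (-t * |(x:ℝ)|) := Finset.sum_nonneg (fun x _ => (Real.exp_pos _).le)
    linarith
  calc _ ≤ _ := Finset.sum_le_sum_of_subset_of_nonneg e (fun x _ _ => (Real.exp_pos _).le)
    _ ≤ _ := hu _ _
    _ ≤ _ := add_le_add (hu _ _) le_rfl
    _ ≤ 1 + 2 / (Real.exp t - 1) := by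
      have : 2 / (Real.exp t - 1) = 1 / (Real.exp t - 1) + 1 / (Real.exp t - 1) := by ring
      rw [this]; simp only [Finset.sum_singleton]
      simp only [Int.cast_zero, abs_zero, mul_zero, Real.exp_zero]
      linarith

/-- abstract exponential counting -/
lemma count_exp {α ι : Type*} [DecidableEq α] [Fintype ι] (Z : Finset α) (f : ι → α → ℝ) (n t : ι → ℝ)
    (ht : ∀ j, 0 ≤ t j)
    (F : Finset (Finset α)) (hF : ∀ S ∈ F, S ⊆ Z ∧ ∀ j, ∑ z ∈ S, f j z ≤ n j) :
    (F.card : ℝ) ≤ Real.exp (∑ j, t j * n j + ∑ z ∈ Z, Real.exp (∑ j, -t j * f j z)) := by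
  have h1 : ∀ S ∈ F, (1:ℝ) ≤ Real.exp (∑ j, t j * n j) * ∏ z ∈ S, Real.exp (∑ j, -t j * f j z) := by
    intro S hS
    rw [← Real.exp_sum, ← Real.exp_add, Real.one_le_exp_iff, Finset.sum_comm, ← Finset.sum_add_distrib]
    apply Finset.sum_nonneg
    intro j _
    rw [← Finset.mul_sum]
    have := mul_le_mul_of_nonneg_left ((hF S hS).2 j) (ht j)
    linarith
  calc (F.card : ℝ) = ∑ S ∈ F, 1 := by simp
    _ ≤ ∑ S ∈ F, Real.exp (∑ j, t j * n j) * ∏ z ∈ S, Real.exp (∑ j, -t j * f j z) := Finset.sum_le_sum h1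
    _ ≤ ∑ S ∈ Z.powerset, Real.exp (∑ j, t j * n j) * ∏ z ∈ S, Real.exp (∑ j, -t j * f j z) := by
      apply Finset.sum_le_sum_of_subset_of_nonneg
      · intro S hS; exact Finset.mem_powerset.2 (hF S hS).1
      · intro S _ _
        exact mul_nonneg (Real.exp_pos _).le (Finset.prod_nonneg (fun _ _ => (Real.exp_pos _).le))
    _ = Real.exp (∑ j, t j * n j) * ∏ z ∈ Z, (1 + Real.exp (∑ j, -t j * f j z)) := by
      rw [← Finset.mul_sum, Finset.prod_one_add]
    _ ≤ Real.exp (∑ j, t j * n j) * ∏ z ∈ Z, Real.exp (Real.exp (∑ j, -t j * f j z)) := by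
      apply mul_le_mul_of_nonneg_left _ (Real.exp_pos _).le
      apply Finset.prod_le_prod
      · intro z _; positivity
      · intro z _; rw [add_comm]; exact Real.add_one_le_exp _
    _ = _ := by rw [← Real.exp_sum, ← Real.exp_add]

lemma e_bound1 {t : ℝ} (ht : 0 < t) : 1 / (Real.exp t - 1) ≤ 1 / t := by
  have := Real.add_one_lt_exp ht.ne'
  apply one_div_le_one_div_of_le ht; linarith

lemma e_bound2 {t : ℝ} (ht : 1 ≤ t) (n : ℕ) : 1 / (Real.exp t - 1) ≤ 2 * n.factorial / t ^ n := by
  have h1 := Real.add_one_le_exp t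
  have h2 := Real.pow_div_factorial_le_exp t (by linarith) n
  have hf : (0:ℝ) < n.factorial := by exact_mod_cast n.factorial_pos
  have htn : 0 < t^n := by positivity
  rw [div_le_div_iff₀ (by linarith) htn]
  rw [div_le_iff₀ hf] at h2
  nlinarith

lemma e_bound3 {t : ℝ} (ht : 0 < t) (ht1 : t ≤ 1) : 1 + 2 / (Real.exp t - 1) ≤ 3 / t := by
  have := e_bound1 ht
  have h1 : 2 / (Real.exp t - 1) = 2 * (1 / (Real.exp t - 1)) := by ring
  have h2 : 3 / t = 1 / t + 2 * (1 / t) := by ring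
  have h3 : 1 ≤ 1 / t := by rw [le_div_iff₀ ht]; linarith
  linarith

theorem count_S (k : ℕ) (C : ℝ) (hC : 0 ≤ C) : ∃ C' : ℝ, 0 < C' ∧ ∀ g : Fin (k+1) → ℕ,
    (∀ j, 1 ≤ g j) → (∀ j, g j ≤ g 0) →
    {S : Finset (Fin (k+1) → ℤ) | (∀ z ∈ S, 1 ≤ z 0) ∧
      ∀ j, (∑ z ∈ S, |(z j : ℝ)|) * g j ≤ C * ∏ i, (g i : ℝ)}.Finite ∧
    ({S : Finset (Fin (k+1) → ℤ) | (∀ z ∈ S, 1 ≤ z 0) ∧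
      ∀ j, (∑ z ∈ S, |(z j : ℝ)|) * g j ≤ C * ∏ i, (g i : ℝ)}.ncard : ℝ) ≤
      Real.exp (C' * (∏ i, (g i : ℝ)) ^ ((k:ℝ) / (k + 2))) := by
  classical
  refine ⟨(k+1) * C + 2 * (k+1).factorial * 3^k, by positivity, ?_⟩
  intro g hg1 hg0
  set B : ℝ := ∏ i, (g i : ℝ) with hB
  have hgpos : ∀ j, (0:ℝ) < g j := fun j => by exact_mod_cast hg1 j
  have hBpos : 0 < B := Finset.prod_pos (fun j _ => hgpos j)
  set Λ := B ^ ((k:ℝ) / (k + 2)) with hΛ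
  set 𝒮 := {S : Finset (Fin (k+1) → ℤ) | (∀ z ∈ S, 1 ≤ z 0) ∧
      ∀ j, (∑ z ∈ S, |(z j : ℝ)|) * g j ≤ C * B} with h𝒮
  set β := B ^ ((2:ℝ) / (k+2)) with hβ
  have hβpos : 0 < β := Real.rpow_pos_of_pos hBpos _
  have hk2 : (k:ℝ) + 2 ≠ 0 := by positivity
  have hBβ : B / β = Λ := by
    rw [hβ, hΛ, div_eq_iff hβpos.ne', hβ, ← Real.rpow_add hBpos]
    conv_lhs => rw [← Real.rpow_one B]
    congr 1; field_simp
  have hβB : β^(k+1) / B = Λ := by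
    rw [div_eq_iff hBpos.ne', hβ, hΛ, ← Real.rpow_natCast, ← Real.rpow_mul hBpos.le]
    conv_rhs => rw [← Real.rpow_one B, ← Real.rpow_mul hBpos.le, ← Real.rpow_add hBpos]
    congr 1; push_cast; field_simp; ring
  have hΛpos : 0 < Λ := Real.rpow_pos_of_pos hBpos _
  set m := max (g 0 : ℝ) β with hm
  have hmpos : 0 < m := lt_of_lt_of_le hβpos (le_max_right _ _)
  let t : Fin (k+1) → ℝ := Fin.cons (g 0 / β) (fun i => g i.succ / m)
  have htpos : ∀ j, 0 < t j := by
    intro j; refine Fin.cases ?_ ?_ j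
    · exact div_pos (hgpos 0) hβpos
    · intro i; exact div_pos (hgpos _) hmpos
  let N : ℕ := ⌈C * B⌉₊
  let s : Fin (k+1) → Finset ℤ := Fin.cons (Finset.Icc 1 (N:ℤ)) (fun _ => Finset.Icc (-(N:ℤ)) N)
  let Z : Finset (Fin (k+1) → ℤ) := Fintype.piFinset s
  have hsub : ∀ S ∈ 𝒮, S ⊆ Z := by
    intro S hS z hz
    have hzb : ∀ j, |z j| ≤ (N:ℤ) := by
      intro j
      have h1 := hS.2 j
      have h2 : |(z j : ℝ)| ≤ ∑ z ∈ S, |(z j : ℝ)| :=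
        Finset.single_le_sum (f := fun z : Fin (k+1) → ℤ => |(z j : ℝ)|) (fun _ _ => abs_nonneg _) hz
      have h3 : (1:ℝ) ≤ g j := by exact_mod_cast hg1 j
      have h4 : |(z j : ℝ)| ≤ C * B := by nlinarith [abs_nonneg (z j : ℝ)]
      have h5 : |(z j : ℝ)| ≤ (N : ℝ) := h4.trans (Nat.le_ceil _)
      exact_mod_cast h5
    rw [Fintype.mem_piFinset]
    intro j; refine Fin.cases ?_ ?_ j
    · have := hS.1 z hz
      have := abs_le.1 (hzb 0)
      simp [s]; omega
    · intro i
      have := abs_le.1 (hzb i.succ)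
      simp [s]; omega
  have hfin : 𝒮.Finite := (Finset.finite_toSet Z.powerset).subset (fun S hS => by
    simpa using hsub S hS)
  refine ⟨hfin, ?_⟩
  rw [Set.ncard_eq_toFinset_card _ hfin]
  have hmain := count_exp Z (fun j (z : Fin (k+1) → ℤ) => |(z j : ℝ)|) (fun j => C * B / g j) t
    (fun j => (htpos j).le) hfin.toFinset (by
      intro S hS
      have hS' : S ∈ 𝒮 := by simpa using hS
      refine ⟨hsub S hS', fun j => ?_⟩
      rw [le_div_iff₀ (hgpos j)]
      exact hS'.2 j)
  refine hmain.trans (Real.exp_le_exp.2 ?_)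
  have p1 : ∑ j, t j * (C * B / g j) ≤ (k+1) * C * Λ := by
    have : ∀ j, t j * (C * B / g j) ≤ C * Λ := by
      intro j
      rw [← hBβ]
      refine Fin.cases ?_ ?_ j
      · have := (hgpos 0).ne'
        simp only [t, Fin.cons_zero]
        apply le_of_eq; field_simp
      · intro i
        have := (hgpos i.succ).ne'
        simp only [t, Fin.cons_succ]
        calc (g i.succ : ℝ) / m * (C * B / g i.succ) = C * (B / m) := by field_simp
          _ ≤ C * (B / β) := by
            apply mul_le_mul_of_nonneg_left _ hC
            exact div_le_div_of_nonneg_left hBpos.le hβpos (le_max_right _ _)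
    calc _ ≤ ∑ j : Fin (k+1), C * Λ := Finset.sum_le_sum (fun j _ => this j)
      _ = _ := by simp; ring
  have p2 : ∑ z ∈ Z, Real.exp (∑ j, -t j * |(z j : ℝ)|) ≤ 2 * (k+1).factorial * 3^k * Λ := by
    simp only [Real.exp_sum]
    have e : ∑ z ∈ Z, ∏ j, Real.exp (-t j * |(z j : ℝ)|) = ∏ j, ∑ x ∈ s j, Real.exp (-t j * |(x : ℝ)|) := by
      rw [Finset.prod_univ_sum]
    rw [e, Fin.prod_univ_succ]
    have q1 : ∏ i : Fin k, ∑ x ∈ s i.succ, Real.exp (-t i.succ * |(x : ℝ)|) ≤ ∏ i : Fin k, (3 * m / g i.succ) := by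
      apply Finset.prod_le_prod
      · intro i _; exact Finset.sum_nonneg (fun _ _ => (Real.exp_pos _).le)
      · intro i _
        have a1 : t i.succ ≤ 1 := by
          simp only [t, Fin.cons_succ]
          rw [div_le_one hmpos]
          exact le_trans (by exact_mod_cast hg0 _) (le_max_left _ _)
        have := (geo4 (htpos i.succ) N).trans (e_bound3 (htpos _) a1)
        simp only [s, Fin.cons_succ]
        refine this.trans (le_of_eq ?_)
        have := (hgpos i.succ).ne'
        simp only [t, Fin.cons_succ]; field_simp
    have q2 : ∏ i : Fin k, (3 * m / g i.succ) = 3^k * m^k * (g 0 / B) := by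
      rw [Finset.prod_div_distrib, Finset.prod_const, hB, Fin.prod_univ_succ]
      have := (hgpos 0).ne'
      have h2 : ∏ i : Fin k, (g i.succ : ℝ) ≠ 0 := (Finset.prod_pos (fun j _ => hgpos _)).ne'
      simp only [Finset.card_univ, Fintype.card_fin, mul_pow]
      field_simp
    rw [q2] at q1
    have q3 := geo3 (htpos 0) N
    have hs0 : s 0 = Finset.Icc 1 (N:ℤ) := rfl
    rw [hs0]
    have ht0 : t 0 = g 0 / β := rfl
    have g0 := hgpos 0
    have fpos : (1:ℝ) ≤ (k+1).factorial := by exact_mod_cast (k+1).factorial_pos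
    have key : ∀ x, 1 / (Real.exp (t 0) - 1) ≤ x → 0 ≤ x → x * (3^k * m^k * (g 0 / B)) ≤ 2 * (k+1).factorial * 3^k * Λ →
      (∑ x ∈ Finset.Icc (1:ℤ) N, Real.exp (-t 0 * |(x:ℝ)|)) * ∏ i : Fin k, ∑ x ∈ s i.succ, Real.exp (-t i.succ * |(x : ℝ)|) ≤ 2 * (k+1).factorial * 3^k * Λ := by
      intro x hx hx0 h
      refine le_trans ?_ h
      apply mul_le_mul (q3.trans hx) q1 _ hx0
      exact Finset.prod_nonneg (fun i _ => Finset.sum_nonneg (fun _ _ => (Real.exp_pos _).le))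
    rcases le_total β (g 0) with h | h
    · have hmm : m = g 0 := max_eq_left h
      have h1 : 1 ≤ t 0 := by rw [ht0, le_div_iff₀ hβpos]; linarith
      refine key _ (e_bound2 h1 (k+1)) (by positivity) ?_
      rw [ht0, hmm, ← hβB]
      apply le_of_eq
      rw [div_pow]
      field_simp
      ring
    · have hmm : m = β := max_eq_right h
      refine key _ (e_bound1 (htpos 0)) (by have := htpos 0; positivity) ?_
      rw [ht0, hmm]
      have : 1 / (g 0 / β) * (3^k * β^k * (g 0 / B)) = 3^k * Λ := by
        rw [← hβB]; field_simp; ring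
      rw [this]
      have : 0 ≤ 3^k * Λ := by positivity
      nlinarith
  calc _ ≤ _ := add_le_add p1 p2
    _ = _ := by ring

end

section

lemma interval_lohi (T : Set ℤ) (hT : T.OrdConnected) (g : ℕ) (hg : ∀ t ∈ T, |t| ≤ (g:ℤ)) :
    ∃ p : Finset.Icc (-(g:ℤ)) (g+1) × Finset.Icc (-(g:ℤ)) (g+1),
      ∀ t, t ∈ T ↔ p.1.1 ≤ t ∧ t ≤ p.2.1 := by
  rcases T.eq_empty_or_nonempty with rfl | hne
  · refine ⟨(⟨g+1, by simp; omega⟩, ⟨g, by simp⟩), ?_⟩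
    intro t; simp
  · have hfin : T.Finite := (Finset.finite_toSet (Finset.Icc (-(g:ℤ)) g)).subset (by
      intro t ht; have := abs_le.1 (hg t ht); simpa using this)
    have hne' : hfin.toFinset.Nonempty := by simpa using hne
    have h1 : hfin.toFinset.min' hne' ∈ T := by simpa using Finset.min'_mem hfin.toFinset hne'
    have h2 : hfin.toFinset.max' hne' ∈ T := by simpa using Finset.max'_mem hfin.toFinset hne'
    have b1 := abs_le.1 (hg _ h1)
    have b2 := abs_le.1 (hg _ h2)
    refine ⟨(⟨hfin.toFinset.min' hne', by rw [Finset.mem_Icc]; omega⟩,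
      ⟨hfin.toFinset.max' hne', by rw [Finset.mem_Icc]; omega⟩), ?_⟩
    intro t
    constructor
    · intro ht
      exact ⟨Finset.min'_le _ _ (by simpa using ht), Finset.le_max' _ _ (by simpa using ht)⟩
    · intro ht
      exact hT.out h1 h2 ht

def DSet (m : ℕ) (g : Fin (m+1) → ℕ) : Set (Set (Fin (m+1) → ℤ)) :=
  {E | ∃ C : Set (Fin (m+1) → ℝ), Convex ℝ C ∧ E = {x | intVec x ∈ C} ∧ ∀ x ∈ E, ∀ i, |x i| ≤ (g i : ℤ)}

lemma fiber_ord {m : ℕ} {C : Set (Fin (m+1) → ℝ)} (hC : Convex ℝ C) (y : Fin m → ℤ) :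
    {t : ℤ | intVec (Fin.cons t y : Fin (m+1) → ℤ) ∈ C}.OrdConnected := by
  have h1 : Convex ℝ {s : ℝ | (Fin.cons s (intVec y) : Fin (m+1) → ℝ) ∈ C} := by
    intro s hs s' hs' a b ha hb hab
    have := hC hs hs' ha hb hab
    simp only [Set.mem_ofPred_eq]
    convert this using 1
    ext j
    refine Fin.cases ?_ ?_ j
    · simp
    · intro i; simp [← add_mul, hab]
  have h2 := h1.ordConnected
  have e : ∀ t : ℤ, intVec (Fin.cons t y : Fin (m+1) → ℤ) = (Fin.cons (t:ℝ) (intVec y) : Fin (m+1) → ℝ) := by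
    intro t; ext j
    refine Fin.cases ?_ ?_ j
    · simp [intVec]
    · intro i; simp [intVec]
  constructor
  intro a ha b hb t ht
  simp only [Set.mem_ofPred_eq, e] at *
  exact h2.out ha hb ⟨by exact_mod_cast ht.1, by exact_mod_cast ht.2⟩

lemma DSet_count (m : ℕ) (g : Fin (m+1) → ℕ) : (DSet m g).Finite ∧
    (DSet m g).ncard ≤ ((2 * g 0 + 2)^2)^(∏ i : Fin m, (2 * g i.succ + 1)) := by
  classical
  let Y : Finset (Fin m → ℤ) := Fintype.piFinset (fun i => Finset.Icc (-(g i.succ : ℤ)) (g i.succ))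
  let R := Finset.Icc (-(g 0:ℤ)) (g 0+1) × Finset.Icc (-(g 0:ℤ)) (g 0+1)
  have hex : ∀ E : DSet m g, ∃ f : Y → R, ∀ y : Y, ∀ t : ℤ,
      (Fin.cons t y.1 : Fin (m+1) → ℤ) ∈ E.1 ↔ (f y).1.1 ≤ t ∧ t ≤ (f y).2.1 := by
    rintro ⟨E, C, hC, hE, hb⟩
    have : ∀ y : Y, ∃ p : R, ∀ t : ℤ,
      (Fin.cons t y.1 : Fin (m+1) → ℤ) ∈ E ↔ p.1.1 ≤ t ∧ t ≤ p.2.1 := by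
      intro y
      apply interval_lohi {t : ℤ | (Fin.cons t y.1 : Fin (m+1) → ℤ) ∈ E}
      · rw [hE]; exact fiber_ord hC y.1
      · intro t ht
        simpa using hb _ ht 0
    choose f hf using this
    exact ⟨f, hf⟩
  choose F hF using hex
  have hinj : Function.Injective F := by
    intro E E' h
    have hsub : ∀ E E' : DSet m g, F E = F E' → E.1 ⊆ E'.1 := by
      intro E E' h x hx
      obtain ⟨C, hC, hE, hb⟩ := E.2
      have hy : Fin.tail x ∈ Y := by
        rw [Fintype.mem_piFinset]
        intro i
        have := abs_le.1 (hb x hx i.succ)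
        rw [Finset.mem_Icc]; exact this
      have h1 := (hF E ⟨Fin.tail x, hy⟩ (x 0))
      have h2 := (hF E' ⟨Fin.tail x, hy⟩ (x 0))
      rw [Fin.cons_self_tail] at h1 h2
      rw [h2, ← h, ← h1]; exact hx
    exact Subtype.ext (Set.Subset.antisymm (hsub _ _ h) (hsub _ _ h.symm))
  have hfin : Finite (DSet m g) := Finite.of_injective F hinj
  refine ⟨hfin, ?_⟩
  rw [← Nat.card_coe_set_eq]
  refine (Nat.card_le_card_of_injective F hinj).trans (le_of_eq ?_)
  rw [Nat.card_eq_fintype_card, Fintype.card_fun]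
  congr 1
  · simp only [R]
    rw [Fintype.card_prod, sq]
    have : Fintype.card (Finset.Icc (-(g 0:ℤ)) (g 0+1)) = 2 * g 0 + 2 := by
      rw [Fintype.card_coe, Int.card_Icc]; omega
    rw [this]
  · rw [Fintype.card_coe, Fintype.card_piFinset]
    apply Finset.prod_congr rfl
    intro i _
    rw [Int.card_Icc]; omega

theorem count_D (m : ℕ) : ∃ C : ℝ, 0 < C ∧ ∀ g : Fin (m+2) → ℕ, (∀ j, 1 ≤ g j) → Antitone g →
    ((DSet m (fun i => g i.succ)).ncard : ℝ) ≤
      Real.exp (C * (∏ i, (g i : ℝ)) ^ (((m+1 : ℕ):ℝ) / ((m+1:ℕ) + 2))) := by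
  refine ⟨2 * 3^m * (4 * (m+3)), by positivity, ?_⟩
  intro g hg1 hanti
  have hc := (DSet_count m (fun i => g i.succ)).2
  have hgpos : ∀ j, (1:ℝ) ≤ g j := fun j => by exact_mod_cast hg1 j
  set u : ℝ := (g 0 : ℝ) with hu
  set v : ℝ := (g (Fin.succ 0) : ℝ) with hv
  set p : ℝ := ∏ i : Fin m, (g i.succ.succ : ℝ) with hp
  have hB : ∏ i, (g i : ℝ) = u * v * p := by
    rw [Fin.prod_univ_succ, Fin.prod_univ_succ]; ring
  have hu1 : 1 ≤ u := hgpos 0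
  have hv1 : 1 ≤ v := hgpos _
  have hvu : v ≤ u := by
    simp only [u, v]; exact_mod_cast hanti (Fin.zero_le _)
  have hp1 : 1 ≤ p := by
    have := Finset.prod_le_prod (s := (Finset.univ : Finset (Fin m))) (f := fun _ => (1:ℝ)) (g := fun i => (g i.succ.succ : ℝ)) (by intros; norm_num) (fun i _ => hgpos _)
    simpa using this
  have hpv : p ≤ v^m := by
    have := Finset.prod_le_prod (s := (Finset.univ : Finset (Fin m))) (f := fun i => (g i.succ.succ : ℝ)) (g := fun _ => v)
      (by intros; positivity) (fun i _ => by
        simp only [v]; exact_mod_cast hanti (by rw [Fin.succ_le_succ_iff]; exact Fin.zero_le _))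
    simpa using this
  set B := u * v * p with hBdef
  set X := u * v with hX
  have hX1 : 1 ≤ X := by nlinarith
  have hB1 : 1 ≤ B := by nlinarith
  have hBpos : 0 < B := by linarith
  have hXpos : 0 < X := by linarith
  have hvX : v^2 ≤ X := by nlinarith
  have hvX' : v ≤ X := by nlinarith
  rw [hB]
  set a : ℝ := 1 / (m+3) with ha
  have hapos : 0 < a := by positivity
  have hm3 : (m:ℝ) + 3 ≠ 0 := by positivity
  -- B ^ 2 ≤ X ^ (m+2)
  have k1 : B^2 ≤ X^(m+2) := by
    have : p^2 ≤ X^m := by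
      calc p^2 ≤ (v^m)^2 := by gcongr
        _ = (v^2)^m := by ring
        _ ≤ X^m := by gcongr
    calc B^2 = p^2 * X^2 := by rw [hBdef]; ring
      _ ≤ X^m * X^2 := by gcongr
      _ = _ := by ring
  have k2 : B ^ (2 * a) * X ^ a ≤ X := by
    have : B ^ (2*a) ≤ X ^ ((m+2) * a) := by
      have := Real.rpow_le_rpow (by positivity) k1 hapos.le
      rw [← Real.rpow_natCast, ← Real.rpow_natCast, ← Real.rpow_mul hBpos.le, ← Real.rpow_mul hXpos.le] at this
      push_cast at this; exact this
    calc _ ≤ X ^ ((m+2) * a) * X ^ a := by gcongr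
      _ = X := by
        rw [← Real.rpow_add hXpos]
        conv_rhs => rw [← Real.rpow_one X]
        congr 1; rw [ha]; field_simp; ring
  have k3 : p * X ^ a ≤ B ^ (1 - 2 * a) := by
    rw [Real.rpow_sub hBpos, Real.rpow_one, le_div_iff₀ (Real.rpow_pos_of_pos hBpos _)]
    calc p * X^a * B^(2*a) = p * (B^(2*a) * X^a) := by ring
      _ ≤ p * X := by gcongr
      _ = B := by rw [hBdef]; ring
  have k4 : Real.log (4 * v) ≤ 4 * (m+3) * X ^ a := by
    have h := Real.log_le_rpow_div (x := 4 * v) (by positivity) hapos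
    have h2 : (4 * v) ^ a ≤ 4 * X ^ a := by
      calc (4*v)^a ≤ (4 * X)^a := by gcongr
        _ = 4^a * X^a := Real.mul_rpow (by norm_num) hXpos.le
        _ ≤ 4^(1:ℝ) * X^a := by
          gcongr
          · norm_num
          · rw [ha, div_le_one (by positivity)]; have : (0:ℝ) ≤ m := by positivity
            linarith
        _ = _ := by rw [Real.rpow_one]
    calc _ ≤ (4 * v) ^ a / a := h
      _ = (m+3) * (4 * v) ^ a := by rw [ha]; field_simp
      _ ≤ (m+3) * (4 * X^a) := by gcongr
      _ = _ := by ring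
  have hexp : ((m+1 : ℕ):ℝ) / ((m+1:ℕ) + 2) = 1 - 2 * a := by
    rw [ha]; push_cast
    have : (m:ℝ) + 1 + 2 ≠ 0 := by positivity
    field_simp; ring
  rw [hexp]
  have hcR : ((DSet m (fun i => g i.succ)).ncard : ℝ) ≤ (((2 * v + 2)^2)^(∏ i : Fin m, (2 * g i.succ.succ + 1)) : ℝ) := by
    simp only [v]; exact_mod_cast hc
  refine hcR.trans ?_
  have hv4 : 2 * v + 2 ≤ 4 * v := by linarith
  rw [← Real.log_le_iff_le_exp (by positivity), Real.log_pow, Real.log_pow]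
  have hP : ((∏ i : Fin m, (2 * g i.succ.succ + 1) : ℕ) : ℝ) ≤ 3^m * p := by
    push_cast
    have : (3:ℝ)^m * p = ∏ i : Fin m, (3 * (g i.succ.succ : ℝ)) := by
      rw [Finset.prod_mul_distrib]; simp [hp]
    rw [this]
    apply Finset.prod_le_prod
    · intros; positivity
    · intro i _; have := hgpos i.succ.succ; linarith
  have hlog : Real.log (2 * v + 2) ≤ 4 * (m+3) * X ^ a :=
    (Real.log_le_log (by positivity) hv4).trans k4
  have hlog0 : 0 ≤ Real.log (2 * v + 2) := Real.log_nonneg (by linarith)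
  calc _ ≤ (3^m * p) * (((2:ℕ):ℝ) * (4 * (m+3) * X ^ a)) := by gcongr
    _ = 2 * 3^m * (4 * (m+3)) * (p * X^a) := by push_cast; ring
    _ ≤ _ := by gcongr

end

section

/-- block matrix with scalar corner -/
def blk {n : ℕ} {R : Type*} (a : R) (b c : Fin n → R) (M : Matrix (Fin n) (Fin n) R) :
    Matrix (Fin (n+1)) (Fin (n+1)) R :=
  Matrix.of (Fin.cons (Fin.cons a b) (fun i => Fin.cons (c i) (M i)))

section
set_option linter.unusedSectionVars false
variable {n : ℕ} {R : Type*} [CommRing R]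

@[simp] lemma blk_00 (a : R) (b c : Fin n → R) (M) : blk a b c M 0 0 = a := rfl
@[simp] lemma blk_0s (a : R) (b c : Fin n → R) (M) (j : Fin n) : blk a b c M 0 j.succ = b j := rfl
@[simp] lemma blk_s0 (a : R) (b c : Fin n → R) (M) (j : Fin n) : blk a b c M j.succ 0 = c j := rfl
@[simp] lemma blk_ss (a : R) (b c : Fin n → R) (M) (i j : Fin n) : blk a b c M i.succ j.succ = M i j := rfl

lemma blk_det_b (a : R) (c : Fin n → R) (M) : (blk a 0 c M).det = a * M.det := by
  rw [Matrix.det_succ_row_zero, Fin.sum_univ_succ]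
  have : (blk a 0 c M).submatrix Fin.succ (Fin.succAbove 0) = M := by
    ext i j; simp [Matrix.submatrix_apply]
  rw [this]
  simp

lemma blk_det_c (a : R) (b : Fin n → R) (M) : (blk a b 0 M).det = a * M.det := by
  rw [Matrix.det_succ_column_zero, Fin.sum_univ_succ]
  have : (blk a b 0 M).submatrix (Fin.succAbove 0) Fin.succ = M := by
    ext i j; simp [Matrix.submatrix_apply]
  rw [this]
  simp

lemma blk_self (S : Matrix (Fin (n+1)) (Fin (n+1)) R) :
    S = blk (S 0 0) (fun j => S 0 j.succ) (fun i => S i.succ 0) (fun i j => S i.succ j.succ) := by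
  ext i j
  refine Fin.cases ?_ ?_ i <;> refine Fin.cases ?_ ?_ j
  · rfl
  · intro j; rfl
  · intro i; rfl
  · intro j i; rfl
end

/-- value of the bilinear form -/
def qf {n : ℕ} (S : Matrix (Fin n) (Fin n) ℤ) (x : Fin n → ℤ) : ℤ := x ⬝ᵥ S.mulVec x

def PD {n : ℕ} (S : Matrix (Fin n) (Fin n) ℤ) : Prop := S.IsSymm ∧ ∀ x, x ≠ 0 → 0 < qf S x

lemma conj_diag {n : ℕ} (S U : Matrix (Fin n) (Fin n) ℤ) (j : Fin n) :
    (U * S * U.transpose) j j = qf S (U j) := by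
  rw [Matrix.mul_assoc]
  simp only [qf, dotProduct, Matrix.mulVec, Matrix.mul_apply, Matrix.transpose_apply]

lemma qf_conj {n : ℕ} (S U : Matrix (Fin n) (Fin n) ℤ) (x : Fin n → ℤ) :
    qf (U * S * U.transpose) x = qf S (Matrix.vecMul x U) := by
  rw [qf, qf, Matrix.mul_assoc, ← Matrix.mulVec_mulVec, ← Matrix.mulVec_mulVec, Matrix.mulVec_transpose,
    Matrix.dotProduct_mulVec]

lemma PD_conj {n : ℕ} {S U : Matrix (Fin n) (Fin n) ℤ} (hS : PD S) (hU : IsUnit U.det) :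
    PD (U * S * U.transpose) := by
  refine ⟨?_, ?_⟩
  · rw [Matrix.IsSymm, Matrix.transpose_mul, Matrix.transpose_mul, Matrix.transpose_transpose, hS.1,
      Matrix.mul_assoc]
  · intro x hx
    rw [qf_conj]
    apply hS.2
    intro h
    apply hx
    have := Matrix.vecMul_injective_of_isUnit ((Matrix.isUnit_iff_isUnit_det U).2 hU)
    apply this
    simpa using h

lemma qf_blk {n : ℕ} (a : ℤ) (b : Fin n → ℤ) (M : Matrix (Fin n) (Fin n) ℤ) (t : ℤ) (v : Fin n → ℤ) :
    qf (blk a b b M) (Fin.cons t v) = a * t^2 + 2 * t * (b ⬝ᵥ v) + qf M v := by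
  simp only [qf, dotProduct, Matrix.mulVec, Fin.sum_univ_succ, Fin.cons_zero, Fin.cons_succ, blk_00,
    blk_0s, blk_s0, blk_ss]
  simp only [mul_add, Finset.sum_add_distrib]
  have : ∑ x, v x * (b x * t) = t * ∑ x, b x * v x := by
    rw [Finset.mul_sum]; exact Finset.sum_congr rfl (fun _ _ => by ring)
  rw [this]; ring

/-- integral Schur complement -/
def schur {n : ℕ} (a : ℤ) (b : Fin n → ℤ) (M : Matrix (Fin n) (Fin n) ℤ) : Matrix (Fin n) (Fin n) ℤ :=
  fun i j => a * M i j - b i * b j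

lemma qf_schur {n : ℕ} (a : ℤ) (b : Fin n → ℤ) (M : Matrix (Fin n) (Fin n) ℤ) (v : Fin n → ℤ) :
    qf (schur a b M) v = a * qf M v - (b ⬝ᵥ v)^2 := by
  simp only [qf, schur, dotProduct, Matrix.mulVec, Finset.mul_sum, sq, Finset.sum_mul_sum, Finset.sum_mul]
  rw [← Finset.sum_sub_distrib]
  apply Finset.sum_congr rfl; intro i _
  rw [← Finset.sum_sub_distrib]
  apply Finset.sum_congr rfl; intro j _
  ring

lemma PD_schur {n : ℕ} {a : ℤ} {b : Fin n → ℤ} {M : Matrix (Fin n) (Fin n) ℤ} (ha : 0 < a)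
    (h : PD (blk a b b M)) : PD (schur a b M) := by
  refine ⟨?_, ?_⟩
  · ext i j
    have := congrFun (congrFun h.1 i.succ) j.succ
    simp only [Matrix.transpose_apply, blk_ss] at this
    simp [schur, this]; ring
  · intro x hx
    have h1 := h.2 (Fin.cons (-(b ⬝ᵥ x)) (a • x)) (by
      intro h0
      apply hx
      ext j
      have := congrFun h0 j.succ
      simpa [ha.ne'] using this)
    rw [qf_blk] at h1
    have e1 : b ⬝ᵥ (a • x) = a * (b ⬝ᵥ x) := by rw [dotProduct_smul, smul_eq_mul]
    have e2 : qf M (a • x) = a^2 * qf M x := by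
      rw [qf, Matrix.mulVec_smul, dotProduct_smul, smul_dotProduct]; simp only [smul_eq_mul, qf]; ring
    rw [e1, e2] at h1
    rw [qf_schur]
    have : 0 < a * (a * qf M x - (b ⬝ᵥ x)^2) := by nlinarith
    exact pos_of_mul_pos_right this ha.le

lemma det_schur {n : ℕ} (a : ℤ) (b : Fin n → ℤ) (M : Matrix (Fin n) (Fin n) ℤ) :
    (blk a b b M).det * a^n = a * (schur a b M).det := by
  have h : blk a b b M * blk 1 (fun j => - b j) 0 (Matrix.diagonal (fun _ : Fin n => a)) =
      blk a 0 b (schur a b M) := by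
    ext i j
    rw [Matrix.mul_apply, Fin.sum_univ_succ]
    refine Fin.cases ?_ ?_ i <;> refine Fin.cases ?_ ?_ j
    · simp
    · intro j; simp [Matrix.diagonal_apply]; ring
    · intro i; simp
    · intro j i; simp [Matrix.diagonal_apply, schur]; ring
  have := congrArg Matrix.det h
  rw [Matrix.det_mul, blk_det_b, blk_det_c, Matrix.det_diagonal] at this
  simpa using this

lemma round_exists (a s : ℤ) (ha : 0 < a) : ∃ t : ℤ, 4 * (a * t + s)^2 ≤ a^2 := by
  refine ⟨-((2 * s + a) / (2 * a)), ?_⟩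
  have h1 := Int.emod_add_mul_ediv (2 * s + a) (2 * a)
  have h2 := Int.emod_nonneg (2 * s + a) (by omega : 2 * a ≠ 0)
  have h3 := Int.emod_lt_of_pos (2 * s + a) (by omega : 0 < 2 * a)
  set r := (2 * s + a) % (2 * a)
  set q := (2 * s + a) / (2 * a)
  have : 2 * (a * -q + s) = r - a := by linarith
  nlinarith

lemma minimal_exists {n : ℕ} (S : Matrix (Fin (n+1)) (Fin (n+1)) ℤ) (hS : PD S) :
    ∃ U : Matrix (Fin (n+1)) (Fin (n+1)) ℤ, IsUnit U.det ∧
      ∀ U' : Matrix (Fin (n+1)) (Fin (n+1)) ℤ, IsUnit U'.det → qf S (U 0) ≤ qf S (U' 0) := by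
  obtain ⟨m, ⟨U, hU⟩, hmin⟩ := WellFounded.has_min (wellFounded_lt (α := ℕ))
    (Set.range (fun U : {U : Matrix (Fin (n+1)) (Fin (n+1)) ℤ // IsUnit U.det} => (qf S (U.1 0)).toNat))
    ⟨_, ⟨⟨1, by simp⟩, rfl⟩⟩
  refine ⟨U.1, U.2, ?_⟩
  intro U' hU'
  have h1 := hmin _ ⟨⟨U', hU'⟩, rfl⟩
  have h0 : ∀ U : Matrix (Fin (n+1)) (Fin (n+1)) ℤ, IsUnit U.det → 0 < qf S (U 0) := by
    intro U hU
    apply hS.2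
    intro h
    have : U.det = 0 := Matrix.det_eq_zero_of_row_eq_zero 0 (fun j => congrFun h j)
    rw [this] at hU; simp at hU
  have a1 := h0 _ U.2
  have a2 := h0 _ hU'
  simp only at h1 hU
  omega

theorem hermite (n : ℕ) : ∃ C : ℝ, 0 < C ∧ ∀ S : Matrix (Fin n) (Fin n) ℤ, PD S →
    ∃ U : Matrix (Fin n) (Fin n) ℤ, IsUnit U.det ∧ (∏ j, (qf S (U j) : ℝ)) ≤ C * S.det := by
  induction n with
  | zero => exact ⟨1, one_pos, fun S _ => ⟨1, by simp, by simp⟩⟩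
  | succ n ih =>
    obtain ⟨C, hC, ih⟩ := ih
    refine ⟨C * (4/3)^n, by positivity, ?_⟩
    intro S hS
    obtain ⟨U0, hU0, hmin⟩ := minimal_exists S hS
    set S1 := U0 * S * U0.transpose with hS1
    have hPD1 : PD S1 := PD_conj hS hU0
    have hdet1 : S1.det = S.det := by
      rw [hS1, Matrix.det_mul, Matrix.det_mul, Matrix.det_transpose]
      have : U0.det * U0.det = 1 := by
        rcases Int.isUnit_iff.1 hU0 with h | h <;> rw [h] <;> rfl
      linear_combination S.det * this
    set a := S1 0 0 with ha
    set b : Fin n → ℤ := fun j => S1 0 j.succ with hb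
    set M : Matrix (Fin n) (Fin n) ℤ := fun i j => S1 i.succ j.succ with hM
    have hblk : S1 = blk a b b M := by
      conv_lhs => rw [blk_self S1]
      congr 1
      ext j
      exact congrFun (congrFun hPD1.1 0) j.succ
    have haq : a = qf S (U0 0) := conj_diag S U0 0
    have hmin1 : ∀ U : Matrix (Fin (n+1)) (Fin (n+1)) ℤ, IsUnit U.det → ∀ j, a ≤ qf S1 (U j) := by
      intro U hU j
      rw [hS1, qf_conj, haq]
      have e : Matrix.vecMul (U j) U0 = (U * U0) j := by rw [Matrix.mul_apply_eq_vecMul]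
      rw [e]
      have := hmin ((U * U0).submatrix (Equiv.swap 0 j) id) (by
        rw [Matrix.det_permute, Matrix.det_mul]
        refine IsUnit.mul ?_ (hU.mul hU0)
        simpa using (Equiv.Perm.sign (Equiv.swap 0 j)).isUnit)
      have e2 : ((U * U0).submatrix (Equiv.swap 0 j) id) 0 = (U * U0) j := by
        ext i; simp [Matrix.submatrix_apply]
      rw [e2] at this
      exact this
    have hapos : 0 < a := by
      rw [haq]
      apply hS.2
      intro h
      have : U0.det = 0 := Matrix.det_eq_zero_of_row_eq_zero 0 (fun j => congrFun h j)
      rw [this] at hU0; simp at hU0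
    have hPDs : PD (schur a b M) := PD_schur hapos (hblk ▸ hPD1)
    obtain ⟨V, hV, hVb⟩ := ih _ hPDs
    choose t ht using fun j => round_exists a (b ⬝ᵥ V j) hapos
    let U1 : Matrix (Fin (n+1)) (Fin (n+1)) ℤ := blk 1 0 t V
    have hU1 : IsUnit U1.det := by simp only [U1]; rw [blk_det_b]; simpa using hV
    have hrow0 : qf S1 (U1 0) = a := by
      have : U1 0 = Fin.cons 1 (0 : Fin n → ℤ) := rfl
      rw [this, hblk, qf_blk]; simp [qf]
    have hrow : ∀ j : Fin n, U1 j.succ = Fin.cons (t j) (V j) := fun j => rfl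
    have key : ∀ j : Fin n, 3 * (a * qf S1 (U1 j.succ)) ≤ 4 * qf (schur a b M) (V j) := by
      intro j
      have h1 := hmin1 U1 hU1 j.succ
      rw [hrow, hblk, qf_blk] at h1 ⊢
      rw [qf_schur]
      have h2 := ht j
      set s := b ⬝ᵥ V j
      set m := qf M (V j)
      nlinarith
    refine ⟨U1 * U0, by rw [Matrix.det_mul]; exact hU1.mul hU0, ?_⟩
    have e : ∀ j, qf S ((U1 * U0) j) = qf S1 (U1 j) := by
      intro j; rw [hS1, qf_conj, Matrix.mul_apply_eq_vecMul]
    simp only [e]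
    rw [Fin.prod_univ_succ, hrow0]
    have haR : (0:ℝ) < a := by exact_mod_cast hapos
    have hs0 : ∀ j : Fin n, (0:ℝ) ≤ qf S1 (U1 j.succ) := by
      intro j; exact_mod_cast hapos.le.trans (hmin1 U1 hU1 j.succ)
    have hdR : (S.det : ℝ) * a^n = a * (schur a b M).det := by
      have := det_schur a b M
      rw [← hblk, hdet1] at this
      exact_mod_cast this
    have hprod : (3/4 * (a:ℝ))^n * ∏ j : Fin n, (qf S1 (U1 j.succ) : ℝ) ≤
        ∏ j : Fin n, (qf (schur a b M) (V j) : ℝ) := by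
      have : (3/4 * (a:ℝ))^n * ∏ j : Fin n, (qf S1 (U1 j.succ) : ℝ) =
        ∏ j : Fin n, (3/4 * (a:ℝ) * (qf S1 (U1 j.succ) : ℝ)) := by
        rw [Finset.prod_mul_distrib]; simp
      rw [this]
      apply Finset.prod_le_prod
      · intro j _; have := hs0 j; positivity
      · intro j _
        have : (3:ℝ) * (a * qf S1 (U1 j.succ)) ≤ 4 * qf (schur a b M) (V j) := by exact_mod_cast key j
        linarith
    have h3 := hprod.trans hVb
    set pr := ∏ j : Fin n, (qf S1 (U1 j.succ) : ℝ)
    have h4 : (a * pr) * (3/4 * (a:ℝ))^n ≤ C * (S.det * a^n) := by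
      rw [hdR]
      calc a * pr * (3/4 * (a:ℝ))^n = a * ((3/4 * (a:ℝ))^n * pr) := by ring
        _ ≤ a * (C * (schur a b M).det) := by gcongr
        _ = _ := by ring
    have h5 : C * (4/3)^n * S.det * (3/4 * (a:ℝ))^n = C * (S.det * a^n) := by
      rw [mul_pow]
      have : ((4:ℝ)/3)^n * (3/4)^n = 1 := by rw [← mul_pow]; norm_num
      linear_combination C * S.det * a^n * this
    rw [← h5] at h4
    exact le_of_mul_le_mul_right h4 (by positivity)

end

section

lemma quot_card {d : ℕ} (B : Matrix (Fin d) (Fin d) ℤ) (hB : B.det ≠ 0) :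
    Nat.card ((Fin d → ℤ) ⧸ LinearMap.range (Matrix.toLin' B)) = B.det.natAbs := by
  have hinj : Function.Injective (Matrix.toLin' B) := by
    rw [← LinearMap.ker_eq_bot, LinearMap.ker_eq_bot']
    intro m hm
    exact Matrix.eq_zero_of_mulVec_eq_zero hB (by simpa using hm)
  have := Submodule.natAbs_det_equiv (LinearMap.range (Matrix.toLin' B))
    (LinearEquiv.ofInjective (Matrix.toLin' B) hinj)
  rw [← this]
  have e : ((LinearMap.range (Matrix.toLin' B)).subtype ∘ₗ
      AddMonoidHom.toIntLinearMap ((LinearEquiv.ofInjective (Matrix.toLin' B) hinj :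
        (Fin d → ℤ) →+ LinearMap.range (Matrix.toLin' B)))) = Matrix.toLin' B := by
    ext x; rfl
  rw [e, LinearMap.det_toLin']

lemma sum_mem_sym {d : ℕ} {Q : Set (Fin d → ℝ)} (hc : Convex ℝ Q) (hs : ∀ x ∈ Q, -x ∈ Q)
    (h0 : (0 : Fin d → ℝ) ∈ Q) (v : Fin d → Fin d → ℝ) (hv : ∀ i, v i ∈ Q) (δ : Fin d → ℝ)
    (hδ : ∑ i, |δ i| ≤ 1) : ∑ i, δ i • v i ∈ Q := by
  have hw : ∀ i, ∃ u ∈ Q, δ i • v i = |δ i| • u := by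
    intro i
    rcases abs_cases (δ i) with h | h
    · exact ⟨v i, hv i, by rw [h.1]⟩
    · exact ⟨-v i, hs _ (hv i), by rw [h.1]; simp⟩
  choose u hu hu2 using hw
  have := hc.sum_mem (t := Finset.univ) (w := fun o : Option (Fin d) => o.elim (1 - ∑ i, |δ i|) (fun i => |δ i|))
    (z := fun o => o.elim 0 u) (by
      intro o _
      cases o with
      | none => simpa using hδ
      | some i => exact abs_nonneg _) (by rw [Fintype.sum_option]; simp) (by
      intro o _
      cases o with
      | none => exact h0
      | some i => exact hu i)
  rw [Fintype.sum_option] at this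
  simp only [Option.elim, smul_zero, zero_add] at this
  simpa only [hu2] using this

lemma det_le_count {d : ℕ} (hd : 0 < d) {Q : Set (Fin d → ℝ)} (hc : Convex ℝ Q) (hs : ∀ x ∈ Q, -x ∈ Q)
    (T : Finset (Fin d → ℤ)) (hT : ∀ x, x ∈ T ↔ intVec x ∈ Q) (A : Matrix (Fin d) (Fin d) ℤ)
    (hA : ∀ i, A i ∈ T) (hdet : A.det ≠ 0) : A.det.natAbs ≤ T.card * d ^ d := by
  classical
  have hR : (A.det : ℝ) ≠ 0 := by exact_mod_cast hdet
  have hv : ∀ i, intVec (A i) ∈ Q := fun i => (hT _).1 (hA i)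
  have h0 : (0 : Fin d → ℝ) ∈ Q := by
    have h1 := hv ⟨0, hd⟩
    have := hc h1 (hs _ h1) (by norm_num : (0:ℝ) ≤ 1/2) (by norm_num : (0:ℝ) ≤ 1/2) (by norm_num)
    simpa using this
  let N := LinearMap.range (Matrix.toLin' A.transpose)
  have hcard : Nat.card ((Fin d → ℤ) ⧸ N) = A.det.natAbs := by
    rw [← Matrix.det_transpose]; exact quot_card _ (by rwa [Matrix.det_transpose])
  have hfin : Finite ((Fin d → ℤ) ⧸ N) := Nat.finite_of_card_ne_zero (by rw [hcard]; exact Int.natAbs_ne_zero.2 hdet)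
  have := Fintype.ofFinite ((Fin d → ℤ) ⧸ N)
  rw [← hcard, Nat.card_eq_fintype_card, ← Finset.card_univ]
  -- coordinates
  let y : (Fin d → ℤ) → Fin d → ℝ := fun z i => (Matrix.cramer A.transpose z i : ℝ) / A.det
  have hy : ∀ z : Fin d → ℤ, intVec z = ∑ i, y z i • intVec (A i) := by
    intro z
    have h := Matrix.mulVec_cramer A.transpose z
    ext j
    have hj := congrFun h j
    simp only [Matrix.mulVec, dotProduct, Matrix.transpose_apply, Matrix.det_transpose, Pi.smul_apply, smul_eq_mul] at hj
    simp only [Finset.sum_apply, Pi.smul_apply, smul_eq_mul, y, intVec]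
    have hj' : ∑ x, (A x j : ℝ) * (Matrix.cramer A.transpose z x : ℝ) = A.det * z j := by exact_mod_cast hj
    have : (z j : ℝ) = (A.det * z j) / A.det := by field_simp
    rw [this, ← hj', Finset.sum_div]
    exact Finset.sum_congr rfl (fun _ _ => by ring)
  -- reduced representative
  let r : (Fin d → ℤ) → (Fin d → ℤ) := fun z => z - A.transpose.mulVec (fun i => ⌊y z i⌋)
  have hr : ∀ z, intVec (r z) = ∑ i, Int.fract (y z i) • intVec (A i) := by
    intro z
    have : intVec (r z) = intVec z - ∑ i, ((⌊y z i⌋ : ℤ) : ℝ) • intVec (A i) := by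
      ext j
      simp [r, intVec, Matrix.mulVec, dotProduct, mul_comm]
    rw [this, hy z, ← Finset.sum_sub_distrib]
    refine Finset.sum_congr rfl (fun i _ => ?_)
    rw [← sub_smul]; rfl
  have hrq : ∀ z, (Submodule.Quotient.mk (r z) : (Fin d → ℤ) ⧸ N) = Submodule.Quotient.mk z := by
    intro z
    rw [Submodule.Quotient.eq]
    refine ⟨-(fun i => ⌊y z i⌋), ?_⟩
    simp [r, Matrix.mulVec_neg]
  let f : ((Fin d → ℤ) ⧸ N) → (Fin d → Fin d) := fun q i =>
    ⟨⌊(d:ℝ) * Int.fract (y q.out i)⌋₊, by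
      rw [Nat.floor_lt (by have := Int.fract_nonneg (y q.out i); positivity)]
      have := Int.fract_lt_one (y q.out i)
      have hd' : (0:ℝ) < d := by exact_mod_cast hd
      nlinarith⟩
  have := Finset.card_le_mul_card_image_of_maps_to (f := f) (s := Finset.univ) (t := Finset.univ)
    (fun _ _ => Finset.mem_univ _) T.card ?_
  · simpa using this
  intro b _
  by_cases hne : ((Finset.univ.filter fun a => f a = b)).Nonempty
  swap
  · rw [Finset.not_nonempty_iff_eq_empty.1 hne]; simp
  obtain ⟨q0, hq0⟩ := hne
  apply Finset.card_le_card_of_injOn (fun q => r q.out - r q0.out)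
  · intro q hq
    have e : f q = f q0 := by
      simp only [Finset.coe_filter, Finset.mem_filter, Finset.mem_univ, true_and, Set.mem_ofPred_eq] at hq hq0
      rw [hq, hq0]
    change r q.out - r q0.out ∈ T
    rw [hT]
    have e2 : intVec (r q.out - r q0.out) =
        ∑ i, (Int.fract (y q.out i) - Int.fract (y q0.out i)) • intVec (A i) := by
      have : intVec (r q.out - r q0.out) = intVec (r q.out) - intVec (r q0.out) := by ext j; simp [intVec]
      rw [this, hr, hr, ← Finset.sum_sub_distrib]
      exact Finset.sum_congr rfl (fun i _ => by rw [sub_smul])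
    rw [e2]
    apply sum_mem_sym hc hs h0 _ hv
    have hd' : (0:ℝ) < d := by exact_mod_cast hd
    have : ∀ i ∈ Finset.univ, |Int.fract (y q.out i) - Int.fract (y q0.out i)| ≤ 1 / d := by
      intro i _
      have h1 := congrArg Fin.val (congrFun e i)
      simp only [f] at h1
      have a1 := Nat.floor_le (a := (d:ℝ) * Int.fract (y q.out i)) (by have := Int.fract_nonneg (y q.out i); positivity)
      have a2 := Nat.lt_floor_add_one ((d:ℝ) * Int.fract (y q.out i))
      have b1 := Nat.floor_le (a := (d:ℝ) * Int.fract (y q0.out i)) (by have := Int.fract_nonneg (y q0.out i); positivity)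
      have b2 := Nat.lt_floor_add_one ((d:ℝ) * Int.fract (y q0.out i))
      rw [h1] at a1 a2
      rw [le_div_iff₀ hd', mul_comm, ← abs_of_pos hd', ← abs_mul, abs_le]
      constructor <;> linarith
    refine (Finset.sum_le_sum this).trans ?_
    simp only [Finset.sum_const, Finset.card_univ, Fintype.card_fin, nsmul_eq_mul]
    field_simp
    exact le_refl _
  · intro q _ q' _ h
    have h' : r q.out = r q'.out := by simpa using h
    have := congrArg (Submodule.Quotient.mk (p := N)) h'
    rw [hrq, hrq] at this
    rw [← Quotient.out_eq q, ← Quotient.out_eq q']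
    exact this

lemma exists_nonsing {d : ℕ} (T : Set (Fin d → ℤ)) (h : affineSpan ℝ (intVec '' T) = ⊤) :
    ∃ A : Matrix (Fin d) (Fin d) ℤ, (∀ i, A i ∈ T) ∧ A.det ≠ 0 := by
  have hsp : Submodule.span ℝ (intVec '' T) = ⊤ := by
    rw [eq_top_iff]
    intro x _
    have hx : x ∈ affineSpan ℝ (intVec '' T) := by rw [h]; trivial
    exact affineSpan_le_toAffineSubspace_span hx
  obtain ⟨b, hb, hbs, hli⟩ := exists_linearIndependent ℝ (intVec '' T)
  rw [hsp] at hbs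
  let B := Module.Basis.mk hli (by simp [hbs])
  have hfin : Fintype b := FiniteDimensional.fintypeBasisIndex B
  have hc : Fintype.card b = d := by
    have := Module.finrank_eq_card_basis B
    simpa using this.symm
  let e : Fin d ≃ b := (Fintype.equivFinOfCardEq hc).symm
  choose z hz hz2 using fun i : Fin d => hb (e i).2
  refine ⟨Matrix.of z, hz, ?_⟩
  have hli2 : LinearIndependent ℝ (fun i => ((e i : b) : Fin d → ℝ)) := hli.comp e e.injective
  have hli3 : LinearIndependent ℝ ((Matrix.of z).map (Int.cast : ℤ → ℝ)).row := by
    convert hli2 using 1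
    ext i j
    rw [← hz2]; rfl
  rw [Matrix.linearIndependent_rows_iff_isUnit, Matrix.isUnit_iff_isUnit_det] at hli3
  intro h0
  have : ((Matrix.of z).map (Int.cast : ℤ → ℝ)).det = 0 := by
    have := (Int.castRingHom ℝ).map_det (Matrix.of z)
    rw [h0] at this
    simpa using this.symm
  rw [this] at hli3; simp at hli3

lemma exists_max {d : ℕ} (T : Finset (Fin d → ℤ)) (h : affineSpan ℝ (intVec '' (T : Set (Fin d → ℤ))) = ⊤) :
    ∃ A : Matrix (Fin d) (Fin d) ℤ, (∀ i, A i ∈ T) ∧ A.det ≠ 0 ∧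
      ∀ A' : Matrix (Fin d) (Fin d) ℤ, (∀ i, A' i ∈ T) → |A'.det| ≤ |A.det| := by
  obtain ⟨A0, h0, h0'⟩ := exists_nonsing _ h
  have hfin : {A : Matrix (Fin d) (Fin d) ℤ | ∀ i, A i ∈ T}.Finite := by
    have := Set.Finite.pi' (t := fun _ : Fin d => (T : Set (Fin d → ℤ))) (fun _ => T.finite_toSet)
    exact this
  obtain ⟨A, hA, hmax⟩ := Set.exists_max_image _ (fun A : Matrix (Fin d) (Fin d) ℤ => |A.det|) hfin ⟨A0, h0⟩
  refine ⟨A, hA, ?_, hmax⟩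
  intro hz
  have := hmax A0 h0
  simp only [hz, abs_zero, abs_nonpos_iff] at this
  exact h0' this

theorem box (d : ℕ) (hd : 0 < d) : ∃ C : ℝ, 0 < C ∧ ∀ (T : Finset (Fin d → ℤ)) (Q : Set (Fin d → ℝ)),
    Convex ℝ Q → (∀ x ∈ Q, -x ∈ Q) → (∀ x, x ∈ T ↔ intVec x ∈ Q) →
    affineSpan ℝ (intVec '' (T : Set (Fin d → ℤ))) = ⊤ →
    ∃ U : Matrix (Fin d) (Fin d) ℤ, IsUnit U.det ∧ ∃ g : Fin d → ℕ, Antitone g ∧ (∀ j, 1 ≤ g j) ∧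
      (∀ x ∈ T, ∀ j, |U.mulVec x j| ≤ g j) ∧ (∏ j, (g j : ℝ)) ≤ C * T.card := by
  obtain ⟨C, hC, hH⟩ := hermite d
  refine ⟨Real.sqrt (d^d * C) * d^d, by positivity, ?_⟩
  intro T Q hc hs hT hspan
  obtain ⟨A, hA, hdet, hmax⟩ := exists_max T hspan
  have hcount := det_le_count hd hc hs T hT A hA hdet
  let S : Matrix (Fin d) (Fin d) ℤ := A.transpose * A
  have hqf : ∀ y, qf S y = ∑ i, (A i ⬝ᵥ y)^2 := by
    intro y
    rw [qf, ← Matrix.mulVec_mulVec, Matrix.dotProduct_mulVec, Matrix.vecMul_transpose]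
    simp [dotProduct, Matrix.mulVec, sq]
  have hPD : PD S := by
    refine ⟨Matrix.isSymm_transpose_mul_self A, ?_⟩
    intro x hx
    rw [hqf]
    apply lt_of_le_of_ne (Finset.sum_nonneg (fun _ _ => sq_nonneg _))
    intro h
    apply hx
    apply Matrix.eq_zero_of_mulVec_eq_zero hdet
    ext i
    have := (Finset.sum_eq_zero_iff_of_nonneg (fun i _ => sq_nonneg (A i ⬝ᵥ x))).1 h.symm i (Finset.mem_univ i)
    have h2 : A i ⬝ᵥ x = 0 := by simpa using this
    exact h2
  obtain ⟨U, hU, hprod⟩ := hH S hPD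
  let γ : Fin d → ℕ := fun j => ∑ i, (A i ⬝ᵥ U j).natAbs
  have hγZ : ∀ j, (γ j : ℤ) = ∑ i, |A i ⬝ᵥ U j| := by intro j; simp [γ]
  have hγ1 : ∀ j, 1 ≤ γ j := by
    intro j
    have h1 : 0 < qf S (U j) := by
      apply hPD.2
      intro h
      have : U.det = 0 := Matrix.det_eq_zero_of_row_eq_zero j (fun i => congrFun h i)
      rw [this] at hU; simp at hU
    rw [hqf] at h1
    by_contra hlt
    have : γ j = 0 := by omega
    have h2 := (Finset.sum_eq_zero_iff.1 this)
    have : ∑ i, (A i ⬝ᵥ U j)^2 = 0 := Finset.sum_eq_zero (fun i hi => by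
      have := h2 i hi; rw [Int.natAbs_eq_zero] at this; rw [this]; rfl)
    omega
  have hbd : ∀ x ∈ T, ∀ j, |U.mulVec x j| ≤ γ j := by
    intro x hx j
    have h := Matrix.mulVec_cramer A.transpose x
    have hcr : ∀ i, |Matrix.cramer A.transpose x i| ≤ |A.det| := by
      intro i
      rw [Matrix.cramer_transpose_apply]
      apply hmax
      intro i'
      by_cases hi : i' = i
      · subst hi; rw [Matrix.updateRow_self]; exact hx
      · rw [Matrix.updateRow_ne hi]; exact hA i'
    have h2 : A.det * U.mulVec x j = ∑ i, Matrix.cramer A.transpose x i * (A i ⬝ᵥ U j) := by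
      have : A.det * U.mulVec x j = U.mulVec (A.transpose.mulVec (Matrix.cramer A.transpose x)) j := by
        rw [h, Matrix.mulVec_smul, Matrix.det_transpose]; rfl
      rw [this, Matrix.mulVec_transpose]
      change U j ⬝ᵥ Matrix.vecMul _ A = _
      rw [dotProduct_comm, ← Matrix.dotProduct_mulVec]
      rfl
    have h3 : |A.det| * |U.mulVec x j| ≤ |A.det| * γ j := by
      rw [← abs_mul, h2, hγZ, Finset.mul_sum]
      refine (Finset.abs_sum_le_sum_abs _ _).trans (Finset.sum_le_sum fun i _ => ?_)
      rw [abs_mul]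
      exact mul_le_mul_of_nonneg_right (hcr i) (abs_nonneg _)
    exact le_of_mul_le_mul_left h3 (abs_pos.2 hdet)
  have hγsq : ∀ j, ((γ j : ℝ))^2 ≤ d * qf S (U j) := by
    intro j
    have : (γ j : ℤ)^2 ≤ d * qf S (U j) := by
      rw [hγZ, hqf]
      refine (sq_sum_le_card_mul_sum_sq (s := Finset.univ)).trans ?_
      simp
    exact_mod_cast this
  have hprod2 : (∏ j, (γ j : ℝ))^2 ≤ (Real.sqrt (d^d * C) * |(A.det:ℝ)|)^2 := by
    rw [mul_pow, Real.sq_sqrt (by positivity), sq_abs, ← Finset.prod_pow]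
    calc ∏ j, (γ j : ℝ)^2 ≤ ∏ j, ((d:ℝ) * qf S (U j)) :=
          Finset.prod_le_prod (fun _ _ => by positivity) (fun j _ => hγsq j)
      _ = d^d * ∏ j, (qf S (U j) : ℝ) := by rw [Finset.prod_mul_distrib]; simp
      _ ≤ d^d * (C * S.det) := by gcongr
      _ = _ := by
        have : S.det = A.det^2 := by simp [S, sq]
        rw [this]; push_cast; ring
  have hprod3 : ∏ j, (γ j : ℝ) ≤ Real.sqrt (d^d * C) * |(A.det:ℝ)| :=
    le_of_sq_le_sq hprod2 (by positivity)
  have hAd : |(A.det:ℝ)| ≤ T.card * d^d := by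
    have : ((A.det.natAbs : ℕ) : ℝ) ≤ T.card * d^d := by exact_mod_cast hcount
    rwa [Nat.cast_natAbs, Int.cast_abs] at this
  let σ := Tuple.sort (fun j => -(γ j : ℤ))
  refine ⟨U.submatrix σ id, ?_, fun j => γ (σ j), ?_, fun j => hγ1 _, ?_, ?_⟩
  · rw [Matrix.det_permute]
    exact IsUnit.mul (by simp) hU
  · intro i j hij
    have := Tuple.monotone_sort (fun j => -(γ j : ℤ)) hij
    simp only [Function.comp] at this
    change γ (σ j) ≤ γ (σ i)
    have h' : -(γ (σ i) : ℤ) ≤ -(γ (σ j) : ℤ) := this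
    omega
  · intro x hx j
    exact hbd x hx (σ j)
  · rw [Equiv.prod_comp σ (fun j => (γ j : ℝ))]
    calc _ ≤ _ := hprod3
      _ ≤ Real.sqrt (d^d * C) * (T.card * d^d) := by gcongr
      _ = _ := by ring

end

section

lemma intVec_inj {d : ℕ} : Function.Injective (intVec (d := d)) := by
  intro x y h
  ext i
  have := congrFun h i
  simpa [intVec] using this

lemma equiv_of {d : ℕ} (x0 : Fin d → ℤ) (U : Matrix (Fin d) (Fin d) ℤ) (hU : IsUnit U.det) :
    ∃ σ : (Fin d → ℝ) ≃ᵃ[ℝ] (Fin d → ℝ), σ '' latticeSet d = latticeSet d ∧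
      (∀ x, σ x = (U.map (Int.cast : ℤ → ℝ)).mulVec (x - intVec x0)) ∧
      ∀ z : Fin d → ℤ, σ (intVec z) = intVec (U.mulVec (z - x0)) := by
  have e1 : (U.map (Int.cast : ℤ → ℝ)) * (U⁻¹.map (Int.cast : ℤ → ℝ)) = 1 := by
    have := congrArg (Int.castRingHom ℝ).mapMatrix (Matrix.mul_nonsing_inv U hU)
    rw [map_mul, map_one] at this
    exact this
  have e2 : (U⁻¹.map (Int.cast : ℤ → ℝ)) * (U.map (Int.cast : ℤ → ℝ)) = 1 := by
    have := congrArg (Int.castRingHom ℝ).mapMatrix (Matrix.nonsing_inv_mul U hU)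
    rw [map_mul, map_one] at this
    exact this
  let σ : (Fin d → ℝ) ≃ᵃ[ℝ] (Fin d → ℝ) := (AffineEquiv.constVAdd ℝ (Fin d → ℝ) (-intVec x0)).trans
    (Matrix.toLin'OfInv e2 e1).toAffineEquiv
  have h1 : ∀ x, σ x = (U.map (Int.cast : ℤ → ℝ)).mulVec (x - intVec x0) := by
    intro x
    have : σ x = Matrix.toLin' (U.map (Int.cast : ℤ → ℝ)) (-intVec x0 + x) := rfl
    rw [this, neg_add_eq_sub, Matrix.toLin'_apply]
  have h2 : ∀ z : Fin d → ℤ, σ (intVec z) = intVec (U.mulVec (z - x0)) := by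
    intro z
    rw [h1]
    ext j
    simp [intVec, Matrix.mulVec, dotProduct]
  refine ⟨σ, ?_, h1, h2⟩
  apply Set.Subset.antisymm
  · rintro _ ⟨_, ⟨z, rfl⟩, rfl⟩
    exact ⟨_, (h2 z).symm⟩
  · rintro _ ⟨z, rfl⟩
    refine ⟨_, ⟨U⁻¹.mulVec z + x0, rfl⟩, ?_⟩
    rw [h2, add_sub_cancel_right, Matrix.mulVec_mulVec, Matrix.mul_nonsing_inv U hU, Matrix.one_mulVec]

lemma centre_int {d : ℕ} {V : Finset (Fin d → ℤ)} {P : Set (Fin d → ℝ)}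
    (hP : P = convexHull ℝ (intVec '' (V : Set (Fin d → ℤ)))) (hne : P.Nonempty) {c : Fin d → ℝ}
    (hc : ∀ x, x ∈ P ↔ (2 : ℝ) • c - x ∈ P) : ∃ s : Fin d → ℤ, (2:ℝ) • c = intVec s := by
  have hcomp : IsCompact P := by
    rw [hP]; exact (V.finite_toSet.image _).isCompact_convexHull (𝕜 := ℝ)
  obtain ⟨v, hv⟩ := hcomp.extremePoints_nonempty hne
  have hv' : (2:ℝ) • c - v ∈ P.extremePoints ℝ := by
    rw [mem_extremePoints] at hv ⊢
    refine ⟨(hc _).1 hv.1, ?_⟩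
    intro x1 h1 x2 h2 hx
    have := hv.2 _ ((hc _).1 h1) _ ((hc _).1 h2) (by
      obtain ⟨a, b, ha, hb, hab, he⟩ := hx
      refine ⟨a, b, ha, hb, hab, ?_⟩
      have hb' : b = 1 - a := by linarith
      subst hb'
      have : v = (2:ℝ) • c - (a • x1 + (1 - a) • x2) := by rw [he]; abel
      rw [this]; module)
    constructor
    · rw [← this.1]; abel
    · rw [← this.2]; abel
  rw [hP] at hv hv'
  obtain ⟨z1, _, h1⟩ := extremePoints_convexHull_subset hv
  obtain ⟨z2, _, h2⟩ := extremePoints_convexHull_subset hv'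
  refine ⟨z1 + z2, ?_⟩
  have : intVec (z1 + z2) = intVec z1 + intVec z2 := by ext j; simp [intVec]
  rw [this, h1, h2]; abel

lemma centre_pt {d : ℕ} {P : Set (Fin d → ℝ)} {c : Fin d → ℝ}
    (hc : ∀ x, x ∈ P ↔ (2 : ℝ) • c - x ∈ P) {s : Fin d → ℤ} (hs : (2:ℝ) • c = intVec s)
    (hw : Odd (latticePts d P).ncard) : ∃ x0 : Fin d → ℤ, c = intVec x0 := by
  have hfin : (latticePts d P).Finite := by
    apply Set.finite_of_ncard_ne_zero
    rintro h; rw [h] at hw; simp at hw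
  have := hfin.fintype
  have hmem : ∀ x, x ∈ latticePts d P → s - x ∈ latticePts d P := by
    intro x hx
    have h1 := (hc _).1 hx
    rw [hs] at h1
    have : intVec (s - x) = intVec s - intVec x := by ext j; simp [intVec]
    change intVec (s - x) ∈ P
    rw [this]; exact h1
  let f : latticePts d P → latticePts d P := fun x => ⟨s - x.1, hmem _ x.2⟩
  have hf : Function.Involutive f := by
    intro x; apply Subtype.ext; simp [f]
  have : Fact (Nat.Prime 2) := ⟨Nat.prime_two⟩
  obtain ⟨a, ha⟩ := Equiv.Perm.exists_fixed_point_of_prime (p := 2) (n := 1) (α := latticePts d P)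
    (σ := hf.toPerm) (by
      rw [← Nat.card_eq_fintype_card, Nat.card_coe_set_eq]
      rw [Nat.odd_iff] at hw
      omega) (by
      ext x : 1
      simp [sq, hf x])
  have ha' : s - a.1 = a.1 := congrArg Subtype.val ha
  refine ⟨a.1, ?_⟩
  ext j
  have h1 := congrFun hs j
  have h2 := congrFun ha' j
  simp only [Pi.sub_apply] at h2
  have h3 : (s j : ℝ) = 2 * a.1 j := by
    have : s j = 2 * a.1 j := by omega
    exact_mod_cast this
  simp only [Pi.smul_apply, smul_eq_mul, intVec] at h1 ⊢
  linarith

theorem reduce (d : ℕ) (hd : 0 < d) : ∃ C : ℝ, 0 < C ∧ ∀ (P : Set (Fin d → ℝ)) (w : ℕ),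
    IsConvexLatticePolytope d P → IsFullDim d P → IsCentrallySymmetric d P →
    (latticePts d P).ncard = w → Odd w →
    ∃ P', LatticeEquiv d P P' ∧ IsConvexLatticePolytope d P' ∧ IsFullDim d P' ∧ (∀ x ∈ P', -x ∈ P') ∧
      ∃ g : Fin d → ℕ, Antitone g ∧ (∀ j, 1 ≤ g j) ∧ (∀ x ∈ P', ∀ j, |x j| ≤ g j) ∧
        ∏ j, (g j : ℝ) ≤ C * w := by
  classical
  obtain ⟨C, hC, hbox⟩ := box d hd
  refine ⟨C, hC, ?_⟩
  rintro P w ⟨V, hP⟩ hfull ⟨c, hc⟩ hw hodd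
  have hfin : (latticePts d P).Finite := by
    apply Set.finite_of_ncard_ne_zero
    rw [hw]; rintro h; rw [h] at hodd; simp at hodd
  have hne : P.Nonempty := by
    have : (latticePts d P).Nonempty := by
      rw [← Set.ncard_pos hfin, hw]; exact hodd.pos
    obtain ⟨x, hx⟩ := this
    exact ⟨_, hx⟩
  obtain ⟨s, hs⟩ := centre_int hP hne hc
  obtain ⟨x0, hx0⟩ := centre_pt hc hs (hw ▸ hodd)
  have hcv : Convex ℝ P := by rw [hP]; exact convex_convexHull _ _
  have iv : ∀ a b : Fin d → ℤ, intVec (a + b) = intVec a + intVec b := by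
    intro a b; ext j; simp [intVec]
  have hVP : ∀ v ∈ V, intVec v ∈ P := by
    intro v hv; rw [hP]; exact subset_convexHull _ _ ⟨v, hv, rfl⟩
  let Q : Set (Fin d → ℝ) := {x | x + c ∈ P}
  let T : Finset (Fin d → ℤ) := hfin.toFinset.image (fun x => x - x0)
  have hTcard : T.card = w := by
    rw [Finset.card_image_of_injective _ (sub_left_injective), ← hw, Set.ncard_eq_toFinset_card _ hfin]
  have hT : ∀ x, x ∈ T ↔ intVec x ∈ Q := by
    intro x
    change x ∈ Finset.image _ _ ↔ intVec x + c ∈ P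
    rw [hx0, ← iv]
    simp only [Finset.mem_image, Set.Finite.mem_toFinset]
    constructor
    · rintro ⟨a, ha, rfl⟩; rw [sub_add_cancel]; exact ha
    · intro h; exact ⟨x + x0, h, by simp⟩
  obtain ⟨τ, hτ1, hτ2, hτ3⟩ := equiv_of x0 1 (by simp)
  have hspanV : affineSpan ℝ (intVec '' (V : Set (Fin d → ℤ))) = ⊤ := by
    rw [← affineSpan_convexHull, ← hP]; exact hfull
  have hspan : affineSpan ℝ (intVec '' (T : Set (Fin d → ℤ))) = ⊤ := by
    rw [AffineEquiv.span_eq_top_iff τ] at hspanV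
    rw [eq_top_iff, ← hspanV]
    apply affineSpan_mono
    rintro _ ⟨_, ⟨v, hv, rfl⟩, rfl⟩
    refine ⟨v - x0, ?_, by rw [hτ3]; simp⟩
    rw [Finset.mem_coe, hT]
    change intVec (v - x0) + c ∈ P
    rw [hx0, ← iv, sub_add_cancel]
    exact hVP v hv
  obtain ⟨U, hU, g, hg, hg1, hbd, hprod⟩ := hbox T Q (by
      intro x hx y hy a b ha hb hab
      have h := hcv hx hy ha hb hab
      change a • x + b • y + c ∈ P
      have hb' : b = 1 - a := by linarith
      subst hb'
      convert h using 1
      module) (by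
      intro x hx
      have := (hc _).1 hx
      change -x + c ∈ P
      convert this using 1
      module) hT hspan
  obtain ⟨σ, hσ1, hσ2, hσ3⟩ := equiv_of x0 U hU
  have hP' : σ '' P = convexHull ℝ (intVec '' ((V.image (fun v => U.mulVec (v - x0)) : Finset _) : Set (Fin d → ℤ))) := by
    have h := AffineMap.image_convexHull (σ : (Fin d → ℝ) →ᵃ[ℝ] (Fin d → ℝ)) (intVec '' (V : Set (Fin d → ℤ)))
    rw [← hP] at h
    have h' : σ '' P = convexHull ℝ (σ '' (intVec '' (V : Set (Fin d → ℤ)))) := h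
    rw [h', Finset.coe_image, Set.image_image, Set.image_image]
    simp only [hσ3]
  refine ⟨σ '' P, ⟨σ, hσ1, rfl⟩, ⟨_, hP'⟩, ?_, ?_, g, hg, hg1, ?_, by rw [hTcard] at hprod; exact hprod⟩
  · exact (AffineEquiv.span_eq_top_iff σ).1 hfull
  · rintro _ ⟨p, hp, rfl⟩
    refine ⟨(2:ℝ) • c - p, (hc _).1 hp, ?_⟩
    rw [hσ2, hσ2, ← Matrix.mulVec_neg, ← hx0]
    congr 1
    module
  · have hsub : σ '' P ⊆ Set.pi Set.univ (fun j => Set.Icc (-(g j:ℝ)) (g j)) := by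
      rw [hP']
      apply convexHull_min
      · rintro _ ⟨z, hz, rfl⟩ j _
        rw [Finset.mem_coe, Finset.mem_image] at hz
        obtain ⟨v, hv, rfl⟩ := hz
        have hvT : v - x0 ∈ T := by
          rw [hT]
          change intVec (v - x0) + c ∈ P
          rw [hx0, ← iv, sub_add_cancel]
          exact hVP v hv
        have := hbd _ hvT j
        rw [Set.mem_Icc, ← abs_le]
        simp only [intVec]
        exact_mod_cast this
      · exact convex_pi (fun j _ => convex_Icc _ _)
    intro x hx j
    have := hsub hx j trivial
    rw [Set.mem_Icc, ← abs_le] at this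
    exact this

end

section

/-- split off the first coordinate -/
def spl (m : ℕ) : (Fin (m+2) → ℝ) →ₗ[ℝ] ℝ × (Fin (m+1) → ℝ) where
  toFun x := (x 0, fun i => x i.succ)
  map_add' _ _ := rfl
  map_smul' _ _ := rfl

lemma spl_inj (m : ℕ) : Function.Injective (spl m) := by
  intro x y h
  ext i
  refine Fin.cases ?_ (fun j => ?_) i
  · exact congrArg Prod.fst h
  · exact congrFun (congrArg Prod.snd h) j

/-- the data set determined by a finite set of integer vectors -/
def dataOf (k : ℕ) (S : Finset (Fin (k+1) → ℤ)) : Set ((Fin k → ℝ) × ENNReal) :=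
  (fun z : Fin (k+1) → ℤ => ((fun i : Fin k => (z i.succ : ℝ) / (z 0 : ℝ)),
          ENNReal.ofReal ((z 0 : ℝ) * (cvol k).toReal))) '' (S : Set (Fin (k+1) → ℤ))

def IsCode (m : ℕ) (P : Set (Fin (m+2) → ℝ)) (E : Set (Fin (m+1) → ℤ)) (S : Finset (Fin (m+2) → ℤ)) (s : ℤ) :
    Prop :=
  ∃ L : Finset (ℝ × (Fin (m+1) → ℝ)), convexHull ℝ (L : Set (ℝ × (Fin (m+1) → ℝ))) = spl m '' P ∧
    domS L = convexHull ℝ (intVec '' E) ∧ (interior (domS L)).Nonempty ∧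
    (∀ y ∈ convexHull ℝ (L : Set (ℝ × (Fin (m+1) → ℝ))), -y ∈ convexHull ℝ (L : Set (ℝ × (Fin (m+1) → ℝ)))) ∧
    (fun q => (q.1, volume (cellS L q))) '' Facets L = dataOf (m+1) S ∧
    (∀ y ∈ convexHull ℝ (L : Set (ℝ × (Fin (m+1) → ℝ))), (s:ℝ) ≤ y.1) ∧
    ∃ y ∈ convexHull ℝ (L : Set (ℝ × (Fin (m+1) → ℝ))), y.1 = (s:ℝ)

lemma IsCode.unique {m : ℕ} {P P' : Set (Fin (m+2) → ℝ)} {E S s} (h : IsCode m P E S s)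
    (h' : IsCode m P' E S s) : P = P' := by
  obtain ⟨L, a1, a2, a3, a4, a5, a6, a7⟩ := h
  obtain ⟨L', b1, b2, b3, b4, b5, b6, b7⟩ := h'
  have := code_inj (a2.trans b2.symm) a3 a4 b4 (a5.trans b5.symm) s a6 a7 b6 b7
  rw [a1, b1] at this
  exact (spl_inj m).image_injective this

/-- the sets of facet vectors compatible with a box -/
def FVSet (k : ℕ) (C : ℝ) (g : Fin (k+1) → ℕ) : Set (Finset (Fin (k+1) → ℤ)) :=
  {S | (∀ z ∈ S, 1 ≤ z 0) ∧ ∀ j, (∑ z ∈ S, |(z j:ℝ)|) * g j ≤ C * ∏ i, (g i:ℝ)}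

lemma code_poly (m : ℕ) (P : Set (Fin (m+2) → ℝ)) (hP : IsConvexLatticePolytope (m+2) P)
    (hfull : IsFullDim (m+2) P) (hsym : ∀ x ∈ P, -x ∈ P) (g : Fin (m+2) → ℕ)
    (hg : ∀ x ∈ P, ∀ j, |x j| ≤ g j) :
    ∃ E ∈ DSet m (fun i => g i.succ), ∃ S ∈ FVSet (m+1) (2^(m+2) / (cvol (m+1)).toReal) g,
      ∃ s ∈ Finset.Icc (-(g 0 : ℤ)) (g 0), IsCode m P E S s := by
  classical
  obtain ⟨V, hV⟩ := hP
  have hc0 : 0 < (cvol (m+1)).toReal := ENNReal.toReal_pos (cvol_pos _).ne' (cvol_ne_top _)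
  have hVP : ∀ v ∈ V, intVec v ∈ P := by
    intro v hv; rw [hV]; exact subset_convexHull _ _ ⟨v, hv, rfl⟩
  let L : Finset (ℝ × (Fin (m+1) → ℝ)) := V.image (fun v => ((v 0 : ℝ), intVec (fun i => v (Fin.succ i))))
  have hLset : (L : Set (ℝ × (Fin (m+1) → ℝ))) = spl m '' (intVec '' (V : Set (Fin (m+2) → ℤ))) := by
    rw [Finset.coe_image, Set.image_image]; rfl
  have hhull : convexHull ℝ (L : Set (ℝ × (Fin (m+1) → ℝ))) = spl m '' P := by
    rw [hLset, hV, LinearMap.image_convexHull]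
  have hdom : domS L = (fun x : Fin (m+2) → ℝ => fun i : Fin (m+1) => x i.succ) '' P := by
    rw [domS_eq, hhull, Set.image_image]; rfl
  have hdconv : Convex ℝ (domS L) := by rw [domS]; exact convex_convexHull _ _
  let tl : (Fin (m+2) → ℝ) →ₗ[ℝ] (Fin (m+1) → ℝ) := (LinearMap.snd ℝ ℝ _).comp (spl m)
  have htl : Function.Surjective tl := by
    intro y; exact ⟨Fin.cons 0 y, rfl⟩
  have hne : (interior (domS L)).Nonempty := by
    rw [← hdconv.convexHull_eq, interior_convexHull_nonempty_iff_affineSpan_eq_top, hdom]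
    exact AffineMap.span_eq_top_of_surjective tl.toAffineMap htl hfull
  have hVne : V.Nonempty := by
    by_contra h
    rw [Finset.not_nonempty_iff_eq_empty] at h
    subst h
    obtain ⟨x, hx⟩ := hne
    have := interior_subset hx
    rw [hdom, hV] at this
    simp at this
  have hint : ∀ l ∈ L, ∃ (a : ℤ) (z : Fin (m+1) → ℤ), l = ((a : ℝ), intVec z) := by
    intro l hl
    obtain ⟨v, hv, rfl⟩ := Finset.mem_image.1 hl
    exact ⟨_, _, rfl⟩
  obtain ⟨S, hS1, hS2, hS3⟩ := code_exists hint hne g (by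
      intro l hl
      obtain ⟨v, hv, rfl⟩ := Finset.mem_image.1 hl
      exact hg _ (hVP v hv) 0) (by
      intro l hl i
      obtain ⟨v, hv, rfl⟩ := Finset.mem_image.1 hl
      exact hg _ (hVP v hv) i.succ)
  obtain ⟨v0, hv0, hmin⟩ := Finset.exists_min_image V (fun v => v 0) hVne
  refine ⟨{x | intVec x ∈ domS L}, ⟨domS L, hdconv, rfl, ?_⟩, S, ⟨hS1, ?_⟩, v0 0, ?_, L, hhull, ?_, hne, ?_, hS2, ?_, ?_⟩
  · intro x hx i
    change intVec x ∈ domS L at hx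
    rw [hdom] at hx
    obtain ⟨p, hp, he⟩ := hx
    have h1 := hg p hp i.succ
    have h2 : p i.succ = x i := congrFun he i
    rw [h2] at h1
    exact_mod_cast h1
  · intro j
    have := hS3 j
    rw [div_mul_eq_mul_div, le_div_iff₀ hc0]
    exact this
  · rw [Finset.mem_Icc, ← abs_le]
    have := hg _ (hVP v0 hv0) 0
    simp only [intVec] at this
    exact_mod_cast this
  · apply Set.Subset.antisymm
    · conv_lhs => rw [domS]
      apply convexHull_mono
      rintro _ ⟨l, hl, rfl⟩
      obtain ⟨a, z, rfl⟩ := hint l hl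
      refine ⟨z, ?_, rfl⟩
      change intVec z ∈ domS L
      rw [domS]
      exact subset_convexHull _ _ ⟨_, hl, rfl⟩
    · apply convexHull_min _ hdconv
      rintro _ ⟨z, hz, rfl⟩
      exact hz
  · intro y hy
    rw [hhull] at hy ⊢
    obtain ⟨p, hp, rfl⟩ := hy
    exact ⟨-p, hsym p hp, map_neg _ _⟩
  · intro y hy
    have : convexHull ℝ (L : Set (ℝ × (Fin (m+1) → ℝ))) ⊆ {y | ((v0 0 : ℤ) : ℝ) ≤ y.1} := by
      apply convexHull_min
      · intro l hl
        obtain ⟨v, hv, rfl⟩ := Finset.mem_image.1 hl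
        have := hmin v hv
        change ((v0 0 : ℤ) : ℝ) ≤ ((v 0 : ℤ) : ℝ)
        exact_mod_cast this
      · exact convex_halfSpace_ge (LinearMap.isLinear (LinearMap.fst ℝ ℝ (Fin (m+1) → ℝ))) _
    exact this hy
  · refine ⟨_, subset_convexHull _ _ (Finset.mem_coe.2 (Finset.mem_image_of_mem _ hv0)), rfl⟩

lemma LatticeEquiv.comm_trans {d : ℕ} {P₁ P₂ P : Set (Fin d → ℝ)} (h1 : LatticeEquiv d P₁ P)
    (h2 : LatticeEquiv d P₂ P) : LatticeEquiv d P₁ P₂ := by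
  obtain ⟨σ, a1, a2⟩ := h1
  obtain ⟨τ, b1, b2⟩ := h2
  refine ⟨σ.trans τ.symm, ?_, ?_⟩
  · rw [AffineEquiv.coe_trans, Set.image_comp, a1]
    conv_lhs => rw [← b1]
    rw [← Set.image_comp]; simp
  · rw [AffineEquiv.coe_trans, Set.image_comp, ← a2, b2, ← Set.image_comp]; simp

theorem main_aux (m : ℕ) :
    ∃ c : ℝ, 0 < c ∧ ∀ w : ℕ, 0 < w → Odd w →
      Finite (ClassesType (m+2) (fun P => IsCentrallySymmetric (m+2) P ∧
        (latticePts (m+2) P).ncard = w)) ∧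
      (Nat.card (ClassesType (m+2) (fun P => IsCentrallySymmetric (m+2) P ∧
          (latticePts (m+2) P).ncard = w)) : ℝ) ≤
        Real.exp (c * (w : ℝ) ^ (((m+1 : ℕ):ℝ) / ((m+1:ℕ) + 2))) := by
  classical
  have hc0 : 0 < (cvol (m+1)).toReal := ENNReal.toReal_pos (cvol_pos _).ne' (cvol_ne_top _)
  obtain ⟨C, hC, hred⟩ := reduce (m+2) (by omega)
  obtain ⟨C1, hC1, hD⟩ := count_D m
  obtain ⟨C2, hC2, hS⟩ := count_S (m+1) (2^(m+2) / (cvol (m+1)).toReal) (by positivity)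
  set e : ℝ := ((m+1 : ℕ):ℝ) / ((m+1:ℕ) + 2) with he
  have he0 : 0 < e := by positivity
  refine ⟨(C1 + C2) * C^e + (m+3) * ((2*C+1)^e / e), by positivity, ?_⟩
  intro w hw hodd
  have hwR : (1:ℝ) ≤ w := by exact_mod_cast hw
  let N : ℕ := ⌊C * w⌋₊
  have hN : (N:ℝ) ≤ C * w := Nat.floor_le (by positivity)
  let G : Finset (Fin (m+2) → ℕ) := (Fintype.piFinset fun _ => Finset.Icc 1 N).filter
    (fun g => Antitone g ∧ ∏ j, (g j : ℝ) ≤ C * w)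
  have hGmem : ∀ g : Fin (m+2) → ℕ, Antitone g → (∀ j, 1 ≤ g j) → ∏ j, (g j : ℝ) ≤ C * w → g ∈ G := by
    intro g h1 h2 h3
    simp only [G, Finset.mem_filter, Fintype.mem_piFinset, Finset.mem_Icc]
    refine ⟨fun j => ⟨h2 j, ?_⟩, h1, h3⟩
    apply Nat.le_floor
    refine le_trans ?_ h3
    have : g j ≤ ∏ i, g i := Finset.single_le_prod' (fun i _ => h2 i) (Finset.mem_univ j)
    exact_mod_cast this
  have hDfin : ∀ g : Fin (m+2) → ℕ, (DSet m (fun i => g i.succ)).Finite := fun g => (DSet_count m _).1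
  have hSfin : ∀ g ∈ G, (FVSet (m+1) (2^(m+2) / (cvol (m+1)).toReal) g).Finite ∧
      ((FVSet (m+1) (2^(m+2) / (cvol (m+1)).toReal) g).ncard : ℝ) ≤ Real.exp (C2 * (∏ i, (g i:ℝ))^e) := by
    intro g hg
    simp only [G, Finset.mem_filter, Fintype.mem_piFinset, Finset.mem_Icc] at hg
    exact hS g (fun j => (hg.1 j).1) (fun j => hg.2.1 (Fin.zero_le j))
  let Z : (Fin (m+2) → ℕ) → Finset (Set (Fin (m+1) → ℤ) × Finset (Fin (m+2) → ℤ) × ℤ) := fun g =>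
    if hg : g ∈ G then
      (hDfin g).toFinset ×ˢ ((hSfin g hg).1.toFinset ×ˢ Finset.Icc (-(g 0 : ℤ)) (g 0)) else ∅
  let W := G.sigma Z
  have hWcard : (W.card : ℝ) ≤ Real.exp (((C1 + C2) * C^e + (m+3) * ((2*C+1)^e / e)) * (w:ℝ)^e) := by
    have hZ : ∀ g ∈ G, ((Z g).card : ℝ) ≤ Real.exp ((C1 + C2) * (C * w)^e) * (2 * N + 1) := by
      intro g hg
      have hSb := (hSfin g hg).2
      have hg' := hg
      simp only [G, Finset.mem_filter, Fintype.mem_piFinset, Finset.mem_Icc] at hg'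
      have hDb := hD g (fun j => (hg'.1 j).1) hg'.2.1
      have hX : (∏ i, (g i:ℝ))^e ≤ (C * w)^e := by
        apply Real.rpow_le_rpow (Finset.prod_nonneg (fun _ _ => by positivity)) hg'.2.2 he0.le
      simp only [Z, hg, dif_pos, Finset.card_product]
      rw [← Set.ncard_eq_toFinset_card _ (hDfin g), ← Set.ncard_eq_toFinset_card _ (hSfin g hg).1, Int.card_Icc]
      have hI : (((g 0 : ℤ) + 1 - -(g 0 : ℤ)).toNat : ℝ) ≤ 2 * N + 1 := by
        have : ((g 0 : ℤ) + 1 - -(g 0 : ℤ)).toNat ≤ 2 * N + 1 := by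
          have := (hg'.1 0).2; omega
        exact_mod_cast this
      push_cast
      calc _ ≤ Real.exp (C1 * (∏ i, (g i:ℝ))^e) * (Real.exp (C2 * (∏ i, (g i:ℝ))^e) * (2 * N + 1)) := by
            gcongr
        _ ≤ Real.exp (C1 * (C * w)^e) * (Real.exp (C2 * (C * w)^e) * (2 * N + 1)) := by gcongr
        _ = _ := by rw [← mul_assoc, ← Real.exp_add]; ring_nf
    have hGc : (G.card : ℝ) ≤ (N:ℝ)^(m+2) := by
      have : G.card ≤ N^(m+2) := by
        refine (Finset.card_filter_le _ _).trans ?_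
        simp
      exact_mod_cast this
    have hlog : (2 * (N:ℝ) + 1)^(m+3) ≤ Real.exp ((m+3) * ((2*C+1)^e / e * (w:ℝ)^e)) := by
      have h1 : 2 * (N:ℝ) + 1 ≤ (2*C+1) * w := by nlinarith
      have h2 : 2 * (N:ℝ) + 1 ≤ Real.exp ((2*C+1)^e / e * (w:ℝ)^e) := by
        have h3 : (0:ℝ) < (2*C+1) * w := by positivity
        have h4 := Real.log_le_rpow_div h3.le he0
        rw [Real.mul_rpow (by positivity) (by positivity)] at h4
        calc _ ≤ _ := h1
          _ = Real.exp (Real.log ((2*C+1) * w)) := (Real.exp_log h3).symm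
          _ ≤ _ := by
            apply Real.exp_le_exp.2
            calc _ ≤ _ := h4
              _ = _ := by ring
      calc _ ≤ (Real.exp ((2*C+1)^e / e * (w:ℝ)^e))^(m+3) := by gcongr
        _ = _ := by rw [← Real.exp_nat_mul]; push_cast; ring_nf
    calc (W.card : ℝ) = ∑ g ∈ G, ((Z g).card : ℝ) := by
          rw [Finset.card_sigma]; push_cast; rfl
      _ ≤ ∑ g ∈ G, Real.exp ((C1 + C2) * (C * w)^e) * (2 * N + 1) := Finset.sum_le_sum hZ
      _ = G.card * (Real.exp ((C1 + C2) * (C * w)^e) * (2 * N + 1)) := by simp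
      _ ≤ (2 * (N:ℝ) + 1)^(m+2) * (Real.exp ((C1 + C2) * (C * w)^e) * (2 * N + 1)) := by
          gcongr
          refine hGc.trans ?_
          gcongr
          have : (0:ℝ) ≤ N := by positivity
          linarith
      _ = Real.exp ((C1 + C2) * (C * w)^e) * (2 * (N:ℝ) + 1)^(m+3) := by ring
      _ ≤ Real.exp ((C1 + C2) * (C * w)^e) * Real.exp ((m+3) * ((2*C+1)^e / e * (w:ℝ)^e)) := by gcongr
      _ = _ := by
          rw [← Real.exp_add, Real.mul_rpow hC.le (by positivity)]; ring_nf
  let K := ClassesType (m+2) (fun P => IsCentrallySymmetric (m+2) P ∧ (latticePts (m+2) P).ncard = w)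
  have hcode : ∀ κ : K, ∃ z : W, ∃ P : {P : Set (Fin (m+2) → ℝ) // IsConvexLatticePolytope (m+2) P ∧
      IsFullDim (m+2) P ∧ IsCentrallySymmetric (m+2) P ∧ (latticePts (m+2) P).ncard = w},
      Quot.mk _ P = κ ∧ ∃ P', LatticeEquiv (m+2) P.1 P' ∧ IsCode m P' z.1.2.1 z.1.2.2.1 z.1.2.2.2 := by
    intro κ
    obtain ⟨P, rfl⟩ := Quot.exists_rep κ
    obtain ⟨P', hP', p1, p2, p3, g, g1, g2, g3, g4⟩ := hred P.1 w P.2.1 P.2.2.1 P.2.2.2.1 P.2.2.2.2 hodd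
    obtain ⟨E, hE, S, hS, s, hs, hcd⟩ := code_poly m P' p1 p2 p3 g g3
    have hgG := hGmem g g1 g2 g4
    refine ⟨⟨⟨g, (E, S, s)⟩, ?_⟩, P, rfl, P', hP', hcd⟩
    simp only [W, Finset.mem_sigma]
    refine ⟨hgG, ?_⟩
    simp only [Z, hgG, dif_pos, Finset.mem_product, Set.Finite.mem_toFinset]
    exact ⟨hE, hS, hs⟩
  choose f P hP P' hP' hcd using hcode
  have hinj : Function.Injective f := by
    intro κ κ' h
    have h1 := hcd κ
    rw [h] at h1
    have h2 := h1.unique (hcd κ')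
    have h3 := hP' κ
    rw [h2] at h3
    rw [← hP κ, ← hP κ']
    exact Quot.sound (h3.comm_trans (hP' κ'))
  refine ⟨Finite.of_injective f hinj, ?_⟩
  refine le_trans ?_ hWcard
  have := Nat.card_le_card_of_injective f hinj
  have hWc : Nat.card W = W.card := by rw [Nat.card_eq_fintype_card, Fintype.card_coe]
  rw [hWc] at this
  exact_mod_cast this

end

/-- For every `d ≥ 2`, the number `κ*(d,w)` of equivalence classes of centrally
symmetric `d`-dimensional convex lattice polytopes with `w` lattice points is
finite for odd `w`, and `κ*(d,w) ≤ exp(c w^{(d-1)/(d+1)})`. -/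
theorem kappastar_upper (d : ℕ) (hd : 2 ≤ d) :
    ∃ c : ℝ, 0 < c ∧ ∀ w : ℕ, 0 < w → Odd w →
      Finite (ClassesType d (fun P => IsCentrallySymmetric d P ∧
        (latticePts d P).ncard = w)) ∧
      (Nat.card (ClassesType d (fun P => IsCentrallySymmetric d P ∧
          (latticePts d P).ncard = w)) : ℝ) ≤
        Real.exp (c * (w : ℝ) ^ (((d : ℝ) - 1) / ((d : ℝ) + 1))) := by
  obtain ⟨m, rfl⟩ : ∃ m, d = m + 2 := ⟨d - 2, by omega⟩
  have e : (((m + 2 : ℕ) : ℝ) - 1) / (((m + 2 : ℕ) : ℝ) + 1) = ((m+1 : ℕ):ℝ) / ((m+1:ℕ) + 2) := by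
    push_cast; ring_nf
  rw [e]
  exact main_aux m

end
end

section
/- Let d ≥ 3 and w ≥ d + 1 be integers, let e₁, …, e_d be the standard basis of ℝ^d, and define P(d,w,k) as the convex hull of the set {0} ∪ {e_i : 1 ≤ i ≤ d−1} ∪ {−j·e_d : 1 ≤ j ≤ w−d−1} ∪ {e₁ + ⋯ + e_{d−1} + k·e_d}. If k₁ and k₂ are distinct integers with k₁, k₂ ≥ (d−2)(w−d−1), then P(d,w,k₁) and P(d,w,k₂) are not equivalent. -/
open MeasureTheory

noncomputable section

/-- The polytope `P(d,w,k)`: the convex hull of `0`, the basis vectors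
`e₁, …, e_{d-1}`, the points `-j·e_d` for `1 ≤ j ≤ w - d - 1`, and the point
`e₁ + ⋯ + e_{d-1} + k·e_d` (here `e_d` is the last coordinate direction). -/
def Pdwk (d w : ℕ) (k : ℤ) : Set (Fin d → ℝ) :=
  convexHull ℝ ({0} ∪ {x | ∃ i : Fin d, (i : ℕ) < d - 1 ∧ x = Pi.single i 1}
    ∪ {x | ∃ j : ℕ, 1 ≤ j ∧ j ≤ w - d - 1 ∧
        x = fun i : Fin d => if (i : ℕ) = d - 1 then -(j : ℝ) else 0}
    ∪ {fun i : Fin d => if (i : ℕ) = d - 1 then (k : ℝ) else 1})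

/-- explicit description -/
def RR (n : ℕ) (m k : ℝ) : Set (Fin (n+1) → ℝ) :=
  {x | ∃ c b : ℝ, 0 ≤ c ∧ 0 ≤ b ∧ (∀ i : Fin n, c ≤ x i.castSucc) ∧
    (∑ i : Fin n, (x i.castSucc - c)) + b + c ≤ 1 ∧ x (Fin.last n) = c * k - m * b}

/-- upper piece, normalised -/
def SS (n : ℕ) : Set (Fin (n+1) → ℝ) :=
  {x | 0 ≤ x (Fin.last n) ∧ (∀ i : Fin n, x (Fin.last n) ≤ x i.castSucc) ∧
    (∑ i : Fin n, (x i.castSucc - x (Fin.last n))) + x (Fin.last n) ≤ 1}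

/-- lower piece -/
def LL (n : ℕ) (m : ℝ) : Set (Fin (n+1) → ℝ) :=
  {x | x (Fin.last n) < 0 ∧ (∀ i : Fin n, 0 ≤ x i.castSucc) ∧
    ∃ b : ℝ, 0 ≤ b ∧ (∑ i : Fin n, x i.castSucc) + b ≤ 1 ∧ x (Fin.last n) = - (m * b)}

/-- scaling of the last coordinate -/
def DD (n : ℕ) (k : ℝ) : (Fin (n+1) → ℝ) →ₗ[ℝ] (Fin (n+1) → ℝ) :=
  Matrix.toLin' (Matrix.diagonal (fun i => if i = Fin.last n then k else 1))

lemma DD_last (n : ℕ) (k : ℝ) (x) : DD n k x (Fin.last n) = k * x (Fin.last n) := by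
  simp [DD, Matrix.mulVec_diagonal]

lemma DD_castSucc (n : ℕ) (k : ℝ) (x) (i : Fin n) : DD n k x i.castSucc = x i.castSucc := by
  simp [DD, Matrix.mulVec_diagonal, (Fin.castSucc_lt_last i).ne]

lemma DD_det (n : ℕ) (k : ℝ) : LinearMap.det (DD n k) = k := by
  simp [DD, LinearMap.det_toLin', Finset.prod_ite_eq']

lemma RR_convex (n : ℕ) (m k : ℝ) : Convex ℝ (RR n m k) := by
  rintro x ⟨c, b, hc, hb, h1, h2, h3⟩ y ⟨c', b', hc', hb', h1', h2', h3'⟩ s t hs ht hst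
  refine ⟨s * c + t * c', s * b + t * b', by positivity, by positivity, ?_, ?_, ?_⟩
  · intro i
    simp only [Pi.add_apply, Pi.smul_apply, smul_eq_mul]
    have := mul_le_mul_of_nonneg_left (h1 i) hs
    have := mul_le_mul_of_nonneg_left (h1' i) ht
    linarith
  · have e : ∑ i : Fin n, ((s • x + t • y) i.castSucc - (s * c + t * c'))
        = s * ∑ i : Fin n, (x i.castSucc - c) + t * ∑ i : Fin n, (y i.castSucc - c') := by
      rw [Finset.mul_sum, Finset.mul_sum, ← Finset.sum_add_distrib]
      refine Finset.sum_congr rfl fun i _ => ?_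
      simp only [Pi.add_apply, Pi.smul_apply, smul_eq_mul]
      ring
    rw [e]
    have := mul_le_mul_of_nonneg_left h2 hs
    have := mul_le_mul_of_nonneg_left h2' ht
    linarith
  · simp only [Pi.add_apply, Pi.smul_apply, smul_eq_mul, h3, h3']
    ring

lemma last_iff {n : ℕ} (i : Fin (n+1)) : ((i : ℕ) = n + 1 - 1) ↔ i = Fin.last n := by
  rw [Fin.ext_iff]; simp

lemma Pdwk_eq (n m : ℕ) (k : ℤ) : Pdwk (n+1) (n+1+1+m) k = RR n m k := by
  have hm : n + 1 + 1 + m - (n+1) - 1 = m := by omega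
  unfold Pdwk
  rw [hm]
  simp only [last_iff]
  apply Set.Subset.antisymm
  · apply convexHull_min _ (RR_convex n m k)
    rintro x (((hx | ⟨i, hi, hx⟩) | ⟨j, hj1, hj2, hx⟩) | hx)
    · rw [Set.mem_singleton_iff] at hx
      subst hx
      exact ⟨0, 0, le_rfl, le_rfl, by simp, by simp, by simp⟩
    · subst hx
      have hil : i ≠ Fin.last n := by
        rintro rfl; simp at hi
      obtain ⟨i', rfl⟩ := Fin.exists_castSucc_eq.mpr hil
      refine ⟨0, 0, le_rfl, le_rfl, ?_, ?_, ?_⟩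
      · intro l
        by_cases h : l = i'
        · subst h; simp
        · rw [Pi.single_eq_of_ne]
          simpa using h
      · simp only [sub_zero, add_zero]
        rw [Finset.sum_eq_single i']
        · simp
        · intro b _ hb
          rw [Pi.single_eq_of_ne]; simpa using hb
        · simp
      · rw [Pi.single_eq_of_ne hil.symm]; simp
    · subst hx
      have hmpos : (0:ℝ) < m := by exact_mod_cast (by omega : 0 < m)
      refine ⟨0, j / m, le_rfl, by positivity, ?_, ?_, ?_⟩
      · intro l; simp [(Fin.castSucc_lt_last l).ne]
      · simp only [(Fin.castSucc_lt_last _).ne]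
        have : (j:ℝ) ≤ m := by exact_mod_cast hj2
        simpa using (div_le_one hmpos).2 this
      · simp; field_simp
    · rw [Set.mem_singleton_iff] at hx
      subst hx
      refine ⟨1, 0, zero_le_one, le_rfl, ?_, ?_, ?_⟩
      · intro l; simp [(Fin.castSucc_lt_last l).ne]
      · simp [(Fin.castSucc_lt_last _).ne]
      · simp
  · rintro x ⟨c, b, hc, hb, h1, h2, h3⟩
    set G := ({0} ∪ {x | ∃ i : Fin (n+1), (i : ℕ) < n + 1 - 1 ∧ x = Pi.single i 1}
      ∪ {x | ∃ j : ℕ, 1 ≤ j ∧ j ≤ m ∧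
        x = fun i : Fin (n+1) => if i = Fin.last n then -(j : ℝ) else 0}
      ∪ {fun i : Fin (n+1) => if i = Fin.last n then (k : ℝ) else 1} : Set (Fin (n+1) → ℝ))
      with hG
    let u : Fin (n+1) → ℝ := fun i => if i = Fin.last n then -(m : ℝ) else 0
    let v : Fin (n+1) → ℝ := fun i => if i = Fin.last n then (k : ℝ) else 1
    let wt : Fin n ⊕ Fin 3 → ℝ := Sum.elim (fun i => x i.castSucc - c)
      ![1 - ((∑ i : Fin n, (x i.castSucc - c)) + b + c), b, c]
    let pt : Fin n ⊕ Fin 3 → (Fin (n+1) → ℝ) :=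
      Sum.elim (fun i => Pi.single i.castSucc 1) ![0, u, v]
    have h0 : (0 : Fin (n+1) → ℝ) ∈ convexHull ℝ G :=
      subset_convexHull ℝ G (Or.inl (Or.inl (Or.inl rfl)))
    have hu : u ∈ convexHull ℝ G := by
      by_cases hm0 : m = 0
      · have : u = 0 := by
          funext i; simp [u, hm0]
        rw [this]; exact h0
      · exact subset_convexHull ℝ G (Or.inl (Or.inr ⟨m, by omega, le_rfl, rfl⟩))
    have hv : v ∈ convexHull ℝ G := subset_convexHull ℝ G (Or.inr rfl)
    have key : ∑ s, wt s • pt s ∈ convexHull ℝ G := by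
      apply (convex_convexHull ℝ G).sum_mem
      · rintro (i | i) _
        · simpa [wt] using h1 i
        · fin_cases i
          · simpa [wt] using h2
          · simpa [wt] using hb
          · simpa [wt] using hc
      · simp only [Fintype.sum_sum_type, Fin.sum_univ_three, wt, Sum.elim_inl, Sum.elim_inr]
        simp
        ring
      · rintro (i | i) _
        · exact subset_convexHull ℝ G (Or.inl (Or.inl (Or.inr ⟨i.castSucc, by simp, rfl⟩)))
        · fin_cases i
          · simpa [pt] using h0
          · simpa [pt] using hu
          · simpa [pt] using hv
    convert key using 1
    funext i
    simp only [Fintype.sum_sum_type, Fin.sum_univ_three, wt, pt, Sum.elim_inl, Sum.elim_inr]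
    refine Fin.lastCases ?_ (fun l => ?_) i
    · simp [u, v, h3, Finset.sum_apply, Pi.single_apply, (Fin.castSucc_lt_last _).ne']
      ring
    · simp [u, v, Finset.sum_apply, Pi.single_apply, (Fin.castSucc_lt_last _).ne]

lemma sum_sub_c (n : ℕ) (x : Fin (n+1) → ℝ) (c : ℝ) :
    ∑ i : Fin n, (x i.castSucc - c) = ∑ i : Fin n, x i.castSucc - n * c := by
  simp [Finset.sum_sub_distrib]

lemma RR_upper (n : ℕ) (m k : ℝ) (hn : 2 ≤ n) (hm : 0 ≤ m) (hk : (n - 1) * m ≤ k) :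
    RR n m k ∩ {x | 0 ≤ x (Fin.last n)} = DD n k '' SS n := by
  have hn' : (2:ℝ) ≤ n := by exact_mod_cast hn
  have hk0 : 0 ≤ k := le_trans (mul_nonneg (by linarith) hm) hk
  apply Set.Subset.antisymm
  · rintro x ⟨⟨c, b, hc, hb, h1, h2, h3⟩, h0⟩
    simp only [Set.mem_ofPred_eq] at h0
    obtain ⟨c', hc'0, hc'c, hc'x, hsum⟩ : ∃ c' : ℝ, 0 ≤ c' ∧ c' ≤ c ∧ x (Fin.last n) = k * c' ∧
        (n - 1) * (c - c') ≤ b := by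
      rcases hk0.eq_or_lt with hk0 | hk0
      · refine ⟨c, hc, le_rfl, ?_, by simpa using hb⟩
        rw [← hk0] at h3 ⊢
        have := mul_nonneg hm hb
        linarith
      · have hmb := mul_nonneg hm hb
        refine ⟨x (Fin.last n) / k, by positivity, ?_, by field_simp, ?_⟩
        · rw [div_le_iff₀ hk0]; linarith
        · have : c - x (Fin.last n) / k = m * b / k := by
            rw [h3]; field_simp; ring
          rw [this, ← mul_div_assoc, div_le_iff₀ hk0]
          have := mul_le_mul_of_nonneg_right hk hb
          linarith
    refine ⟨Fin.lastCases c' (fun i => x i.castSucc), ⟨?_, ?_, ?_⟩, ?_⟩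
    · simpa using hc'0
    · intro i; simpa using hc'c.trans (h1 i)
    · simp only [Fin.lastCases_last, Fin.lastCases_castSucc]
      rw [sum_sub_c] at h2 ⊢
      linarith
    · funext i
      refine Fin.lastCases ?_ (fun l => ?_) i
      · rw [DD_last, hc'x]; simp
      · rw [DD_castSucc]; simp
  · rintro _ ⟨x, ⟨h0, h1, h2⟩, rfl⟩
    refine ⟨⟨x (Fin.last n), 0, h0, le_rfl, ?_, ?_, ?_⟩, ?_⟩
    · intro i; rw [DD_castSucc]; exact h1 i
    · simp only [DD_castSucc]; simpa using h2
    · rw [DD_last]; ring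
    · simp only [Set.mem_ofPred_eq, DD_last]; positivity

lemma RR_lower (n : ℕ) (m k : ℝ) (hn : 2 ≤ n) (hm : 0 ≤ m) (hk : (n - 1) * m ≤ k) :
    RR n m k \ {x | 0 ≤ x (Fin.last n)} = LL n m := by
  have hn' : (2:ℝ) ≤ n := by exact_mod_cast hn
  have hk0 : 0 ≤ k := le_trans (mul_nonneg (by linarith) hm) hk
  apply Set.Subset.antisymm
  · rintro x ⟨⟨c, b, hc, hb, h1, h2, h3⟩, h0⟩
    simp only [Set.mem_ofPred_eq, not_le] at h0
    have hck := mul_nonneg hc hk0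
    have hm' : 0 < m := by
      rcases hm.eq_or_lt with h | h
      · rw [← h] at h3; linarith
      · exact h
    refine ⟨h0, fun i => hc.trans (h1 i), -x (Fin.last n) / m, ?_, ?_, ?_⟩
    · apply div_nonneg _ hm; linarith
    · rw [sum_sub_c] at h2
      have : -x (Fin.last n) / m = b - c * k / m := by
        rw [h3]; field_simp; ring
      rw [this]
      have : (n - 1) * c ≤ c * k / m := by
        rw [le_div_iff₀ hm']
        have := mul_le_mul_of_nonneg_left hk hc
        linarith
      linarith
    · field_simp
  · rintro x ⟨h0, h1, b, hb, h2, h3⟩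
    refine ⟨⟨0, b, le_rfl, hb, h1, ?_, ?_⟩, ?_⟩
    · simpa using h2
    · rw [h3]; ring
    · simpa using h0

lemma vol_RR (n : ℕ) (m k : ℝ) (hn : 2 ≤ n) (hm : 0 ≤ m) (hk : (n - 1) * m ≤ k) :
    volume (RR n m k) = ENNReal.ofReal k * volume (SS n) + volume (LL n m) := by
  have hn' : (2:ℝ) ≤ n := by exact_mod_cast hn
  have hk0 : 0 ≤ k := le_trans (mul_nonneg (by linarith) hm) hk
  have hH : MeasurableSet {x : Fin (n+1) → ℝ | 0 ≤ x (Fin.last n)} :=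
    measurableSet_le measurable_const (measurable_pi_apply _)
  rw [← measure_inter_add_sdiff (RR n m k) hH, RR_upper n m k hn hm hk, RR_lower n m k hn hm hk,
    Measure.addHaar_image_linearMap, DD_det, abs_of_nonneg hk0]

lemma vol_LL (n : ℕ) (m : ℝ) (hm : 0 ≤ m) : volume (LL n m) ≠ ⊤ := by
  have : LL n m ⊆ Set.Icc (fun _ => -m) (fun _ => 1) := by
    rintro x ⟨h0, h1, b, hb, h2, h3⟩
    have hs : 0 ≤ ∑ i : Fin n, x i.castSucc := Finset.sum_nonneg fun i _ => h1 i
    constructor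
    · intro i
      refine Fin.lastCases ?_ (fun l => ?_) i
      · show -m ≤ _
        rw [h3]
        have : m * b ≤ m * 1 := mul_le_mul_of_nonneg_left (by linarith) hm
        linarith
      · have := h1 l
        show -m ≤ _
        linarith
    · intro i
      refine Fin.lastCases ?_ (fun l => ?_) i
      · show _ ≤ (1:ℝ)
        linarith
      · have := Finset.single_le_sum (f := fun i : Fin n => x i.castSucc)
          (fun i _ => h1 i) (Finset.mem_univ l)
        show _ ≤ (1:ℝ)
        linarith
  exact ((measure_mono this).trans_lt isCompact_Icc.measure_lt_top).ne

lemma vol_SS (n : ℕ) : volume (SS n) ≠ ⊤ := by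
  have : SS n ⊆ Set.Icc (fun _ => 0) (fun _ => 1) := by
    rintro x ⟨h0, h1, h2⟩
    have hs : 0 ≤ ∑ i : Fin n, (x i.castSucc - x (Fin.last n)) :=
      Finset.sum_nonneg fun i _ => sub_nonneg.2 (h1 i)
    constructor
    · intro i
      refine Fin.lastCases h0 (fun l => h0.trans (h1 l)) i
    · intro i
      refine Fin.lastCases ?_ (fun l => ?_) i
      · show _ ≤ (1:ℝ)
        linarith
      · have := Finset.single_le_sum (f := fun i : Fin n => x i.castSucc - x (Fin.last n))
          (fun i _ => sub_nonneg.2 (h1 i)) (Finset.mem_univ l)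
        show _ ≤ (1:ℝ)
        linarith
  exact ((measure_mono this).trans_lt isCompact_Icc.measure_lt_top).ne

lemma vol_SS_pos (n : ℕ) : volume (SS n) ≠ 0 := by
  let U : Set (Fin (n+1) → ℝ) :=
    {x | 0 < x (Fin.last n)} ∩ (⋂ i : Fin n, {x | x (Fin.last n) < x i.castSucc}) ∩
    {x | (∑ i : Fin n, (x i.castSucc - x (Fin.last n))) + x (Fin.last n) < 1}
  have hU : IsOpen U := by
    refine (IsOpen.inter ?_ (isOpen_iInter_of_finite fun i => ?_)).inter ?_
    · exact isOpen_lt (by fun_prop) (by fun_prop)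
    · exact isOpen_lt (by fun_prop) (by fun_prop)
    · exact isOpen_lt (by fun_prop) (by fun_prop)
  have hne : U.Nonempty := by
    have hp : (0:ℝ) < 1 / (n + 2) := by positivity
    refine ⟨Fin.lastCases (1 / ((n:ℝ)+2)) (fun _ => 2 * (1 / ((n:ℝ)+2))), ⟨?_, ?_⟩, ?_⟩
    · simpa using (by positivity : (0:ℝ) < n + 2)
    · simp only [Set.mem_iInter, Set.mem_ofPred_eq, Fin.lastCases_last, Fin.lastCases_castSucc]
      intro _; linarith
    · simp only [Set.mem_ofPred_eq, Fin.lastCases_last, Fin.lastCases_castSucc,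
        Finset.sum_const, Finset.card_univ, Fintype.card_fin, nsmul_eq_mul]
      have : (1 / ((n:ℝ)+2)) * (n + 2) = 1 := by field_simp
      linarith
  have hsub : U ⊆ SS n := by
    rintro x ⟨⟨h0, h1⟩, h2⟩
    simp only [Set.mem_iInter, Set.mem_ofPred_eq] at h0 h1 h2
    exact ⟨h0.le, fun i => (h1 i).le, h2.le⟩
  intro h
  exact (hU.measure_pos volume hne).ne' (measure_mono_null hsub h)

lemma int_matrix {d : ℕ} (f : (Fin d → ℝ) →ₗ[ℝ] (Fin d → ℝ))
    (hf : ∀ x ∈ latticeSet d, f x ∈ latticeSet d) :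
    ∃ N : ℤ, LinearMap.det f = (N : ℝ) := by
  have h : ∀ j : Fin d, ∃ y : Fin d → ℤ, intVec y = f (Pi.single j 1) := by
    intro j
    refine hf _ ⟨Pi.single j 1, ?_⟩
    funext i
    by_cases hij : i = j
    · subst hij; simp [intVec]
    · simp [intVec, hij]
  choose y hy using h
  refine ⟨(Matrix.of fun i j => y j i).det, ?_⟩
  rw [← LinearMap.det_toMatrix', ← eq_intCast (Int.castRingHom ℝ), RingHom.map_det]
  congr 1
  ext i j
  rw [LinearMap.toMatrix'_apply]
  have := congrFun (hy j) i
  simp only [intVec] at this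
  simp [this]

lemma latticeSet_sub {d : ℕ} {x y : Fin d → ℝ} (hx : x ∈ latticeSet d) (hy : y ∈ latticeSet d) :
    x - y ∈ latticeSet d := by
  obtain ⟨a, rfl⟩ := hx
  obtain ⟨b, rfl⟩ := hy
  exact ⟨a - b, by funext i; simp [intVec]⟩

lemma int_affine {d : ℕ} (σ : (Fin d → ℝ) ≃ᵃ[ℝ] (Fin d → ℝ))
    (h : ∀ x ∈ latticeSet d, σ x ∈ latticeSet d) :
    ∃ N : ℤ, LinearMap.det (σ.linear : (Fin d → ℝ) →ₗ[ℝ] (Fin d → ℝ)) = (N : ℝ) := by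
  apply int_matrix
  intro x hx
  have h0 : (0 : Fin d → ℝ) ∈ latticeSet d := ⟨0, by funext i; simp [intVec]⟩
  have := latticeSet_sub (h x hx) (h 0 h0)
  have e : σ x = σ.linear x + σ 0 := by
    simpa using σ.map_vadd 0 x
  rw [e, add_sub_cancel_right] at this
  exact this

lemma vol_equiv {d : ℕ} {P Q : Set (Fin d → ℝ)} (h : LatticeEquiv d P Q) :
    volume Q = volume P := by
  obtain ⟨σ, hσ, rfl⟩ := h
  obtain ⟨N, hN⟩ := int_affine σ (fun x hx => hσ ▸ Set.mem_image_of_mem σ hx)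
  obtain ⟨N', hN'⟩ := int_affine σ.symm (by
    intro x hx
    rw [← hσ] at hx
    obtain ⟨y, hy, rfl⟩ := hx
    simpa using hy)
  have hmul : (N : ℝ) * N' = 1 := by
    rw [← hN, ← hN', ← LinearMap.det_comp]
    have : (σ.linear : (Fin d → ℝ) →ₗ[ℝ] (Fin d → ℝ)) ∘ₗ
        (σ.symm.linear : (Fin d → ℝ) →ₗ[ℝ] (Fin d → ℝ)) = LinearMap.id := by
      ext1 x
      simp
    rw [this, LinearMap.det_id]
  have hmul' : N * N' = 1 := by exact_mod_cast hmul
  have habs : |(N : ℝ)| = 1 := by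
    have := Int.isUnit_iff_abs_eq.1 (IsUnit.of_mul_eq_one _ hmul')
    exact_mod_cast this
  have himg : σ '' P = (fun y => y + σ 0) ''
      ((σ.linear : (Fin d → ℝ) →ₗ[ℝ] (Fin d → ℝ)) '' P) := by
    rw [Set.image_image]
    apply Set.image_congr
    intro x _
    simpa using σ.map_vadd 0 x
  rw [himg, Set.image_add_right, measure_preimage_add_right, Measure.addHaar_image_linearMap,
    hN, habs]
  simp

/-- For `d ≥ 3`, `w ≥ d + 1` and distinct `k₁, k₂ ≥ (d-2)(w-d-1)`, the polytopes
`P(d,w,k₁)` and `P(d,w,k₂)` are not equivalent. -/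
theorem Pdwk_not_equiv (d w : ℕ) (k₁ k₂ : ℤ) (hd : 3 ≤ d) (hw : d + 1 ≤ w)
    (hk₁ : ((d : ℤ) - 2) * ((w : ℤ) - d - 1) ≤ k₁)
    (hk₂ : ((d : ℤ) - 2) * ((w : ℤ) - d - 1) ≤ k₂) (hne : k₁ ≠ k₂) :
    ¬ LatticeEquiv d (Pdwk d w k₁) (Pdwk d w k₂) := by
  intro h
  obtain ⟨n, rfl⟩ : ∃ n, d = n + 1 := ⟨d - 1, by omega⟩
  obtain ⟨m, rfl⟩ : ∃ m, w = n + 1 + 1 + m := ⟨w - (n + 1 + 1), by omega⟩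
  have hv := vol_equiv h
  have hn : 2 ≤ n := by omega
  have hm : (0:ℝ) ≤ m := by positivity
  have conv : ∀ k : ℤ, (((n + 1 : ℕ) : ℤ) - 2) * (((n + 1 + 1 + m : ℕ) : ℤ) - (n + 1 : ℕ) - 1) ≤ k →
      ((n:ℝ) - 1) * m ≤ k := by
    intro k hk
    have : ((n:ℤ) - 1) * m ≤ k := by
      convert hk using 1
      push_cast
      ring
    exact_mod_cast this
  have h1 := conv k₁ hk₁
  have h2 := conv k₂ hk₂
  have hn' : (2:ℝ) ≤ n := by exact_mod_cast hn
  have p1 : (0:ℝ) ≤ k₁ := le_trans (mul_nonneg (by linarith) hm) h1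
  have p2 : (0:ℝ) ≤ k₂ := le_trans (mul_nonneg (by linarith) hm) h2
  rw [Pdwk_eq, Pdwk_eq, vol_RR n m k₁ hn hm h1, vol_RR n m k₂ hn hm h2,
    ENNReal.add_left_inj (vol_LL n m hm),
    ENNReal.mul_left_inj (vol_SS_pos n) (vol_SS n),
    ENNReal.ofReal_eq_ofReal_iff p2 p1] at hv
  exact hne (by exact_mod_cast hv.symm)

end
end
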